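/- arXiv:2306.07943 — 3 statements merged into one kernel-verified Lean document; each statement's English description precedes it below -/
import Mathlib

section
/- Let n ≤ m be natural numbers, let Ω ⊂ ℝ^n be open, and let f : closure(Ω) → ℝ^m be a Lipschitz map. Let x ∈ Ω be a point such that the Fréchet derivative f'(x) exists, vol f'(x) > 0, and x is a Lebesgue point of the almost-everywhere defined function y ↦ vol f'(y) (i.e. the averages of vol f' over B(x,r) converge to vol f'(x) as r → 0). Then for every η ∈ (0,1) there exist r₀ > 0 with B(x,r₀) ⊂ Ω and δ > 0 such that for every r ≤ r₀ and every continuous g : B(x,r) → ℝ^m with sup_{y ∈ B(x,r)} |g(y) − f(y)| ≤ δ r, one has H^n(g(B(x,r))) ≥ η · H^n(f(B(x,r))). -/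
open MeasureTheory Metric Set Filter Topology ENNReal

noncomputable section

abbrev Euc (n : ℕ) : Type := EuclideanSpace ℝ (Fin n)

/-- The matrix of a continuous linear map between Euclidean spaces. -/
def matrixOf {n m : ℕ} (A : Euc n →L[ℝ] Euc m) : Matrix (Fin m) (Fin n) ℝ :=
  Matrix.of fun i j => A (EuclideanSpace.single j 1) i

/-- `vol A = sqrt (det (Aᵀ A))`. -/
def volMap {n m : ℕ} (A : Euc n →L[ℝ] Euc m) : ℝ :=
  Real.sqrt ((Matrix.transpose (matrixOf A) * matrixOf A).det)

/-- `det (1 + T)` is a fixed affine combination of the values of `det (1 + t • T)` at any `n + 1` distinct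
parameters `t`. -/
theorem exists_det_one_add_eq_sum {n : ℕ} (t : ℕ → ℝ) (ht : Function.Injective t) :
    ∃ c : ℕ → ℝ, ∑ j ∈ Finset.range (n + 1), c j = 1 ∧
      ∀ T : Euc n →L[ℝ] Euc n, (1 + T).det =
        ∑ j ∈ Finset.range (n + 1), c j * (1 + t j • T).det := by
  refine ⟨fun j => (Lagrange.basis (Finset.range (n + 1)) t j).eval 1, ?_, fun T => ?_⟩
  · rw [← Polynomial.eval_finsetSum, Lagrange.sum_basis ht.injOn (by simp)]
    simp
  · set b := (EuclideanSpace.basisFun (Fin n) ℝ).toBasis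
    set M : Matrix (Fin n) (Fin n) ℝ := LinearMap.toMatrix b b T with hM
    set p : Polynomial ℝ := ((Polynomial.X : Polynomial ℝ) • M.map (Polynomial.C : ℝ →+* Polynomial ℝ) +
      (1 : Matrix (Fin n) (Fin n) ℝ).map (Polynomial.C : ℝ →+* Polynomial ℝ)).det with hp
    have hpe : ∀ s : ℝ, p.eval s = (1 + s • T).det := by
      intro s
      have h1 : (1 + s • T).det = (LinearMap.toMatrix b b
          ((1 + s • T : Euc n →L[ℝ] Euc n) : Euc n →ₗ[ℝ] Euc n)).det := by
        rw [LinearMap.det_toMatrix, ContinuousLinearMap.det]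
      have h2 : LinearMap.toMatrix b b ((1 + s • T : Euc n →L[ℝ] Euc n) : Euc n →ₗ[ℝ] Euc n) =
          1 + s • M := by
        rw [ContinuousLinearMap.toLinearMap_add, ContinuousLinearMap.toLinearMap_smul, map_add, map_smul]
        congr 1
        exact LinearMap.toMatrix_one b
      rw [h1, h2, hp, ← Polynomial.coe_evalRingHom, RingHom.map_det]
      congr 1
      ext i j
      simp [Matrix.one_apply, apply_ite, add_comm]
      ring
    have hdeg : p.degree < (Finset.range (n + 1)).card := by
      refine lt_of_le_of_lt Polynomial.degree_le_natDegree ?_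
      have := Polynomial.natDegree_det_X_add_C_le M 1
      rw [Finset.card_range]
      exact_mod_cast Nat.lt_succ_of_le (by simpa [hp] using this)
    have h := Lagrange.eq_interpolate (s := Finset.range (n + 1)) (v := t) ht.injOn hdeg
    have h1 := congrArg (Polynomial.eval 1) h
    rw [hpe, one_smul, Lagrange.interpolate_apply, Polynomial.eval_finsetSum] at h1
    rw [h1]
    refine Finset.sum_congr rfl fun j _ => ?_
    simp [hpe, mul_comm]

open scoped NNReal in
/-- A map with a small Lipschitz displacement supported in a ball preserves the volume of the ball. -/
theorem integral_det_one_add_fderiv_of_small {n : ℕ} {v : Euc n → Euc n} {l : ℝ≥0} (hl : l < 1)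
    (hv : LipschitzWith l v) (hdet : ∀ M : Euc n →L[ℝ] Euc n, ‖M‖ ≤ l → 0 < (1 + M).det)
    {z : Euc n} {R : ℝ} (hsupp : ∀ y ∉ closedBall z R, v y = 0) :
    IntegrableOn (fun y => (1 + fderiv ℝ v y).det) (closedBall z R) μH[n] ∧
    ∫ y in closedBall z R, (1 + fderiv ℝ v y).det ∂μH[n] = μH[n].real (closedBall z R) := by
  set B := closedBall z R
  set F : Euc n → Euc n := fun y => y + v y with hF
  have hmeas : Measurable fun y => (1 + fderiv ℝ v y).det :=
    ContinuousLinearMap.continuous_det.measurable.comp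
      ((measurable_fderiv ℝ v).const_add 1)
  have hpos : ∀ y, 0 < (1 + fderiv ℝ v y).det := fun y =>
    hdet _ (norm_fderiv_le_of_lipschitz ℝ hv)
  have hinj : Function.Injective F := by
    intro a b hab
    have h1 : dist a b = dist (v b) (v a) := by
      rw [dist_eq_norm, dist_eq_norm]
      congr 1
      rw [sub_eq_sub_iff_add_eq_add, add_comm (v b)]
      exact hab
    have h2 := hv.dist_le_mul b a
    have h3 : (l : ℝ) < 1 := by exact_mod_cast hl
    rw [dist_comm b a] at h2
    by_contra hne
    nlinarith [dist_pos.2 hne]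
  have hsurj : Function.Surjective F := by
    have : ApproximatesLinearOn F ((ContinuousLinearEquiv.refl ℝ (Euc n) : Euc n ≃L[ℝ] Euc n) :
        Euc n →L[ℝ] Euc n) univ l := by
      intro a _ b _
      have := hv.dist_le_mul a b
      rw [dist_eq_norm, dist_eq_norm] at this
      have e : a + v a - (b + v b) - (a - b) = v a - v b := by abel
      rw [← e] at this
      exact this
    refine this.surjective ?_
    rcases subsingleton_or_nontrivial (Euc n) with h | h
    · exact Or.inl h
    · right
      simpa using hl
  have hFB : F '' B = B := by
    ext w
    constructor
    · rintro ⟨y, hy, rfl⟩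
      by_contra hw
      have : F (F y) = F y := by simp only [hF]; rw [hsupp (y + v y) hw, add_zero]
      exact hw (by rw [hinj this]; exact hy)
    · intro hw
      obtain ⟨y, rfl⟩ := hsurj w
      refine ⟨y, ?_, rfl⟩
      by_contra hy
      have : F y = y := by simp [hF, hsupp y hy]
      exact hy (this ▸ hw)
  have hFL : LipschitzWith (1 + l) F := LipschitzWith.id.add hv
  set D := B ∩ {y | DifferentiableAt ℝ v y} with hD
  have hDm : MeasurableSet D :=
    isClosed_closedBall.measurableSet.inter (measurableSet_of_differentiableAt ℝ v)
  have hae : D =ᵐ[μH[n]] B := by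
    refine inter_ae_eq_left_of_ae_eq_univ ?_
    rw [eventuallyEq_univ]
    exact hv.ae_differentiableAt
  have hnull : μH[n] (B \ D) = 0 := ((ae_eq_set.1 hae).2)
  have hcov := lintegral_abs_det_fderiv_eq_addHaar_image (μH[n] : Measure (Euc n)) hDm
    (f := F) (f' := fun y => 1 + fderiv ℝ v y)
    (fun y hy => ((hasFDerivAt_id y).add hy.2.hasFDerivAt).hasFDerivWithinAt) hinj.injOn
  have himg : μH[n] (F '' D) = μH[n] B := by
    apply le_antisymm
    · calc μH[n] (F '' D) ≤ μH[n] (F '' B) := measure_mono (image_mono inter_subset_left)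
        _ = _ := by rw [hFB]
    · calc μH[n] B = μH[n] (F '' B) := by rw [hFB]
        _ ≤ μH[n] (F '' D ∪ F '' (B \ D)) := measure_mono (by
            rw [← image_union]; exact image_mono (by simp [hD]))
        _ ≤ μH[n] (F '' D) + μH[n] (F '' (B \ D)) := measure_union_le _ _
        _ ≤ μH[n] (F '' D) + 0 := by
            gcongr
            refine (hFL.hausdorffMeasure_image_le (by positivity) _).trans ?_
            rw [hnull, mul_zero]
        _ = _ := add_zero _
  have hlin : ∫⁻ y in B, ENNReal.ofReal ((1 + fderiv ℝ v y).det) ∂μH[n] = μH[n] B := by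
    rw [← setLIntegral_congr hae, ← himg, ← hcov]
    simp only [abs_of_pos (hpos _)]
  have hfin : μH[n] B < ∞ := measure_closedBall_lt_top
  have h_integral : IntegrableOn (fun y => (1 + fderiv ℝ v y).det) B μH[n] := by
    refine ⟨hmeas.aestronglyMeasurable, ?_⟩
    rw [hasFiniteIntegral_iff_ofReal (ae_of_all _ fun y => (hpos y).le), hlin]
    exact hfin
  refine ⟨h_integral, ?_⟩
  rw [integral_eq_lintegral_of_nonneg_ae (ae_of_all _ fun y => (hpos y).le)
    hmeas.aestronglyMeasurable, hlin]
  rfl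

open scoped NNReal in
theorem integral_det_one_add_fderiv {n : ℕ} {u : Euc n → Euc n} {l : ℝ≥0}
    (hu : LipschitzWith l u) {z : Euc n} {R : ℝ} (hsupp : ∀ y ∉ closedBall z R, u y = 0) :
    ∫ y in closedBall z R, (1 + fderiv ℝ u y).det ∂μH[n] = μH[n].real (closedBall z R) := by
  obtain ⟨ε, εpos, hε⟩ : ∃ ε > (0 : ℝ), ∀ M : Euc n →L[ℝ] Euc n, ‖M‖ ≤ ε → 0 < (1 + M).det := by
    have hc : Continuous fun M : Euc n →L[ℝ] Euc n => (1 + M).det :=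
      ContinuousLinearMap.continuous_det.comp (continuous_const.add continuous_id)
    have h0 : ∀ᶠ M : Euc n →L[ℝ] Euc n in 𝓝 0, 0 < (1 + M).det := by
      refine hc.continuousAt.eventually (lt_mem_nhds ?_)
      simp [ContinuousLinearMap.det]
    obtain ⟨ε, εpos, h⟩ := Metric.eventually_nhds_iff_ball.1 h0
    exact ⟨ε / 2, by positivity, fun M hM => h M (by
      rw [mem_ball_zero_iff]; linarith)⟩
  set a : ℝ := min ε (1 / 2) / (l + 1) with ha
  have hapos : 0 < a := by positivity
  have hal : a * l ≤ min ε (1 / 2) := by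
    rw [ha, div_mul_eq_mul_div, div_le_iff₀ (by positivity)]
    have : 0 < min ε (1 / 2) := by positivity
    nlinarith [l.2]
  set t : ℕ → ℝ := fun j => a / (j + 1) with ht
  have htinj : Function.Injective t := by
    intro i j hij
    simp only [ht] at hij
    rw [div_eq_div_iff (by positivity) (by positivity)] at hij
    have := mul_left_cancel₀ hapos.ne' hij
    exact_mod_cast (add_right_cancel this).symm
  have htpos : ∀ j, 0 < t j := fun j => by positivity
  have htle : ∀ j, t j ≤ a := fun j => by
    simp only [ht]
    exact div_le_self hapos.le (by linarith [(Nat.cast_nonneg j : (0 : ℝ) ≤ j)])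
  obtain ⟨c, hc1, hc⟩ := exists_det_one_add_eq_sum (n := n) t htinj
  have key : ∀ j, IntegrableOn (fun y => (1 + t j • fderiv ℝ u y).det) (closedBall z R) μH[n] ∧
      ∫ y in closedBall z R, (1 + t j • fderiv ℝ u y).det ∂μH[n] =
        μH[n].real (closedBall z R) := by
    intro j
    have hle : t j * l ≤ min ε (1 / 2) :=
      (mul_le_mul_of_nonneg_right (htle j) l.2).trans hal
    have hlip : LipschitzWith (‖t j‖₊ * l) (t j • u) := (lipschitzWith_smul (t j)).comp hu
    have hcoe : ((‖t j‖₊ * l : ℝ≥0) : ℝ) = t j * l := by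
      simp [abs_of_pos (htpos j)]
    have hlt : ‖t j‖₊ * l < 1 := by
      rw [← NNReal.coe_lt_coe, hcoe]
      have := hle.trans (min_le_right _ _)
      norm_num at this ⊢
      linarith
    have := integral_det_one_add_fderiv_of_small hlt hlip
      (fun M hM => hε M (hM.trans (by rw [hcoe]; exact hle.trans (min_le_left _ _))))
      (z := z) (R := R) (fun y hy => by simp [hsupp y hy])
    simpa only [fderiv_const_smul_field, Pi.smul_apply] using this
  rw [funext fun y => hc (fderiv ℝ u y), integral_finsetSum _ fun j _ => (key j).1.const_mul _]
  simp_rw [integral_const_mul, (key _).2]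
  rw [← Finset.sum_mul, hc1, one_mul]

theorem exists_pos_le_norm_add_sub {n : ℕ} {u : Euc n → Euc n} (hu : Continuous u)
    (hs : HasCompactSupport u) {z : Euc n} (hz : ∀ y, y + u y ≠ z) :
    ∃ d > (0 : ℝ), ∀ y, d ≤ ‖y + u y - z‖ := by
  obtain ⟨R, hR⟩ := hs.isCompact.isBounded.subset_closedBall z
  set R' := max R 1
  have hR'0 : 0 < R' := lt_of_lt_of_le one_pos (le_max_right _ _)
  have hcont : ContinuousOn (fun y => ‖y + u y - z‖) (closedBall z R') := by fun_prop
  obtain ⟨y₀, -, hy₀⟩ := (isCompact_closedBall z R').exists_isMinOn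
    ⟨z, mem_closedBall_self hR'0.le⟩ hcont
  refine ⟨min ‖y₀ + u y₀ - z‖ R', lt_min (norm_pos_iff.2 (sub_ne_zero.2 (hz y₀))) hR'0,
    fun y => ?_⟩
  by_cases hy : y ∈ closedBall z R'
  · exact (min_le_left _ _).trans (hy₀ hy)
  · have : u y = 0 := by
      by_contra h
      exact hy (closedBall_subset_closedBall (le_max_left _ _) (hR (subset_tsupport _ h)))
    rw [this, add_zero]
    rw [mem_closedBall, dist_eq_norm, not_le] at hy
    exact (min_le_right _ _).trans hy.le

theorem norm_inv_norm_smul_sub_le {E : Type*} [NormedAddCommGroup E] [NormedSpace ℝ E] {d : ℝ}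
    (hd : 0 < d) {w w' : E} (hw : d ≤ ‖w‖) (hw' : d ≤ ‖w'‖) :
    ‖‖w‖⁻¹ • w - ‖w'‖⁻¹ • w'‖ ≤ 2 / d * ‖w - w'‖ := by
  have h1 : 0 < ‖w‖ := hd.trans_le hw
  have h2 : 0 < ‖w'‖ := hd.trans_le hw'
  have e : ‖w‖⁻¹ • w - ‖w'‖⁻¹ • w' = ‖w‖⁻¹ • ((w - w') + ((‖w'‖ - ‖w‖) * ‖w'‖⁻¹) • w') := by
    have h : ‖w'‖⁻¹ = ‖w‖⁻¹ * (1 - (‖w'‖ - ‖w‖) * ‖w'‖⁻¹) := by field_simp; ring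
    conv_lhs => rw [h]
    module
  rw [e, norm_smul, norm_inv, norm_norm]
  have h3 : ‖((‖w'‖ - ‖w‖) * ‖w'‖⁻¹) • w'‖ ≤ ‖w - w'‖ := by
    rw [norm_smul, norm_mul, norm_inv, norm_norm, mul_assoc, inv_mul_cancel₀ h2.ne', mul_one,
      Real.norm_eq_abs, norm_sub_rev]
    exact abs_norm_sub_norm_le _ _
  calc ‖w‖⁻¹ * ‖(w - w') + ((‖w'‖ - ‖w‖) * ‖w'‖⁻¹) • w'‖
      ≤ d⁻¹ * (‖w - w'‖ + ‖w - w'‖) := by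
        gcongr
        exact (norm_add_le _ _).trans (by gcongr)
    _ = _ := by ring

/-- A map constant in norm near a point has singular derivative there. -/
theorem det_eq_zero_of_norm_eventually_const {E : Type*} [NormedAddCommGroup E]
    [InnerProductSpace ℝ E] [FiniteDimensional ℝ E] {G : E → E} {G' : E →L[ℝ] E} {y : E} {R : ℝ}
    (hR : R ≠ 0) (hG : HasFDerivAt G G' y) (hnorm : ∀ᶠ x in 𝓝 y, ‖G x‖ = R) : G'.det = 0 := by
  by_contra hdet
  have h1 := hG.norm_sq
  have h2 : HasFDerivAt (fun x => ‖G x‖ ^ 2) (0 : E →L[ℝ] ℝ) y :=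
    (hasFDerivAt_const (R ^ 2) y).congr_of_eventuallyEq (hnorm.mono fun x hx => by simp [hx])
  have h3 := h1.unique h2
  set e := LinearMap.equivOfDetNeZero (G' : E →ₗ[ℝ] E) hdet
  obtain ⟨v, hv⟩ := e.surjective (G y)
  have hv' : G' v = G y := hv
  have h4 := congrArg (fun T : E →L[ℝ] ℝ => T v) h3
  simp [hv'] at h4
  have := hnorm.self_of_nhds
  simp [h4] at this
  exact hR this.symm

open scoped NNReal in
theorem surjective_add_of_lipschitzWith {n : ℕ} {u : Euc n → Euc n} {l : ℝ≥0}
    (hu : LipschitzWith l u) (hs : HasCompactSupport u) :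
    Function.Surjective fun y => y + u y := by
  intro z
  by_contra! hz
  obtain ⟨d, hd, hdist⟩ := exists_pos_le_norm_add_sub hu.continuous hs hz
  obtain ⟨R₁, hR₁⟩ := hs.isCompact.isBounded.subset_closedBall z
  obtain ⟨C, hC⟩ := hu.continuous.bounded_above_of_compact_support hs
  set R := max R₁ 0 + C + 1 with hRdef
  have hC0 : 0 ≤ C := (norm_nonneg _).trans (hC z)
  have hR : 0 < R := by positivity
  set W : Euc n → Euc n := fun y => y + u y - z with hW
  have hzero : ∀ y, R ≤ dist y z → u y = 0 := by
    intro y hy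
    by_contra h
    have := hR₁ (subset_tsupport _ h)
    rw [mem_closedBall] at this
    linarith [le_max_left R₁ 0]
  have hWlip : LipschitzWith (1 + l) W := by
    simpa using (LipschitzWith.id.add hu).sub (LipschitzWith.const z)
  have hWball : ∀ y, dist y z < R → ‖W y‖ < R := by
    intro y hy
    by_cases h : u y = 0
    · simpa [hW, h, dist_eq_norm] using hy
    · have h1 := hR₁ (subset_tsupport _ h)
      rw [mem_closedBall, dist_eq_norm] at h1
      calc ‖W y‖ = ‖(y - z) + u y‖ := by congr 1; simp only [hW]; abel
        _ ≤ ‖y - z‖ + ‖u y‖ := norm_add_le _ _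
        _ < R := by linarith [hC y, le_max_left R₁ 0]
  set q : Euc n → Euc n := fun y => max 0 (R - ‖W y‖) • (‖W y‖⁻¹ • W y) with hq
  have hWpos : ∀ y, 0 < ‖W y‖ := fun y => hd.trans_le (hdist y)
  have hqlip : LipschitzWith (Real.toNNReal (1 + R * (2 / d)) * (1 + l)) q := by
    refine LipschitzWith.of_dist_le_mul fun a b => ?_
    have e : q a - q b = (max 0 (R - ‖W a‖) - max 0 (R - ‖W b‖)) • (‖W a‖⁻¹ • W a) +
        max 0 (R - ‖W b‖) • (‖W a‖⁻¹ • W a - ‖W b‖⁻¹ • W b) := by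
      simp only [hq]
      module
    have h1 : |max 0 (R - ‖W a‖) - max 0 (R - ‖W b‖)| ≤ ‖W a - W b‖ := by
      rw [max_comm 0, max_comm 0]
      refine (abs_max_sub_max_le_abs _ _ _).trans (le_trans ?_ (abs_norm_sub_norm_le (W a) (W b)))
      rw [abs_sub_comm]
      exact le_of_eq (congrArg _ (by ring))
    have h2 : ‖‖W a‖⁻¹ • W a‖ = 1 := by
      rw [norm_smul, norm_inv, norm_norm, inv_mul_cancel₀ (hWpos a).ne']
    have h3 := norm_inv_norm_smul_sub_le hd (hdist a) (hdist b)
    have h4 : |max 0 (R - ‖W b‖)| ≤ R := by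
      rw [abs_of_nonneg (le_max_left _ _)]
      exact max_le hR.le (by linarith [hWpos b])
    have h5 := hWlip.dist_le_mul a b
    rw [dist_eq_norm (W a)] at h5
    rw [dist_eq_norm (q a), e, NNReal.coe_mul, Real.coe_toNNReal _ (by positivity)]
    calc _ ≤ |max 0 (R - ‖W a‖) - max 0 (R - ‖W b‖)| * 1 +
          |max 0 (R - ‖W b‖)| * ‖‖W a‖⁻¹ • W a - ‖W b‖⁻¹ • W b‖ := by
            refine (norm_add_le _ _).trans ?_
            rw [norm_smul _ (‖W a‖⁻¹ • W a), h2, norm_smul _ (_ - _), Real.norm_eq_abs,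
              Real.norm_eq_abs]
      _ ≤ ‖W a - W b‖ * 1 + R * (2 / d * ‖W a - W b‖) := by
            gcongr
      _ = (1 + R * (2 / d)) * ‖W a - W b‖ := by ring
      _ ≤ _ := by
            rw [mul_assoc]
            gcongr
  have hqzero : ∀ y ∉ closedBall z R, (u + q) y = 0 := by
    intro y hy
    rw [mem_closedBall, not_le] at hy
    have h0 := hzero y hy.le
    have : max 0 (R - ‖W y‖) = 0 := by
      simp only [hW, h0, add_zero, ← dist_eq_norm]
      exact max_eq_left (by linarith)
    simp [hq, this, h0]
  have hlip : LipschitzWith _ (u + q) := hu.add hqlip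
  have h_integral := integral_det_one_add_fderiv hlip hqzero
  have hvanish : ∫ y in closedBall z R, (1 + fderiv ℝ (u + q) y).det ∂μH[n] = 0 := by
    refine integral_eq_zero_of_ae ?_
    have hsph : ∀ᵐ y ∂(μH[n] : Measure (Euc n)), y ∉ sphere z R := by
      rw [ae_iff]
      simp only [not_not, Set.ofPred_mem_eq]
      exact Measure.addHaar_sphere_of_ne_zero μH[n] z hR.ne'
    filter_upwards [ae_restrict_mem isClosed_closedBall.measurableSet,
      ae_restrict_of_ae hsph, ae_restrict_of_ae hlip.ae_differentiableAt] with y hy hys hyd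
    have hyb : y ∈ ball z R := lt_of_le_of_ne hy hys
    have hG : HasFDerivAt (fun x => x + (u + q) x - z) (1 + fderiv ℝ (u + q) y) y :=
      ((hasFDerivAt_id y).add hyd.hasFDerivAt).sub_const z
    refine det_eq_zero_of_norm_eventually_const hR.ne' hG ?_
    filter_upwards [isOpen_ball.mem_nhds hyb] with x hx
    have hx' := hWball x hx
    have e : x + (u + q) x - z = (R * ‖W x‖⁻¹) • W x := by
      have e1 : x + (u + q) x - z = W x + q x := by
        simp only [hW, Pi.add_apply]; abel
      have e2 : R * ‖W x‖⁻¹ = 1 + (R - ‖W x‖) * ‖W x‖⁻¹ := by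
        have := (hWpos x).ne'
        field_simp
        ring
      rw [e1, e2, hq]
      simp only
      rw [max_eq_right (by linarith)]
      module
    rw [e, norm_smul, norm_mul, norm_inv, norm_norm, mul_assoc, inv_mul_cancel₀ (hWpos x).ne',
      mul_one, Real.norm_of_nonneg hR.le]
  rw [hvanish] at h_integral
  have : 0 < μH[n].real (closedBall z R) :=
    ENNReal.toReal_pos (measure_closedBall_pos _ z hR).ne' measure_closedBall_lt_top.ne
  exact this.ne h_integral

theorem surjective_add_of_hasCompactSupport {n : ℕ} {u : Euc n → Euc n} (hu : Continuous u)
    (hs : HasCompactSupport u) : Function.Surjective fun y => y + u y := by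
  intro z
  by_contra! hz
  obtain ⟨d, hd, hdist⟩ := exists_pos_le_norm_add_sub hu hs hz
  obtain ⟨v, hv, hvu, hsupp⟩ := hu.exists_contDiff_approx 1 (ε := fun _ => d) continuous_const
    fun _ => hd
  have hvs : HasCompactSupport v := hs.mono hsupp
  obtain ⟨l, hl⟩ := hv.lipschitzWith_of_hasCompactSupport hvs (by simp)
  obtain ⟨y, hy⟩ := surjective_add_of_lipschitzWith hl hvs z
  have h1 := hdist y
  have h2 := hvu y
  rw [← hy, add_sub_add_left_eq_sub, ← dist_eq_norm, dist_comm] at h1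
  exact absurd h1 (not_le.2 h2)

/-- A continuous map moving the points of a ball of radius `r` by at most `ε` covers the concentric
ball of radius `r - ε`. -/
theorem closedBall_subset_image_of_norm_sub_le {n : ℕ} {h : Euc n → Euc n} {x : Euc n} {r ε : ℝ}
    (hr : 0 < r) (hcont : ContinuousOn h (closedBall x r))
    (hh : ∀ y ∈ closedBall x r, ‖h y - y‖ ≤ ε) :
    closedBall x (r - ε) ⊆ h '' closedBall x r := by
  set π : Euc n → Euc n := fun y => x + (r / max r ‖y - x‖) • (y - x) with hπ
  have hmax : ∀ y, 0 < max r ‖y - x‖ := fun y => lt_max_of_lt_left hr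
  have hπc : Continuous π := by
    have : Continuous fun y => r / max r ‖y - x‖ :=
      continuous_const.div (by fun_prop) fun y => (hmax y).ne'
    fun_prop
  have hπmem : ∀ y, π y ∈ closedBall x r := by
    intro y
    rw [mem_closedBall, dist_eq_norm]
    simp only [hπ, add_sub_cancel_left]
    rw [norm_smul, norm_div, Real.norm_of_nonneg hr.le, Real.norm_of_nonneg (hmax y).le,
      div_mul_eq_mul_div, div_le_iff₀ (hmax y)]
    exact mul_le_mul_of_nonneg_left (le_max_right _ _) hr.le
  have hπid : ∀ y ∈ closedBall x r, π y = y := by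
    intro y hy
    rw [mem_closedBall, dist_eq_norm] at hy
    simp only [hπ]
    rw [max_eq_left hy, div_self hr.ne', one_smul, add_sub_cancel]
  set χ : Euc n → ℝ := fun y => max 0 (min 1 (2 - dist y x / r)) with hχ
  have hχc : Continuous χ := by fun_prop
  have hχ0 : ∀ y, 0 ≤ χ y := fun y => le_max_left _ _
  have hχ1 : ∀ y, χ y ≤ 1 := fun y => max_le zero_le_one (min_le_left _ _)
  set u : Euc n → Euc n := fun y => χ y • (h (π y) - π y) with hu
  have huc : Continuous u :=
    hχc.smul ((hcont.comp_continuous hπc hπmem).sub hπc)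
  have hus : HasCompactSupport u := by
    refine HasCompactSupport.intro (isCompact_closedBall x (2 * r)) fun y hy => ?_
    rw [mem_closedBall, not_le] at hy
    have : χ y = 0 := by
      refine max_eq_left ((min_le_right _ _).trans ?_)
      rw [sub_nonpos, le_div_iff₀ hr]
      exact hy.le
    simp [hu, this]
  intro z hz
  obtain ⟨y, hy⟩ := surjective_add_of_hasCompactSupport huc hus z
  have hub : ‖u y‖ ≤ ε := by
    simp only [hu]
    rw [norm_smul, Real.norm_of_nonneg (hχ0 y)]
    exact (mul_le_of_le_one_left (norm_nonneg _) (hχ1 y)).trans (hh _ (hπmem y))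
  have hyB : y ∈ closedBall x r := by
    rw [mem_closedBall, dist_eq_norm] at hz ⊢
    calc ‖y - x‖ = ‖(z - x) - u y‖ := by rw [← hy]; congr 1; simp only; abel
      _ ≤ ‖z - x‖ + ‖u y‖ := norm_sub_le _ _
      _ ≤ r := by linarith
  have hχy : χ y = 1 := by
    rw [mem_closedBall] at hyB
    have : 1 ≤ 2 - dist y x / r := by
      have : dist y x / r ≤ 1 := (div_le_one hr).2 hyB
      linarith
    simp only [hχ]
    rw [min_eq_left this]
    simp
  refine ⟨y, hyB, ?_⟩
  rw [← hy]
  simp [hu, hχy, hπid y hyB]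

theorem gram_eq_transpose_matrixOf_mul {n m : ℕ} (A : Euc n →L[ℝ] Euc m) :
    Matrix.gram ℝ (fun i => A (EuclideanSpace.basisFun (Fin n) ℝ i)) =
      Matrix.transpose (matrixOf A) * matrixOf A := by
  ext i j
  simp [Matrix.gram_apply, matrixOf, Matrix.mul_apply, PiLp.inner_apply, mul_comm]

theorem volMap_eq_normDet {n m : ℕ} (A : Euc n →L[ℝ] Euc m) :
    volMap A = (A : Euc n →ₗ[ℝ] Euc m).normDet := by
  have h := LinearMap.normDet_sq_eq_det_gram (A : Euc n →ₗ[ℝ] Euc m) (EuclideanSpace.basisFun (Fin n) ℝ)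
  rw [volMap, ← gram_eq_transpose_matrixOf_mul]
  exact (congrArg Real.sqrt h.symm).trans (Real.sqrt_sq (LinearMap.normDet_nonneg _))

theorem continuous_volMap {n m : ℕ} : Continuous (volMap : (Euc n →L[ℝ] Euc m) → ℝ) := by
  unfold volMap matrixOf
  refine Real.continuous_sqrt.comp (Continuous.matrix_det (Continuous.matrix_mul (Continuous.matrix_transpose ?_) ?_))
  all_goals
    refine continuous_matrix fun i j => ?_
    simp only [Matrix.of_apply]
    fun_prop

theorem hausdorffMeasure_image_eq_volMap {n m : ℕ} (A : Euc n →L[ℝ] Euc m) (s : Set (Euc n)) :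
    μH[n] (A '' s) = ENNReal.ofReal (volMap A) * μH[n] s := by
  have := LinearMap.hausdorffMeasure_image (A : Euc n →ₗ[ℝ] Euc m) s
  simpa [volMap_eq_normDet] using this

/-- The map `v ↦ (A v, ε v)`. -/
def graphMap {n m : ℕ} (A : Euc n →L[ℝ] Euc m) (ε : ℝ) : Euc n →ₗ[ℝ] WithLp 2 (Euc m × Euc n) :=
  (WithLp.linearEquiv 2 ℝ (Euc m × Euc n)).symm.toLinearMap ∘ₗ
    (LinearMap.prod (A : Euc n →ₗ[ℝ] Euc m) (ε • LinearMap.id))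

theorem normDet_graphMap_sq {n m : ℕ} (A : Euc n →L[ℝ] Euc m) (ε : ℝ) :
    (graphMap A ε).normDet ^ 2 =
      (Matrix.transpose (matrixOf A) * matrixOf A + ε ^ 2 • (1 : Matrix (Fin n) (Fin n) ℝ)).det := by
  have h := LinearMap.normDet_sq_eq_det_gram (graphMap A ε) (EuclideanSpace.basisFun (Fin n) ℝ)
  rw [← gram_eq_transpose_matrixOf_mul]
  refine (Eq.trans (by simp) h).trans ?_
  congr 1
  ext i j
  simp only [graphMap, Matrix.gram_apply, EuclideanSpace.basisFun_apply, Matrix.add_apply,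
    Matrix.smul_apply, Matrix.one_apply, smul_eq_mul, mul_ite, mul_one, mul_zero]
  simp [EuclideanSpace.inner_single_left, inner_smul_left, inner_smul_right]
  split_ifs <;> ring

theorem tendsto_normDet_graphMap {n m : ℕ} (A : Euc n →L[ℝ] Euc m) :
    Tendsto (fun ε : ℝ => (graphMap A ε).normDet) (𝓝 0) (𝓝 (volMap A)) := by
  have h : ∀ ε, (graphMap A ε).normDet = Real.sqrt
      (Matrix.transpose (matrixOf A) * matrixOf A + ε ^ 2 • (1 : Matrix (Fin n) (Fin n) ℝ)).det := by
    intro ε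
    rw [← normDet_graphMap_sq, Real.sqrt_sq (LinearMap.normDet_nonneg _)]
  simp only [h]
  have hc : Continuous fun ε : ℝ => Real.sqrt
      (Matrix.transpose (matrixOf A) * matrixOf A + ε ^ 2 • (1 : Matrix (Fin n) (Fin n) ℝ)).det := by
    refine Real.continuous_sqrt.comp (Continuous.matrix_det ?_)
    fun_prop
  simpa [volMap] using hc.tendsto 0

theorem norm_graphMap_sq {n m : ℕ} (A : Euc n →L[ℝ] Euc m) (ε : ℝ) (v : Euc n) :
    ‖graphMap A ε v‖ ^ 2 = ‖A v‖ ^ 2 + (ε * ‖v‖) ^ 2 := by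
  rw [WithLp.prod_norm_sq_eq_of_L2]
  simp [graphMap, norm_smul, mul_pow]

theorem exists_hausdorffMeasure_image_le_of_volMap_lt {n m : ℕ} (A : Euc n →L[ℝ] Euc m) {c : ℝ}
    (hc : volMap A < c) :
    ∃ δ : NNReal, δ ≠ 0 ∧ ∀ (f : Euc n → Euc m) (s : Set (Euc n)), ApproximatesLinearOn f A s δ →
      μH[n] (f '' s) ≤ ENNReal.ofReal c * μH[n] s := by
  obtain ⟨ε, hε, hεc⟩ : ∃ ε > 0, (graphMap A ε).normDet < c :=
    (((tendsto_normDet_graphMap A).mono_left nhdsWithin_le_nhds).eventually_lt_const hc |>.and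
      (self_mem_nhdsWithin (s := Ioi 0))).exists.imp fun _ h => ⟨h.2, h.1⟩
  have h1 : Tendsto (fun δ : ℝ => (1 + δ / ε) ^ n * (graphMap A ε).normDet) (𝓝[>] 0)
      (𝓝 (graphMap A ε).normDet) := by
    have : Continuous (fun δ : ℝ => (1 + δ / ε) ^ n * (graphMap A ε).normDet) := by fun_prop
    simpa using (this.tendsto 0).mono_left nhdsWithin_le_nhds
  obtain ⟨δ, hδc, hδ⟩ := (h1.eventually_lt_const hεc |>.and
    (self_mem_nhdsWithin (s := Ioi 0))).exists
  have hδ : 0 < δ := hδ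
  refine ⟨δ.toNNReal, by simpa using hδ, fun f s hf => ?_⟩
  have hsnd : ∀ v, ε⁻¹ • (graphMap A ε v).snd = v := by
    intro v
    simp [graphMap, smul_smul, inv_mul_cancel₀ hε.ne']
  have himg : f '' s = (fun p : WithLp 2 (Euc m × Euc n) => f (ε⁻¹ • p.snd)) '' (graphMap A ε '' s) := by
    rw [image_image]
    simp only [hsnd]
  have hlip : LipschitzOnWith (1 + δ / ε).toNNReal
      (fun p : WithLp 2 (Euc m × Euc n) => f (ε⁻¹ • p.snd)) (graphMap A ε '' s) := by
    refine LipschitzOnWith.of_dist_le_mul ?_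
    rintro _ ⟨y, hy, rfl⟩ _ ⟨z, hz, rfl⟩
    rw [hsnd, hsnd, dist_eq_norm, dist_eq_norm, ← map_sub, Real.coe_toNNReal _ (by positivity)]
    have h2 := norm_graphMap_sq A ε (y - z)
    have h3 : ‖A (y - z)‖ ≤ ‖graphMap A ε (y - z)‖ := by
      refine (pow_le_pow_iff_left₀ (by positivity) (by positivity) two_ne_zero).mp ?_
      nlinarith [sq_nonneg (ε * ‖y - z‖)]
    have h4 : ε * ‖y - z‖ ≤ ‖graphMap A ε (y - z)‖ := by
      refine (pow_le_pow_iff_left₀ (by positivity) (by positivity) two_ne_zero).mp ?_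
      nlinarith [sq_nonneg ‖A (y - z)‖]
    have h5 := hf y hy z hz
    rw [Real.coe_toNNReal _ hδ.le] at h5
    have h6 : f y - f z = A (y - z) + (f y - f z - A (y - z)) := by abel
    calc ‖f y - f z‖ ≤ ‖A (y - z)‖ + δ * ‖y - z‖ := by
          rw [h6]; exact (norm_add_le _ _).trans (by gcongr)
      _ = ‖A (y - z)‖ + δ / ε * (ε * ‖y - z‖) := by field_simp
      _ ≤ ‖graphMap A ε (y - z)‖ + δ / ε * ‖graphMap A ε (y - z)‖ := by gcongr
      _ = _ := by ring
  rw [himg]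
  refine (hlip.hausdorffMeasure_image_le (Nat.cast_nonneg n)).trans ?_
  have h7 := LinearMap.hausdorffMeasure_image (graphMap A ε) s
  rw [finrank_euclideanSpace, Fintype.card_fin] at h7
  rw [h7, ← mul_assoc, ENNReal.rpow_natCast]
  gcongr
  rw [ENNReal.ofNNReal_toNNReal, ← ENNReal.ofReal_pow (by positivity), ← ENNReal.ofReal_mul (by positivity)]
  exact ENNReal.ofReal_le_ofReal hδc.le

theorem hausdorffMeasure_image_le_of_forall_volMap_lt {n m : ℕ} {f : Euc n → Euc m}
    {s : Set (Euc n)} (hs : MeasurableSet s) (hf : ∀ y ∈ s, DifferentiableAt ℝ f y) {c : ℝ}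
    (hc : ∀ y ∈ s, volMap (fderiv ℝ f y) < c) :
    μH[n] (f '' s) ≤ ENNReal.ofReal c * μH[n] s := by
  classical
  rcases s.eq_empty_or_nonempty with rfl | hne
  · simp
  choose δ hδ0 hδ using fun (A : Euc n →L[ℝ] Euc m) (hA : volMap A < c) =>
    exists_hausdorffMeasure_image_le_of_volMap_lt A hA
  obtain ⟨t, A, hdisj, htm, hst, happ, hA⟩ :=
    exists_partition_approximatesLinearOn_of_hasFDerivWithinAt f s (fderiv ℝ f)
      (fun y hy => (hf y hy).hasFDerivAt.hasFDerivWithinAt)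
      (fun A => if hA : volMap A < c then δ A hA else 1)
      (fun A => by split_ifs with h; exacts [hδ0 A h, one_ne_zero])
  have hAc : ∀ k, volMap (A k) < c := fun k => by
    obtain ⟨y, hy, hyA⟩ := hA hne k
    rw [hyA]
    exact hc y hy
  have hunion : s = ⋃ k, s ∩ t k := by rw [← inter_iUnion, inter_eq_left.mpr hst]
  calc μH[n] (f '' s) = μH[n] (⋃ k, f '' (s ∩ t k)) := by rw [← image_iUnion, ← hunion]
    _ ≤ ∑' k, μH[n] (f '' (s ∩ t k)) := measure_iUnion_le _
    _ ≤ ∑' k, ENNReal.ofReal c * μH[n] (s ∩ t k) := by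
        refine ENNReal.tsum_le_tsum fun k => hδ (A k) (hAc k) f _ ?_
        simpa [hAc k] using happ k
    _ = ENNReal.ofReal c * μH[n] s := by
        rw [ENNReal.tsum_mul_left, ← measure_iUnion _ fun k => hs.inter (htm k), ← hunion]
        exact fun i j hij => (hdisj hij).mono inter_subset_right inter_subset_right

theorem volMap_nonneg {n m : ℕ} (A : Euc n →L[ℝ] Euc m) : 0 ≤ volMap A := Real.sqrt_nonneg _

theorem measurable_volMap_fderiv {n m : ℕ} (f : Euc n → Euc m) :
    Measurable fun y => volMap (fderiv ℝ f y) :=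
  continuous_volMap.measurable.comp (measurable_fderiv ℝ f)

theorem hausdorffMeasure_image_le_lintegral_add {n m : ℕ} {f : Euc n → Euc m}
    {s : Set (Euc n)} (hs : MeasurableSet s) (hf : ∀ y ∈ s, DifferentiableAt ℝ f y) {ε : ℝ}
    (hε : 0 < ε) :
    μH[n] (f '' s) ≤ ∫⁻ y in s, ENNReal.ofReal (volMap (fderiv ℝ f y) + ε) ∂μH[n] := by
  have hmeas : Measurable fun y => ⌊volMap (fderiv ℝ f y) / ε⌋₊ :=
    Nat.measurable_floor.comp ((measurable_volMap_fderiv f).div_const ε)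
  set t : ℕ → Set (Euc n) := fun k => s ∩ {y | ⌊volMap (fderiv ℝ f y) / ε⌋₊ = k} with ht
  have htm : ∀ k, MeasurableSet (t k) := fun k => hs.inter (hmeas (measurableSet_singleton k))
  have hunion : s = ⋃ k, t k := by ext y; simp [ht]
  have hdisj : Pairwise (Function.onFun Disjoint t) := fun i j hij =>
    Set.disjoint_left.mpr fun y hi hj => hij (hi.2.symm.trans hj.2)
  calc μH[n] (f '' s) = μH[n] (⋃ k, f '' t k) := by rw [← image_iUnion, ← hunion]
    _ ≤ ∑' k, μH[n] (f '' t k) := measure_iUnion_le _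
    _ ≤ ∑' k, ∫⁻ y in t k, ENNReal.ofReal (volMap (fderiv ℝ f y) + ε) ∂μH[n] := by
        refine ENNReal.tsum_le_tsum fun k => ?_
        refine (hausdorffMeasure_image_le_of_forall_volMap_lt (c := (k + 1) * ε) (htm k)
          (fun y hy => hf y hy.1) ?_).trans ?_
        · intro y hy
          rw [← div_lt_iff₀ hε, ← hy.2]
          exact Nat.lt_floor_add_one _
        · rw [← setLIntegral_const]
          refine setLIntegral_mono' (htm k) fun y hy => ENNReal.ofReal_le_ofReal ?_
          have : (k : ℝ) ≤ volMap (fderiv ℝ f y) / ε := by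
            rw [← hy.2]
            exact Nat.floor_le (div_nonneg (volMap_nonneg _) hε.le)
          rw [le_div_iff₀ hε] at this
          linarith
    _ = ∫⁻ y in s, ENNReal.ofReal (volMap (fderiv ℝ f y) + ε) ∂μH[n] := by
        rw [← lintegral_iUnion htm hdisj, ← hunion]

theorem hausdorffMeasure_image_le_lintegral_add_of_lipschitzOnWith {n m : ℕ} {f : Euc n → Euc m}
    {K : NNReal} {Ω s : Set (Euc n)} (hΩ : IsOpen Ω) (hf : LipschitzOnWith K f Ω)
    (hs : MeasurableSet s) (hsΩ : s ⊆ Ω) {ε : ℝ} (hε : 0 < ε) :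
    μH[n] (f '' s) ≤ ∫⁻ y in s, ENNReal.ofReal (volMap (fderiv ℝ f y) + ε) ∂μH[n] := by
  set D : Set (Euc n) := {y | DifferentiableAt ℝ f y} with hD
  have hDm : MeasurableSet D := measurableSet_of_differentiableAt ℝ f
  have hnull : μH[n] (s \ D) = 0 := by
    refine measure_mono_null ?_ (ae_iff.mp (hf.ae_differentiableWithinAt_of_mem (μ := μH[n])))
    intro y hy h
    exact hy.2 ((h (hsΩ hy.1)).differentiableAt (hΩ.mem_nhds (hsΩ hy.1)))
  have hnull' : μH[n] (f '' (s \ D)) = 0 := by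
    have := (hf.mono (sdiff_subset.trans hsΩ)).hausdorffMeasure_image_le (s := s \ D)
      (Nat.cast_nonneg n)
    rw [hnull, mul_zero] at this
    exact le_antisymm this bot_le
  calc μH[n] (f '' s) = μH[n] (f '' (s ∩ D) ∪ f '' (s \ D)) := by
        rw [← image_union, inter_union_sdiff]
    _ ≤ μH[n] (f '' (s ∩ D)) + μH[n] (f '' (s \ D)) := measure_union_le _ _
    _ ≤ ∫⁻ y in s ∩ D, ENNReal.ofReal (volMap (fderiv ℝ f y) + ε) ∂μH[n] := by
        rw [hnull', add_zero]
        exact hausdorffMeasure_image_le_lintegral_add (hs.inter hDm) (fun y hy => hy.2) hε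
    _ ≤ _ := lintegral_mono_set inter_subset_left

/-- Wherever the average of `vol f'` is positive, it bounds the area of the image from above. -/
theorem hausdorffMeasure_image_closedBall_le_of_average_lt {n m : ℕ} {f : Euc n → Euc m}
    {K : NNReal} {Ω : Set (Euc n)} (hΩ : IsOpen Ω) (hf : LipschitzOnWith K f Ω) {x : Euc n} {r a : ℝ}
    (hr : closedBall x r ⊆ Ω) (hr0 : 0 < r)
    (ha : (⨍ y in closedBall x r, volMap (fderiv ℝ f y) ∂(μH[n] : Measure (Euc n))) < a)
    (hpos : 0 < ⨍ y in closedBall x r, volMap (fderiv ℝ f y) ∂(μH[n] : Measure (Euc n))) :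
    μH[n] (f '' closedBall x r) ≤ ENNReal.ofReal a * μH[n] (closedBall x r) := by
  set v := ⨍ y in closedBall x r, volMap (fderiv ℝ f y) ∂(μH[n] : Measure (Euc n)) with hv
  have hε : 0 < a - v := sub_pos.mpr ha
  have hfin : (μH[n] : Measure (Euc n)) (closedBall x r) < ∞ := measure_closedBall_lt_top
  have hpm : 0 < (μH[n] : Measure (Euc n)) (closedBall x r) := measure_closedBall_pos _ _ hr0
  have h_integral : IntegrableOn (fun y => volMap (fderiv ℝ f y)) (closedBall x r) μH[n] := by
    by_contra h
    rw [hv, setAverage_eq, integral_undef h, smul_zero] at hpos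
    exact lt_irrefl _ hpos
  refine (hausdorffMeasure_image_le_lintegral_add_of_lipschitzOnWith hΩ hf measurableSet_closedBall hr hε).trans ?_
  have h1 : ∀ y, ENNReal.ofReal (volMap (fderiv ℝ f y) + (a - v)) =
      ENNReal.ofReal (volMap (fderiv ℝ f y)) + ENNReal.ofReal (a - v) := fun y =>
    ENNReal.ofReal_add (volMap_nonneg _) hε.le
  simp only [h1]
  rw [lintegral_add_right _ measurable_const, setLIntegral_const,
    ← ofReal_integral_eq_lintegral_ofReal h_integral (ae_of_all _ fun y => volMap_nonneg _)]
  have h2 : ∫ y in closedBall x r, volMap (fderiv ℝ f y) ∂(μH[n] : Measure (Euc n)) =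
      v * (μH[n] : Measure (Euc n)).real (closedBall x r) := by
    have hne : (μH[n] : Measure (Euc n)).real (closedBall x r) ≠ 0 :=
      (ENNReal.toReal_pos hpm.ne' hfin.ne).ne'
    rw [hv, setAverage_eq, smul_eq_mul]
    field_simp
  rw [h2, ENNReal.ofReal_mul hpos.le, Measure.real, ENNReal.ofReal_toReal hfin.ne, ← add_mul,
    ← ENNReal.ofReal_add hpos.le hε.le, add_sub_cancel]

theorem exists_leftInverse_volMap_mul_le {n m : ℕ} (A : Euc n →L[ℝ] Euc m) (hA : 0 < volMap A) :
    ∃ L : Euc m →L[ℝ] Euc n, (∀ v, L (A v) = v) ∧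
      ∀ s : Set (Euc m), ENNReal.ofReal (volMap A) * μH[n] (L '' s) ≤ μH[n] s := by
  have hker : LinearMap.ker (A : Euc n →ₗ[ℝ] Euc m) = ⊥ := by
    rw [volMap_eq_normDet] at hA
    by_contra h
    exact hA.ne' (LinearMap.normDet_eq_zero_iff_ker_ne_bot.mpr h)
  set e := LinearEquiv.ofInjective (A : Euc n →ₗ[ℝ] Euc m) (LinearMap.ker_eq_bot.mp hker)
  set P := (LinearMap.range (A : Euc n →ₗ[ℝ] Euc m)).orthogonalProjectionOnto
  set L : Euc m →L[ℝ] Euc n := (LinearMap.toContinuousLinearMap e.symm.toLinearMap).comp P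
  have hAL : ∀ w, A (L w) = P w := by
    intro w
    have : (e (e.symm (P w)) : Euc m) = P w := by rw [e.apply_symm_apply]
    exact this
  refine ⟨L, fun v => ?_, fun s => ?_⟩
  · have : P (A v) = e v := Submodule.orthogonalProjectionOnto_mem_subspace_eq_self (e v)
    change e.symm (P (A v)) = v
    rw [this, e.symm_apply_apply]
  · rw [← hausdorffMeasure_image_eq_volMap, image_image]
    have hlip : LipschitzWith 1 fun w => A (L w) := by
      refine LipschitzWith.of_dist_le_mul fun a b => ?_
      rw [dist_eq_norm, dist_eq_norm, ← map_sub, ← map_sub, hAL, NNReal.coe_one, one_mul]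
      exact Submodule.norm_orthogonalProjectionOnto_apply_le
        (LinearMap.range (A : Euc n →ₗ[ℝ] Euc m)) (a - b)
    simpa using hlip.hausdorffMeasure_image_le (Nat.cast_nonneg n) s

theorem hausdorffMeasure_closedBall_one_sub_mul {n : ℕ} (x : Euc n) {r ε : ℝ} (hr : 0 ≤ r) (hε : ε ≤ 1) :
    μH[n] (closedBall x (r - ε * r)) =
      ENNReal.ofReal ((1 - ε) ^ n) * μH[n] (closedBall x r) := by
  have h := Measure.addHaar_closedBall_mul (μH[n] : Measure (Euc n)) x (sub_nonneg.mpr hε) hr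
  rw [finrank_euclideanSpace, Fintype.card_fin] at h
  rw [show r - ε * r = (1 - ε) * r by ring, h, Measure.addHaar_closedBall_center _ x r]

theorem le_hausdorffMeasure_image_of_norm_sub_le {n m : ℕ} {A : Euc n →L[ℝ] Euc m} {x : Euc n}
    (hA : 0 < volMap A) {q : ℝ} (hq : q < 1) (p : Euc m) :
    ∃ δ > 0, ∀ r > 0, ∀ g : Euc n → Euc m, ContinuousOn g (closedBall x r) →
      (∀ y ∈ closedBall x r, ‖g y - p - A (y - x)‖ ≤ δ * r) →
      ENNReal.ofReal (q * volMap A) * μH[n] (closedBall x r) ≤ μH[n] (g '' closedBall x r) := by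
  obtain ⟨L, hLA, hL⟩ := exists_leftInverse_volMap_mul_le A hA
  have h1 : Tendsto (fun ε : ℝ => (1 - ε) ^ n) (𝓝[>] 0) (𝓝 1) := by
    have : Continuous (fun ε : ℝ => (1 - ε) ^ n) := by fun_prop
    simpa using (this.tendsto 0).mono_left nhdsWithin_le_nhds
  obtain ⟨ε, hqε, hε0, hε1⟩ := (h1.eventually_const_lt hq |>.and
    (Ioo_mem_nhdsGT (zero_lt_one' ℝ))).exists
  have hC : 0 < ‖L‖ + 1 := by positivity
  refine ⟨ε / (‖L‖ + 1), by positivity, fun r hr g hg hgp => ?_⟩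
  set h : Euc n → Euc n := fun y => L (g y) + (x - L p) with hh
  have hcov : closedBall x (r - ε * r) ⊆ h '' closedBall x r := by
    refine closedBall_subset_image_of_norm_sub_le hr
      ((L.continuous.comp_continuousOn hg).add continuousOn_const) fun y hy => ?_
    have e1 : h y - y = L (g y - p - A (y - x)) := by
      rw [map_sub, map_sub, hLA]
      simp only [hh]
      abel
    calc ‖h y - y‖ ≤ ‖L‖ * (ε / (‖L‖ + 1) * r) := by
          rw [e1]
          exact (L.le_opNorm _).trans (by gcongr; exact hgp y hy)
      _ ≤ (‖L‖ + 1) * (ε / (‖L‖ + 1) * r) := by gcongr; linarith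
      _ = ε * r := by field_simp
  have himg : h '' closedBall x r =
      IsometryEquiv.addRight (x - L p) '' (L '' (g '' closedBall x r)) := by
    rw [image_image, image_image]
    rfl
  have hmeas : ENNReal.ofReal q * μH[n] (closedBall x r) ≤ μH[n] (L '' (g '' closedBall x r)) := by
    rw [← IsometryEquiv.hausdorffMeasure_image (IsometryEquiv.addRight (x - L p)) n
      (L '' (g '' closedBall x r)), ← himg]
    refine le_trans ?_ (measure_mono hcov)
    rw [hausdorffMeasure_closedBall_one_sub_mul x hr.le hε1.le]
    gcongr
  calc ENNReal.ofReal (q * volMap A) * μH[n] (closedBall x r)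
      = ENNReal.ofReal (volMap A) * (ENNReal.ofReal q * μH[n] (closedBall x r)) := by
        rw [mul_comm q, ENNReal.ofReal_mul hA.le, mul_assoc]
    _ ≤ ENNReal.ofReal (volMap A) * μH[n] (L '' (g '' closedBall x r)) := by gcongr
    _ ≤ _ := hL _

/-- Let `Ω ⊆ ℝ^n` be open, `f : closure Ω → ℝ^m` Lipschitz, `x ∈ Ω` a point
where `f'(x)` exists, `vol f'(x) > 0`, and which is a Lebesgue point of `y ↦ vol f'(y)`.
Then for every `η ∈ (0,1)` there are `r₀ > 0` with `B(x,r₀) ⊆ Ω` and `δ > 0` such that for all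
`0 < r ≤ r₀` and all continuous `g : B(x,r) → ℝ^m` with `‖g − f‖_∞ ≤ δ r` one has
`H^n(g(B(x,r))) ≥ η · H^n(f(B(x,r)))`. -/
theorem stmt7 (n m : ℕ) (hnm : n ≤ m)
    (Ω : Set (Euc n)) (hΩ : IsOpen Ω)
    (f : Euc n → Euc m) (K : NNReal) (hf : LipschitzOnWith K f (closure Ω))
    (x : Euc n) (hx : x ∈ Ω)
    (A : Euc n →L[ℝ] Euc m) (hA : HasFDerivAt f A x)
    (hvol : 0 < volMap A)
    (hleb : Tendsto (fun r : ℝ => ⨍ y in closedBall x r, volMap (fderiv ℝ f y)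
        ∂(μH[n] : Measure (Euc n))) (𝓝[>] 0) (𝓝 (volMap A)))
    (η : ℝ) (hη₁ : 0 < η) (hη₂ : η < 1) :
    ∃ r₀ > (0 : ℝ), closedBall x r₀ ⊆ Ω ∧ ∃ δ > (0 : ℝ),
      ∀ r : ℝ, 0 < r → r ≤ r₀ →
        ∀ g : Euc n → Euc m, ContinuousOn g (closedBall x r) →
          (∀ y ∈ closedBall x r, ‖g y - f y‖ ≤ δ * r) →
          ENNReal.ofReal η * μH[n] (f '' closedBall x r)
            ≤ μH[n] (g '' closedBall x r) := by
  have hq1 : √η < 1 := by rwa [Real.sqrt_lt' one_pos, one_pow]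
  have hq0 : 0 < √η := Real.sqrt_pos.mpr hη₁
  obtain ⟨δ, hδ, hlow⟩ := le_hausdorffMeasure_image_of_norm_sub_le (x := x) hvol hq1 (f x)
  obtain ⟨ρ₁, hρ₁, hball⟩ := nhds_basis_closedBall.mem_iff.mp (hΩ.mem_nhds hx)
  have hdiff : ∀ᶠ y in 𝓝 x, ‖f y - f x - A (y - x)‖ ≤ δ / 2 * ‖y - x‖ :=
    hA.isLittleO.def (half_pos hδ)
  obtain ⟨ρ₂, hρ₂, hdiff⟩ := nhds_basis_closedBall.mem_iff.mp hdiff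
  have hlt : volMap A < volMap A / √η := by
    rw [lt_div_iff₀ hq0]
    exact mul_lt_of_lt_one_right hvol hq1
  obtain ⟨ρ₃, hρ₃, havg⟩ := mem_nhdsGT_iff_exists_Ioc_subset.mp
    ((hleb.eventually_lt_const hlt).and (hleb.eventually_const_lt hvol))
  have hρ₃ : 0 < ρ₃ := hρ₃
  refine ⟨min ρ₁ (min ρ₂ ρ₃), by positivity,
    (closedBall_subset_closedBall (min_le_left _ _)).trans hball, δ / 2, half_pos hδ,
    fun r hr hrle g hg hgf => ?_⟩
  obtain ⟨hr1, hr2, hr3⟩ : r ≤ ρ₁ ∧ r ≤ ρ₂ ∧ r ≤ ρ₃ := by simpa using hrle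
  have hup := hausdorffMeasure_image_closedBall_le_of_average_lt hΩ (hf.mono subset_closure)
    ((closedBall_subset_closedBall hr1).trans hball) hr (havg ⟨hr, hr3⟩).1 (havg ⟨hr, hr3⟩).2
  have hlow' := hlow r hr g hg fun y hy => by
    have h1 := hdiff (closedBall_subset_closedBall hr2 hy)
    have h2 : ‖y - x‖ ≤ r := by rwa [← dist_eq_norm, ← mem_closedBall]
    have h3 : g y - f x - A (y - x) = (g y - f y) + (f y - f x - A (y - x)) := by abel
    calc ‖g y - f x - A (y - x)‖ ≤ δ / 2 * r + δ / 2 * ‖y - x‖ := by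
          rw [h3]
          exact (norm_add_le _ _).trans (add_le_add (hgf y hy) h1)
      _ ≤ δ / 2 * r + δ / 2 * r := by gcongr
      _ = δ * r := by ring
  refine le_trans ?_ hlow'
  calc ENNReal.ofReal η * μH[n] (f '' closedBall x r)
      ≤ ENNReal.ofReal η * (ENNReal.ofReal (volMap A / √η) * μH[n] (closedBall x r)) := by gcongr
    _ = ENNReal.ofReal (√η * volMap A) * μH[n] (closedBall x r) := by
        rw [← mul_assoc, ← ENNReal.ofReal_mul hη₁.le]
        congr 2
        rw [mul_div_assoc', div_eq_iff hq0.ne', mul_right_comm, Real.mul_self_sqrt hη₁.le]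
end
end

section
/- Let n ≤ m be natural numbers, let E ⊂ ℝ^n be a compact set, let f : E → ℝ^m be an injective Lipschitz map, and let L ≥ 0. Then for every η ∈ (0,1) there exists δ > 0 such that every L-Lipschitz map g : E → ℝ^m with sup_{x ∈ E} |g(x) − f(x)| ≤ δ satisfies H^n(g(E)) ≥ η · H^n(f(E)). -/
open MeasureTheory Metric Set Filter Topology ENNReal

noncomputable section

open scoped NNReal
open Module (finrank)

/-- Along a line through the identity the determinant is a polynomial of bounded degree, hence
its value at time `1` is an affine combination of its values at sufficiently many nodes. -/
lemma exists_weights_det_one_add {V : Type*} [NormedAddCommGroup V] [NormedSpace ℝ V]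
    [FiniteDimensional ℝ V] (t : ℕ → ℝ) (ht : Function.Injective t) :
    ∃ w : ℕ → ℝ, ∑ i ∈ Finset.range (finrank ℝ V + 1), w i = 1 ∧ ∀ X : V →L[ℝ] V,
      (1 + X).det = ∑ i ∈ Finset.range (finrank ℝ V + 1), w i * (1 + t i • X).det := by
  classical
  set s := Finset.range (finrank ℝ V + 1)
  have hs : s.Nonempty := ⟨0, by simp [s]⟩
  refine ⟨fun i => (Lagrange.basis s t i).eval 1, ?_, fun X => ?_⟩
  · have := congrArg (Polynomial.eval 1) (Lagrange.sum_basis (ht.injOn (s := (s : Set ℕ))) hs)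
    simpa [Polynomial.eval_finsetSum] using this
  · let b := Module.finBasis ℝ V
    let M := LinearMap.toMatrix b b (X : V →ₗ[ℝ] V)
    let p : Polynomial ℝ :=
      Matrix.det ((Polynomial.X : Polynomial ℝ) • M.map Polynomial.C +
        (1 : Matrix (Fin (finrank ℝ V)) (Fin (finrank ℝ V)) ℝ).map Polynomial.C)
    have hp : ∀ c : ℝ, p.eval c = (1 + c • X).det := by
      intro c
      have h1 : (1 + c • X).det = Matrix.det (1 + c • M) := by
        rw [ContinuousLinearMap.det, ← LinearMap.det_toMatrix b]
        congr 1
        have : ((1 + c • X : V →L[ℝ] V) : V →ₗ[ℝ] V) = LinearMap.id + c • (X : V →ₗ[ℝ] V) := rfl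
        rw [this, map_add, map_smul, LinearMap.toMatrix_id]
      rw [h1, ← Polynomial.coe_evalRingHom, RingHom.map_det]
      congr 1
      ext i j
      simp [Matrix.one_apply, apply_ite (Polynomial.eval c), add_comm]
      ring
    have hdeg : p.degree < (s.card : WithBot ℕ) := by
      refine lt_of_le_of_lt Polynomial.degree_le_natDegree ?_
      have := Polynomial.natDegree_det_X_add_C_le M 1
      rw [Fintype.card_fin] at this
      simp only [s, Finset.card_range]
      exact_mod_cast Nat.lt_succ_of_le this
    have key := Lagrange.eq_interpolate_of_eval_eq (fun i => (1 + t i • X).det)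
      (ht.injOn (s := (s : Set ℕ))) hdeg (fun i _ => hp (t i))
    have h1 := hp 1
    rw [one_smul] at h1
    rw [← h1, key, Lagrange.interpolate_apply]
    simp [Polynomial.eval_finsetSum, mul_comm]

lemma bijective_id_add_smul_of_lipschitz {V : Type*} [NormedAddCommGroup V] [NormedSpace ℝ V]
    [CompleteSpace V] {k : V → V} {M : ℝ≥0} (hk : LipschitzWith M k) {t : ℝ} (ht : |t| * M < 1) :
    Function.Bijective (fun x => x + t • k x) := by
  have hlip : ∀ x y, ‖t • k x - t • k y‖ ≤ |t| * M * ‖x - y‖ := by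
    intro x y
    rw [← smul_sub, norm_smul, Real.norm_eq_abs, mul_assoc]
    exact mul_le_mul_of_nonneg_left (hk.norm_sub_le x y) (abs_nonneg t)
  refine ⟨fun x y hxy => ?_, fun y => ?_⟩
  · by_contra hne
    have hpos : 0 < ‖x - y‖ := norm_pos_iff.2 (sub_ne_zero.2 hne)
    have h1 : x - y = -(t • k x - t • k y) := by
      simp only at hxy
      rw [neg_sub, sub_eq_sub_iff_add_eq_add, hxy, add_comm]
    have h2 := hlip x y
    rw [← norm_neg (t • k x - t • k y), ← h1] at h2
    nlinarith
  · let K : ℝ≥0 := ⟨|t| * M, by positivity⟩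
    have hc : ContractingWith K (fun x => y - t • k x) := by
      refine ⟨by exact_mod_cast ht, LipschitzWith.of_dist_le_mul fun a b => ?_⟩
      rw [dist_eq_norm, dist_eq_norm,
        show y - t • k a - (y - t • k b) = -(t • k a - t • k b) by abel, norm_neg]
      exact hlip a b
    refine ⟨ContractingWith.fixedPoint _ hc, ?_⟩
    have := hc.fixedPoint_isFixedPt
    rw [Function.IsFixedPt] at this
    exact (eq_sub_iff_add_eq.1 this.symm)

lemma LipschitzWith.hausdorffMeasure_image_null {V : Type*} [NormedAddCommGroup V]
    [InnerProductSpace ℝ V] [MeasurableSpace V] [BorelSpace V] {k : V → V} {M : ℝ≥0}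
    (hk : LipschitzWith M k) {N : Set V} (hN : μH[finrank ℝ V] N = 0) :
    μH[finrank ℝ V] (k '' N) = 0 := by
  have := hk.hausdorffMeasure_image_le (d := (finrank ℝ V : ℝ)) (by positivity) N
  rw [hN, mul_zero] at this
  exact le_antisymm this bot_le

section

variable {V : Type*} [NormedAddCommGroup V] [InnerProductSpace ℝ V] [FiniteDimensional ℝ V]
  [MeasurableSpace V] [BorelSpace V]

lemma integral_det_one_add_smul_of_small {k : V → V} {M : ℝ≥0} (hk : LipschitzWith M k)
    {B : Set V} (hB : MeasurableSet B) (hBfin : μH[finrank ℝ V] B ≠ ∞) (hkB : ∀ x ∉ B, k x = 0) :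
    ∃ ε > (0 : ℝ), ∀ t : ℝ, |t| < ε →
      IntegrableOn (fun x => (1 + t • fderiv ℝ k x).det) B μH[finrank ℝ V] ∧
      ∫ x in B, (1 + t • fderiv ℝ k x).det ∂μH[finrank ℝ V] = μH[finrank ℝ V].real B := by
  obtain ⟨ρ, hρ, hdet⟩ : ∃ ρ > (0 : ℝ), ∀ X : V →L[ℝ] V, ‖X‖ < ρ → 0 < (1 + X).det := by
    have hcont : ContinuousAt (fun X : V →L[ℝ] V => (1 + X).det) 0 :=
      (ContinuousLinearMap.continuous_det.comp (continuous_const.add continuous_id)).continuousAt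
    have h0 : (0 : ℝ) < (1 + (0 : V →L[ℝ] V)).det := by
      rw [add_zero, ContinuousLinearMap.det]
      change 0 < LinearMap.det (LinearMap.id : V →ₗ[ℝ] V)
      simp
    obtain ⟨ρ, hρ, h⟩ := Metric.eventually_nhds_iff.1 (hcont.eventually (lt_mem_nhds h0))
    exact ⟨ρ, hρ, fun X hX => h (by simpa using hX)⟩
  refine ⟨min 1 ρ / (M + 1), by positivity, fun t ht => ?_⟩
  have htM : |t| * (M + 1) < min 1 ρ := (lt_div_iff₀ (by positivity)).1 ht
  have htM' : |t| * M < min 1 ρ := by nlinarith [abs_nonneg t]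
  let h : V → V := fun x => x + t • k x
  have hbij : Function.Bijective h :=
    bijective_id_add_smul_of_lipschitz hk (htM'.trans_le (min_le_left _ _))
  have hBimage : h '' B = B := by
    have hout : ∀ x ∉ B, h x = x := fun x hx => by simp [h, hkB x hx]
    ext y
    constructor
    · rintro ⟨x, hx, rfl⟩
      by_contra hy
      have := hbij.1 (hout _ hy)
      rw [this] at hy
      exact hy hx
    · intro hy
      obtain ⟨x, rfl⟩ := hbij.2 y
      refine ⟨x, ?_, rfl⟩
      by_contra hx
      rw [hout x hx] at hy
      exact hx hy
  let D := {x | DifferentiableAt ℝ k x}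
  have hD : MeasurableSet D := measurableSet_of_differentiableAt ℝ k
  have hDae : ∀ᵐ x ∂(μH[finrank ℝ V] : Measure V), x ∈ D := hk.ae_differentiableAt
  have hhlip : LipschitzWith (1 + ‖t‖₊ * M) h :=
    LipschitzWith.id.add ((lipschitzWith_smul t).comp hk)
  have hBD : (B ∩ D : Set V) =ᵐ[μH[finrank ℝ V]] B := by
    filter_upwards [hDae] with x hx
    exact propext ⟨fun h => h.1, fun h => ⟨h, hx⟩⟩
  have himage : (h '' (B ∩ D) : Set V) =ᵐ[μH[finrank ℝ V]] B := by
    refine (subset_of_subset_of_eq (image_mono inter_subset_left) hBimage).eventuallyLE.antisymm ?_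
    rw [ae_le_set]
    refine measure_mono_null ?_ (hhlip.hausdorffMeasure_image_null (N := Dᶜ) hDae)
    rintro y ⟨hy, hy'⟩
    rw [← hBimage] at hy
    obtain ⟨x, hx, rfl⟩ := hy
    exact ⟨x, fun hxD => hy' ⟨x, ⟨hx, hxD⟩, rfl⟩, rfl⟩
  have hderiv : ∀ x ∈ B ∩ D, HasFDerivWithinAt h (1 + t • fderiv ℝ k x) (B ∩ D) x := by
    intro x hx
    exact ((hasFDerivAt_id x).add ((hx.2 : DifferentiableAt ℝ k x).hasFDerivAt.const_smul
      t)).hasFDerivWithinAt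
  have habs : ∀ x, |(1 + t • fderiv ℝ k x).det| = (1 + t • fderiv ℝ k x).det := by
    intro x
    refine abs_of_pos (hdet _ ?_)
    rw [norm_smul, Real.norm_eq_abs]
    refine lt_of_le_of_lt ?_ (htM'.trans_le (min_le_right _ _))
    exact mul_le_mul_of_nonneg_left (norm_fderiv_le_of_lipschitz ℝ hk) (abs_nonneg t)
  constructor
  · have := (integrableOn_image_iff_integrableOn_abs_det_fderiv_smul μH[finrank ℝ V]
      (hB.inter hD) hderiv (hbij.1.injOn) (fun _ => (1 : ℝ))).1 ?_
    · simp only [habs, smul_eq_mul, mul_one] at this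
      exact this.congr_set_ae hBD.symm
    · rw [integrableOn_congr_set_ae himage]
      exact integrableOn_const hBfin
  · have := integral_image_eq_integral_abs_det_fderiv_smul μH[finrank ℝ V]
      (hB.inter hD) hderiv (hbij.1.injOn) (fun _ => (1 : ℝ))
    simp only [habs, smul_eq_mul, mul_one] at this
    rw [setIntegral_congr_set hBD, setIntegral_congr_set himage] at this
    rw [← this]
    simp

/-- A Lipschitz perturbation of the identity supported in `B` preserves the signed volume of `B`. -/
lemma integral_det_one_add_fderiv_s8 {k : V → V} {M : ℝ≥0} (hk : LipschitzWith M k)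
    {B : Set V} (hB : MeasurableSet B) (hBfin : μH[finrank ℝ V] B ≠ ∞) (hkB : ∀ x ∉ B, k x = 0) :
    ∫ x in B, (1 + fderiv ℝ k x).det ∂μH[finrank ℝ V] = μH[finrank ℝ V].real B := by
  obtain ⟨ε, hε, h⟩ := integral_det_one_add_smul_of_small hk hB hBfin hkB
  let t : ℕ → ℝ := fun i => ε / (i + 2)
  have ht : Function.Injective t := by
    intro i j hij
    have : (i : ℝ) + 2 = j + 2 := by
      have h1 : (0 : ℝ) < i + 2 := by positivity
      have h2 : (0 : ℝ) < j + 2 := by positivity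
      simp only [t] at hij
      rw [div_eq_div_iff h1.ne' h2.ne'] at hij
      exact (mul_left_cancel₀ hε.ne' hij).symm
    exact_mod_cast add_right_cancel this
  have htε : ∀ i, |t i| < ε := by
    intro i
    have h1 : (0 : ℝ) < i + 2 := by positivity
    rw [abs_of_pos (div_pos hε h1), div_lt_iff₀ h1]
    nlinarith [(Nat.cast_nonneg i : (0 : ℝ) ≤ i)]
  obtain ⟨w, hw, hdet⟩ := exists_weights_det_one_add (V := V) t ht
  rw [integral_congr_ae (ae_of_all _ fun x => hdet (fderiv ℝ k x)),
    integral_finsetSum _ fun i _ => (h _ (htε i)).1.const_mul _]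
  simp_rw [integral_const_mul, (h _ (htε _)).2]
  rw [← Finset.sum_mul, hw, one_mul]

end

section

variable {V : Type*} [NormedAddCommGroup V] [InnerProductSpace ℝ V]

/-- Push a vector of norm less than `R` radially onto the sphere of radius `R`, and fix the vectors
of norm at least `R`. -/
def radialPush (R : ℝ) (z : V) : V := z + max (R - ‖z‖) 0 • (‖z‖⁻¹ • z)

lemma radialPush_of_le {R : ℝ} {z : V} (h : R ≤ ‖z‖) : radialPush R z = z := by
  simp [radialPush, max_eq_right (sub_nonpos.2 h)]

lemma norm_radialPush_of_le {R : ℝ} {z : V} (hz : z ≠ 0) (hR : 0 < R) (h : ‖z‖ ≤ R) :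
    ‖radialPush R z‖ = R := by
  have hz' : 0 < ‖z‖ := norm_pos_iff.2 hz
  have : radialPush R z = (R * ‖z‖⁻¹) • z := by
    rw [radialPush, max_eq_left (sub_nonneg.2 h), smul_smul]
    nth_rewrite 1 [← one_smul ℝ z]
    rw [← add_smul]
    congr 1
    field_simp
    ring
  rw [this, norm_smul, Real.norm_of_nonneg (by positivity)]
  field_simp

lemma norm_radialPush_sub_le {R ρ : ℝ} (hR : 0 ≤ R) (hρ : 0 < ρ) {z w : V} (hz : ρ ≤ ‖z‖)
    (hw : ρ ≤ ‖w‖) :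
    ‖radialPush R z - radialPush R w‖ ≤ (2 + 2 * R / ρ) * ‖z - w‖ := by
  have hz0 : 0 < ‖z‖ := hρ.trans_le hz
  have hw0 : 0 < ‖w‖ := hρ.trans_le hw
  have hu : ‖‖z‖⁻¹ • z - ‖w‖⁻¹ • w‖ ≤ 2 / ρ * ‖z - w‖ := by
    have h1 : ‖z‖⁻¹ • z - ‖w‖⁻¹ • w = ‖z‖⁻¹ • (z - w) + (‖z‖⁻¹ - ‖w‖⁻¹) • w := by module
    have h2 : ‖(‖z‖⁻¹ - ‖w‖⁻¹) • w‖ ≤ ‖z‖⁻¹ * ‖z - w‖ := by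
      rw [norm_smul, inv_sub_inv hz0.ne' hw0.ne', norm_div, norm_mul, norm_norm, norm_norm,
        div_mul_eq_mul_div, mul_div_mul_right _ _ hw0.ne', div_eq_inv_mul]
      gcongr
      simpa [abs_sub_comm, norm_sub_rev] using abs_norm_sub_norm_le w z
    have h3 : ‖‖z‖⁻¹ • (z - w)‖ = ‖z‖⁻¹ * ‖z - w‖ := by
      rw [norm_smul, norm_inv, norm_norm]
    rw [h1]
    refine (norm_add_le _ _).trans ?_
    have h4 : ‖z‖⁻¹ ≤ ρ⁻¹ := by gcongr
    have h5 := mul_le_mul_of_nonneg_right h4 (norm_nonneg (z - w))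
    rw [div_eq_mul_inv]
    linarith
  have hmax : |max (R - ‖z‖) 0 - max (R - ‖w‖) 0| ≤ ‖z - w‖ := by
    refine (abs_max_sub_max_le_abs _ _ _).trans ?_
    rw [_root_.sub_sub_sub_cancel_left, abs_sub_comm]
    exact abs_norm_sub_norm_le z w
  have hsplit : radialPush R z - radialPush R w = (z - w) +
      (max (R - ‖z‖) 0 • (‖z‖⁻¹ • z - ‖w‖⁻¹ • w) +
        (max (R - ‖z‖) 0 - max (R - ‖w‖) 0) • (‖w‖⁻¹ • w)) := by
    simp only [radialPush]
    module
  have hm0 : 0 ≤ max (R - ‖z‖) 0 := le_max_right _ _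
  have hmR : max (R - ‖z‖) 0 ≤ R := max_le (by linarith) hR
  have e1 : ‖max (R - ‖z‖) 0 • (‖z‖⁻¹ • z - ‖w‖⁻¹ • w)‖ ≤ R * (2 / ρ * ‖z - w‖) := by
    rw [norm_smul, Real.norm_of_nonneg hm0]
    exact mul_le_mul hmR hu (norm_nonneg _) hR
  have e2 : ‖(max (R - ‖z‖) 0 - max (R - ‖w‖) 0) • (‖w‖⁻¹ • w)‖ ≤ ‖z - w‖ := by
    rw [norm_smul, norm_smul, norm_inv, norm_norm, inv_mul_cancel₀ hw0.ne', mul_one]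
    exact hmax
  rw [hsplit]
  refine (norm_add_le _ _).trans ?_
  have := norm_add_le (max (R - ‖z‖) 0 • (‖z‖⁻¹ • z - ‖w‖⁻¹ • w))
    ((max (R - ‖z‖) 0 - max (R - ‖w‖) 0) • (‖w‖⁻¹ • w))
  calc _ ≤ ‖z - w‖ + (R * (2 / ρ * ‖z - w‖) + ‖z - w‖) := by linarith
    _ = _ := by ring

variable [FiniteDimensional ℝ V]

lemma det_eq_zero_of_norm_sub_eq_const {G : V → V} {G' : V →L[ℝ] V} {x c : V} {R : ℝ} (hR : R ≠ 0)
    (hG : HasFDerivAt G G' x) (hc : ∀ᶠ y in 𝓝 x, ‖G y - c‖ = R) : G'.det = 0 := by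
  by_contra hdet
  have hcx : ‖G x - c‖ = R := hc.self_of_nhds
  have hsurj : Function.Surjective G' := by
    have := (LinearMap.equivOfDetNeZero (G' : V →ₗ[ℝ] V) hdet).surjective
    exact this
  obtain ⟨v, hv⟩ := hsurj (G x - c)
  have h1 : HasFDerivAt (fun y => ‖G y - c‖ ^ 2) _ x := (hG.sub_const c).norm_sq
  have h2 : HasFDerivAt (fun y => ‖G y - c‖ ^ 2) (0 : V →L[ℝ] ℝ) x :=
    (hasFDerivAt_const (R ^ 2) x).congr_of_eventuallyEq (by
      filter_upwards [hc] with y hy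
      rw [hy])
  have h3 := congrArg (fun L : V →L[ℝ] ℝ => L v) (h1.unique h2)
  simp only [_root_.smul_apply, ContinuousLinearMap.comp_apply, hv, innerSL_apply_apply,
    real_inner_self_eq_norm_sq, hcx, _root_.zero_apply] at h3
  simp [hR] at h3

/-- A Lipschitz self-map of a Euclidean space which is the identity off a bounded set is onto. -/
theorem surjective_of_lipschitz_of_eq_self_off_bounded {h : V → V} {M : ℝ≥0}
    (hh : LipschitzWith M h) {S : Set V} (hS : Bornology.IsBounded S) (hhS : ∀ x ∉ S, h x = x) :
    Function.Surjective h := by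
  borelize V
  intro y₀
  by_contra hy₀
  have hbdd : Bornology.IsBounded (S ∪ h '' S) := hS.union (hh.isBounded_image hS)
  obtain ⟨R₀, hR₀⟩ := hbdd.subset_ball y₀
  set R := max R₀ 1
  have hR : 0 < R := lt_max_of_lt_right one_pos
  have hSR : S ∪ h '' S ⊆ ball y₀ R := hR₀.trans (ball_subset_ball (le_max_left _ _))
  have hmaps : ∀ x ∈ ball y₀ R, h x ∈ ball y₀ R := by
    intro x hx
    by_cases hxS : x ∈ S
    · exact hSR (Or.inr ⟨x, hxS, rfl⟩)
    · rwa [hhS x hxS]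
  have hout : ∀ x ∉ ball y₀ R, h x = x := fun x hx => hhS x fun hxS => hx (hSR (Or.inl hxS))
  obtain ⟨ρ, hρ, hρR, hfar⟩ : ∃ ρ > (0 : ℝ), ρ ≤ R ∧ ∀ x, ρ ≤ ‖h x - y₀‖ := by
    have hcomp : IsCompact (h '' closedBall y₀ R) :=
      (isCompact_closedBall y₀ R).image hh.continuous
    have hnot : y₀ ∉ h '' closedBall y₀ R := fun ⟨x, _, hx⟩ => hy₀ ⟨x, hx⟩
    obtain ⟨ρ, hρ, hball⟩ := Metric.isOpen_iff.1 hcomp.isClosed.isOpen_compl y₀ hnot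
    refine ⟨min ρ R, lt_min hρ hR, min_le_right _ _, fun x => ?_⟩
    by_cases hx : x ∈ ball y₀ R
    · refine (min_le_left _ _).trans (not_lt.1 fun hlt => ?_)
      exact hball (mem_ball_iff_norm.2 hlt) ⟨x, ball_subset_closedBall hx, rfl⟩
    · refine (min_le_right _ _).trans ?_
      rw [hout x hx]
      exact not_lt.1 fun hlt => hx (mem_ball_iff_norm.2 hlt)
  let G : V → V := fun x => y₀ + radialPush R (h x - y₀)
  let C : ℝ≥0 := ⟨2 + 2 * R / ρ, by positivity⟩
  have hG : LipschitzWith (C * M) G := by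
    refine LipschitzWith.of_dist_le_mul fun x y => ?_
    rw [dist_eq_norm, add_sub_add_left_eq_sub]
    refine (norm_radialPush_sub_le hR.le hρ (hfar x) (hfar y)).trans ?_
    rw [sub_sub_sub_cancel_right, NNReal.coe_mul, mul_assoc]
    exact mul_le_mul_of_nonneg_left (by simpa [dist_eq_norm] using hh.dist_le_mul x y) C.2
  have hGball : ∀ x ∈ ball y₀ R, ‖G x - y₀‖ = R := by
    intro x hx
    simp only [G, add_sub_cancel_left]
    refine norm_radialPush_of_le (norm_pos_iff.1 (hρ.trans_le (hfar x))) hR ?_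
    exact (mem_ball_iff_norm.1 (hmaps x hx)).le
  have hGout : ∀ x ∉ ball y₀ R, G x - x = 0 := by
    intro x hx
    simp only [G, hout x hx]
    rw [radialPush_of_le (not_lt.1 fun hlt => hx (mem_ball_iff_norm.2 hlt))]
    abel
  have hk : LipschitzWith (C * M + 1) (fun x => G x - x) := hG.sub LipschitzWith.id
  have hfin : μH[finrank ℝ V] (ball y₀ R) ≠ ∞ := measure_ball_lt_top.ne
  have hvol := integral_det_one_add_fderiv_s8 hk measurableSet_ball hfin hGout
  have hzero : ∫ x in ball y₀ R, (1 + fderiv ℝ (fun x => G x - x) x).det ∂μH[finrank ℝ V] = 0 := by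
    refine setIntegral_eq_zero_of_ae_eq_zero ?_
    have hd : ∀ᵐ x ∂(μH[finrank ℝ V] : Measure V), DifferentiableAt ℝ (fun x => G x - x) x :=
      hk.ae_differentiableAt
    filter_upwards [hd] with x hx hxB
    have hGx : HasFDerivAt G (1 + fderiv ℝ (fun x => G x - x) x) x := by
      have := (hasFDerivAt_id x).add hx.hasFDerivAt
      refine this.congr_of_eventuallyEq (Eventually.of_forall fun y => ?_)
      simp
    refine det_eq_zero_of_norm_sub_eq_const (c := y₀) hR.ne' hGx ?_
    filter_upwards [isOpen_ball.mem_nhds hxB] with y hy using hGball y hy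
  rw [hzero] at hvol
  have hpos : 0 < μH[finrank ℝ V].real (ball y₀ R) :=
    ENNReal.toReal_pos (measure_ball_pos _ _ hR).ne' hfin
  exact hpos.ne hvol

end

lemma EuclideanSpace.norm_le_card_mul {n : ℕ} (v : Euc n) {c : ℝ} (hc : 0 ≤ c)
    (h : ∀ i, |v i| ≤ c) : ‖v‖ ≤ n * c := by
  rw [EuclideanSpace.norm_eq]
  refine Real.sqrt_le_iff.2 ⟨by positivity, ?_⟩
  have h1 : ∑ i, ‖v i‖ ^ 2 ≤ ∑ _i : Fin n, c ^ 2 :=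
    Finset.sum_le_sum fun i _ => by
      rw [Real.norm_eq_abs]
      exact pow_le_pow_left₀ (abs_nonneg _) (h i) 2
  have h2 : (n : ℝ) ≤ (n : ℝ) ^ 2 := by exact_mod_cast Nat.le_self_pow two_ne_zero n
  simp only [Finset.sum_const, Finset.card_univ, Fintype.card_fin, nsmul_eq_mul] at h1
  nlinarith [sq_nonneg c]

/-- If a Lipschitz map defined on a subset `S` of a ball is uniformly close to a translation, then
its image covers the ball up to a loss controlled by the size of the complement of `S`. -/
lemma measure_closedBall_le_image_add {n : ℕ} {S : Set (Euc n)} {h : Euc n → Euc n} {M : ℝ≥0}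
    (hh : LipschitzOnWith M h S) {x b : Euc n} {r τ : ℝ}
    (hclose : ∀ y ∈ S, ‖h y - y - b‖ ≤ τ * r) :
    μH[n] (closedBall x r) ≤ μH[n] (h '' S) + ((1 + n * (M + 1) : ℝ≥0) : ℝ≥0∞) ^ n *
      μH[n] (closedBall x r \ (S ∩ closedBall x ((1 - τ) * r))) := by
  have hk : ∀ i : Fin n, LipschitzOnWith (M + 1) (fun y => (h y - y - b) i) S := by
    intro i
    refine LipschitzOnWith.of_dist_le_mul fun y hy z hz => ?_
    rw [Real.dist_eq]
    have h1 : (h y - y - b) i - (h z - z - b) i = ((h y - h z) - (y - z)) i := by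
      simp only [PiLp.sub_apply]
      ring
    rw [h1, dist_eq_norm, ← Real.norm_eq_abs]
    refine (PiLp.norm_apply_le _ i).trans ((norm_sub_le _ _).trans ?_)
    have h2 := hh.dist_le_mul y hy z hz
    rw [dist_eq_norm, dist_eq_norm] at h2
    push_cast
    linarith
  choose k hklip hkeq using fun i => (hk i).extend_real
  let ψ : Euc n → ℝ := fun y => max 0 (min (τ * r) (r - ‖y - x‖))
  have hψ : LipschitzWith 1 ψ := by
    refine LipschitzWith.const_max (LipschitzWith.const_min ?_ _) _
    refine LipschitzWith.of_dist_le_mul fun y z => ?_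
    rw [Real.dist_eq, _root_.sub_sub_sub_cancel_left, abs_sub_comm, dist_eq_norm]
    simpa using abs_norm_sub_norm_le (y - x) (z - x)
  let c : Fin n → Euc n → ℝ := fun i y => max (-ψ y) (min (k i y) (ψ y))
  have hc : ∀ i, LipschitzWith (M + 1) (c i) := by
    intro i
    have := hψ.neg.max ((hklip i).min hψ)
    simpa using this
  let H : Euc n → Euc n := fun y => y + WithLp.toLp 2 (fun i => c i y)
  have hH : LipschitzWith (1 + n * (M + 1)) H := by
    refine LipschitzWith.id.add (LipschitzWith.of_dist_le_mul fun y z => ?_)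
    rw [dist_eq_norm]
    push_cast
    rw [mul_assoc]
    refine EuclideanSpace.norm_le_card_mul _ (by positivity) fun i => ?_
    have := (hc i).dist_le_mul y z
    rw [Real.dist_eq] at this
    simpa using this
  have hHout : ∀ y ∉ closedBall x r, H y = y := by
    intro y hy
    have hψ0 : ψ y = 0 := by
      refine max_eq_left ((min_le_right _ _).trans ?_)
      rw [mem_closedBall_iff_norm, not_le] at hy
      linarith
    have : (fun i => c i y) = 0 := by
      funext i
      simp [c, hψ0]
    simp [H, this]
  have hsurj := surjective_of_lipschitz_of_eq_self_off_bounded hH isBounded_closedBall hHout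
  set S' := S ∩ closedBall x ((1 - τ) * r)
  have hHin : ∀ y ∈ S', H y = h y - b := by
    rintro y ⟨hyS, hy⟩
    rw [mem_closedBall_iff_norm] at hy
    have hψy : τ * r ≤ ψ y := le_max_of_le_right (le_min le_rfl (by linarith))
    have : (fun i => c i y) = fun i => (h y - y - b) i := by
      funext i
      have h1 : |(h y - y - b) i| ≤ ψ y := by
        rw [← Real.norm_eq_abs]
        exact (PiLp.norm_apply_le _ i).trans ((hclose y hyS).trans hψy)
      have h2 := abs_le.1 h1
      simp only [c]
      rw [← hkeq i hyS, min_eq_left h2.2, max_eq_right h2.1]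
    simp only [H, this]
    change y + (h y - y - b) = h y - b
    abel
  have hcover : closedBall x r ⊆ (fun z => z - b) '' (h '' S) ∪ H '' (closedBall x r \ S') := by
    intro y hy
    obtain ⟨z, rfl⟩ := hsurj y
    by_cases hz : z ∈ closedBall x r
    · by_cases hzS : z ∈ S'
      · exact Or.inl ⟨h z, ⟨z, hzS.1, rfl⟩, (hHin z hzS).symm⟩
      · exact Or.inr ⟨z, ⟨hz, hzS⟩, rfl⟩
    · rw [hHout z hz] at hy
      exact absurd hy hz
  refine (measure_mono hcover).trans ((measure_union_le _ _).trans (add_le_add ?_ ?_))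
  · exact ((IsometryEquiv.subRight b).isometry.hausdorffMeasure_image
      (Or.inl (Nat.cast_nonneg n)) _).le
  · simpa using hH.hausdorffMeasure_image_le (Nat.cast_nonneg n) (closedBall x r \ S')

/-- An injective linear map into a Euclidean space is, up to an isometry onto its range, a linear
automorphism of its source. -/
lemma exists_equiv_of_injective {n m : ℕ} {A : Euc n →L[ℝ] Euc m} (hA : Function.Injective A) :
    ∃ (T : Euc n ≃L[ℝ] Euc n) (π : Euc m →L[ℝ] Euc n), (∀ w, ‖π w‖ ≤ ‖w‖) ∧
      (∀ v, π (A v) = T v) ∧ ∀ v, ‖T v‖ = ‖A v‖ := by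
  let U := LinearMap.range (A : Euc n →ₗ[ℝ] Euc m)
  have hU : finrank ℝ U = n := by
    rw [LinearMap.finrank_range_of_inj hA, finrank_euclideanSpace_fin]
  let e : U ≃ₗᵢ[ℝ] Euc n := (stdOrthonormalBasis ℝ U).repr.trans
    (LinearIsometryEquiv.piLpCongrLeft 2 ℝ ℝ (finCongr hU))
  let T₀ : Euc n ≃ₗ[ℝ] Euc n :=
    (LinearEquiv.ofInjective (A : Euc n →ₗ[ℝ] Euc m) hA).trans e.toLinearEquiv
  let P : Euc m →L[ℝ] U := U.orthogonalProjectionOnto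
  refine ⟨T₀.toContinuousLinearEquiv, (e.toContinuousLinearEquiv : U →L[ℝ] Euc n).comp P,
    fun w => ?_, fun v => ?_, fun v => ?_⟩
  · change ‖e (P w)‖ ≤ _
    rw [e.norm_map]
    exact U.norm_orthogonalProjectionOnto_apply_le w
  · change e (P (A v)) = e _
    congr 1
    exact U.orthogonalProjectionOnto_mem_subspace_eq_self ⟨A v, LinearMap.mem_range_self _ v⟩
  · change ‖e _‖ = _
    rw [e.norm_map]
    rfl

lemma hausdorffMeasure_image_equiv {n : ℕ} (T : Euc n ≃L[ℝ] Euc n) (S : Set (Euc n)) :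
    μH[n] (T '' S) = ENNReal.ofReal |(T : Euc n →L[ℝ] Euc n).det| * μH[n] S :=
  Measure.addHaar_image_continuousLinearMap μH[n] (T : Euc n →L[ℝ] Euc n) S

/-- If `f` is approximated on `S` by a linear map dominated by the automorphism `T`, then it expands
the measure of `S` by at most about `|det T|`. -/
lemma hausdorffMeasure_image_le_of_approximatesLinearOn {n m : ℕ} {f : Euc n → Euc m}
    {A : Euc n →L[ℝ] Euc m} {S : Set (Euc n)} {c : ℝ≥0} (hf : ApproximatesLinearOn f A S c)
    (T : Euc n ≃L[ℝ] Euc n) (hT : ∀ v, ‖A v‖ ≤ ‖T v‖) :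
    μH[n] (f '' S) ≤ ENNReal.ofReal ((1 + c * ‖(T.symm : Euc n →L[ℝ] Euc n)‖) ^ n *
      |(T : Euc n →L[ℝ] Euc n).det|) * μH[n] S := by
  have hlip : LipschitzOnWith (1 + c * ‖(T.symm : Euc n →L[ℝ] Euc n)‖₊) (f ∘ T.symm) (T '' S) := by
    refine LipschitzOnWith.of_dist_le_mul ?_
    rintro _ ⟨y, hy, rfl⟩ _ ⟨z, hz, rfl⟩
    simp only [Function.comp_apply, ContinuousLinearEquiv.symm_apply_apply, dist_eq_norm]
    rw [← map_sub]
    have h1 := hf y hy z hz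
    have h2 := hT (y - z)
    have h3 : ‖y - z‖ ≤ ‖(T.symm : Euc n →L[ℝ] Euc n)‖ * ‖T (y - z)‖ := by
      simpa using (T.symm : Euc n →L[ℝ] Euc n).le_opNorm (T (y - z))
    have h4 : ‖f y - f z‖ ≤ ‖f y - f z - A (y - z)‖ + ‖A (y - z)‖ := by
      simpa using norm_add_le (f y - f z - A (y - z)) (A (y - z))
    have h5 := mul_le_mul_of_nonneg_left h3 c.coe_nonneg
    push_cast
    linarith
  have himage : f '' S = (f ∘ T.symm) '' (T '' S) := by
    rw [image_image]
    simp
  rw [himage]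
  refine (hlip.hausdorffMeasure_image_le (Nat.cast_nonneg n)).trans_eq ?_
  rw [hausdorffMeasure_image_equiv, ← mul_assoc, ENNReal.ofReal_mul (by positivity),
    ENNReal.rpow_natCast, ENNReal.ofReal_pow (by positivity)]
  congr 3
  rw [← ENNReal.ofReal_coe_nnreal]
  simp

/-- A non-injective linear map is dominated by automorphisms of arbitrarily small determinant. -/
lemma exists_equiv_det_lt_of_not_injective {n m : ℕ} {A : Euc n →L[ℝ] Euc m}
    (hA : ¬ Function.Injective A) {ε : ℝ} (hε : 0 < ε) :
    ∃ T : Euc n ≃L[ℝ] Euc n, (∀ v, ‖A v‖ ≤ ‖T v‖) ∧ |(T : Euc n →L[ℝ] Euc n).det| < ε := by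
  obtain ⟨e, he, hAe⟩ : ∃ e : Euc n, ‖e‖ = 1 ∧ A e = 0 := by
    rw [injective_iff_map_eq_zero] at hA
    push Not at hA
    obtain ⟨v, hv, hv0⟩ := hA
    have : ‖v‖ ≠ 0 := norm_ne_zero_iff.2 hv0
    exact ⟨‖v‖⁻¹ • v, by rw [norm_smul, norm_inv, norm_norm, inv_mul_cancel₀ this], by simp [hv]⟩
  have hee : inner ℝ e e = 1 := by rw [real_inner_self_eq_norm_sq, he, one_pow]
  let P : Euc n →L[ℝ] Euc n := (innerSL ℝ e).smulRight e
  have hP : ∀ v, P v = inner ℝ e v • e := fun v => rfl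
  set Λ : ℝ := ‖A‖ + 1
  have hΛ : 0 < Λ := by positivity
  let X : ℝ → Euc n →L[ℝ] Euc n := fun κ => Λ • (1 - P) + κ • P
  have hX : ∀ κ v, X κ v = Λ • (v - inner ℝ e v • e) + κ • (inner ℝ e v • e) := fun κ v => rfl
  have hcont : Continuous fun κ => (X κ).det :=
    ContinuousLinearMap.continuous_det.comp (by fun_prop)
  have hX0 : (X 0).det = 0 := by
    by_contra hdet
    have hinj := (LinearMap.equivOfDetNeZero (X 0 : Euc n →ₗ[ℝ] Euc n) hdet).injective
    have : e = 0 := hinj (by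
      change X 0 e = X 0 0
      rw [map_zero, hX, hee]
      simp)
    rw [this, norm_zero] at he
    exact zero_ne_one he
  have hsmall : ∀ᶠ κ in 𝓝[>] (0 : ℝ), |(X κ).det| < ε := by
    refine ((hcont.abs.tendsto 0).mono_left nhdsWithin_le_nhds).eventually (gt_mem_nhds ?_)
    simpa [hX0] using hε
  obtain ⟨κ, hκε, hκ⟩ := (hsmall.and self_mem_nhdsWithin).exists
  replace hκ : 0 < κ := hκ
  have hproj : ∀ w : Euc n, ‖w - inner ℝ e w • e‖ ≤ ‖w‖ := by
    intro w
    refine le_of_sq_le_sq ?_ (norm_nonneg _)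
    rw [norm_sub_sq_real, inner_smul_right, norm_smul, he, real_inner_comm, mul_one,
      Real.norm_eq_abs, sq_abs]
    nlinarith [sq_nonneg (inner ℝ e w)]
  have hXin : ∀ v, inner ℝ e (X κ v) = κ * inner ℝ e v := by
    intro v
    rw [hX, inner_add_right, inner_smul_right, inner_sub_right, inner_smul_right, inner_smul_right,
      inner_smul_right, hee]
    ring
  have hbound : ∀ v, Λ * ‖v - inner ℝ e v • e‖ ≤ ‖X κ v‖ := by
    intro v
    have h1 := hproj (X κ v)
    have h2 : X κ v - inner ℝ e (X κ v) • e = Λ • (v - inner ℝ e v • e) := by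
      rw [hXin, hX]
      module
    rwa [h2, norm_smul, Real.norm_of_nonneg hΛ.le] at h1
  have hinj : Function.Injective (X κ) := by
    rw [injective_iff_map_eq_zero]
    intro v hv
    have h1 : inner ℝ e v = 0 := by
      have := hXin v
      rw [hv, inner_zero_right] at this
      exact (mul_eq_zero.1 this.symm).resolve_left hκ.ne'
    have h2 := hbound v
    rw [hv, norm_zero, h1, zero_smul, sub_zero] at h2
    exact norm_le_zero_iff.1 (nonpos_of_mul_nonpos_right h2 hΛ)
  let T := (LinearEquiv.ofInjectiveEndo (X κ : Euc n →ₗ[ℝ] Euc n) hinj).toContinuousLinearEquiv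
  have hTX : (T : Euc n →L[ℝ] Euc n) = X κ := by
    ext1 v
    rfl
  refine ⟨T, fun v => ?_, by rwa [hTX]⟩
  change _ ≤ ‖X κ v‖
  refine le_trans ?_ (hbound v)
  have h1 : A v = A (v - inner ℝ e v • e) := by simp [hAe]
  rw [h1]
  refine (A.le_opNorm _).trans ?_
  gcongr
  simp [Λ]

lemma exists_pos_forall_hausdorffMeasure_image_le_of_not_injective {n m : ℕ}
    {A : Euc n →L[ℝ] Euc m} (hA : ¬ Function.Injective A) {ε : ℝ} (hε : 0 < ε) :
    ∃ c : ℝ≥0, c ≠ 0 ∧ ∀ (f : Euc n → Euc m) (S : Set (Euc n)), ApproximatesLinearOn f A S c →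
      μH[n] (f '' S) ≤ ENNReal.ofReal ε * μH[n] S := by
  obtain ⟨T, hT, hdet⟩ := exists_equiv_det_lt_of_not_injective hA hε
  have hcont : Continuous fun c : ℝ≥0 => (1 + (c : ℝ) * ‖(T.symm : Euc n →L[ℝ] Euc n)‖) ^ n *
      |(T : Euc n →L[ℝ] Euc n).det| := by fun_prop
  have hsmall : ∀ᶠ c : ℝ≥0 in 𝓝[>] 0, (1 + (c : ℝ) * ‖(T.symm : Euc n →L[ℝ] Euc n)‖) ^ n *
      |(T : Euc n →L[ℝ] Euc n).det| < ε := by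
    refine ((hcont.tendsto 0).mono_left nhdsWithin_le_nhds).eventually (gt_mem_nhds ?_)
    simpa using hdet
  obtain ⟨c, hcε, hc⟩ := (hsmall.and self_mem_nhdsWithin).exists
  replace hc : 0 < c := hc
  refine ⟨c, hc.ne', fun f S hf => ?_⟩
  refine (hausdorffMeasure_image_le_of_approximatesLinearOn hf T hT).trans ?_
  gcongr

/-- Lower bound for the measure of the image under a Lipschitz map `g` close to a map `f` which is
well approximated by an injective linear map on a large part `S` of a ball. -/
lemma det_mul_measure_closedBall_le {n m : ℕ} {f g : Euc n → Euc m} {A : Euc n →L[ℝ] Euc m}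
    {S : Set (Euc n)} {c L : ℝ≥0} {x : Euc n} {r : ℝ}
    (hf : ApproximatesLinearOn f A S c) (hxS : x ∈ S) (hSr : S ⊆ closedBall x r)
    (hg : LipschitzOnWith L g S) (hgf : ∀ y ∈ S, ‖g y - f y‖ ≤ c * r)
    (T : Euc n ≃L[ℝ] Euc n) (π : Euc m →L[ℝ] Euc n) (hπ : ∀ w, ‖π w‖ ≤ ‖w‖)
    (hπA : ∀ v, π (A v) = T v) :
    ENNReal.ofReal |(T : Euc n →L[ℝ] Euc n).det| * μH[n] (closedBall x r) ≤
      μH[n] (g '' S) + ENNReal.ofReal (|(T : Euc n →L[ℝ] Euc n).det| *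
        (1 + n * (‖(T.symm : Euc n →L[ℝ] Euc n)‖ * L + 1)) ^ n) *
      μH[n] (closedBall x r \ (S ∩ closedBall x
        ((1 - 2 * ‖(T.symm : Euc n →L[ℝ] Euc n)‖ * c) * r))) := by
  set N := ‖(T.symm : Euc n →L[ℝ] Euc n)‖₊ with hN
  have hTs : ∀ w, ‖T.symm w‖ ≤ N * ‖w‖ := fun w => (T.symm : Euc n →L[ℝ] Euc n).le_opNorm w
  have hπlip : LipschitzWith 1 π := LipschitzWith.of_dist_le_mul fun a b => by
    rw [dist_eq_norm, dist_eq_norm, ← map_sub, NNReal.coe_one, one_mul]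
    exact hπ _
  have hh : LipschitzOnWith (N * L) (fun y => T.symm (π (g y))) S := by
    refine LipschitzOnWith.of_dist_le_mul fun y hy z hz => ?_
    rw [dist_eq_norm, ← map_sub, ← map_sub]
    refine (hTs _).trans ?_
    have := hg.dist_le_mul y hy z hz
    rw [dist_eq_norm] at this
    push_cast
    rw [mul_assoc]
    exact mul_le_mul_of_nonneg_left ((hπ _).trans this) N.coe_nonneg
  have hclose : ∀ y ∈ S, ‖T.symm (π (g y)) - y - (T.symm (π (f x)) - x)‖ ≤ 2 * N * c * r := by
    intro y hy
    have h1 : T.symm (π (g y)) - y - (T.symm (π (f x)) - x) =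
        T.symm (π ((g y - f y) + (f y - f x - A (y - x)))) := by
      have : y - x = T.symm (π (A (y - x))) := by rw [hπA, T.symm_apply_apply]
      rw [map_add, map_sub, map_sub π (f y - f x), map_add, map_sub T.symm (π (f y - f x)), ← this]
      simp only [map_sub]
      abel
    rw [h1]
    refine (hTs _).trans ?_
    have h2 : ‖y - x‖ ≤ r := mem_closedBall_iff_norm.1 (hSr hy)
    have h3 := (hπ ((g y - f y) + (f y - f x - A (y - x)))).trans (norm_add_le _ _)
    have h4 := hf y hy x hxS
    have h5 := mul_le_mul_of_nonneg_left h2 c.coe_nonneg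
    have h6 := hgf y hy
    have h7 : ‖π ((g y - f y) + (f y - f x - A (y - x)))‖ ≤ 2 * (c * r) := by linarith
    have h8 := mul_le_mul_of_nonneg_left h7 N.coe_nonneg
    linarith
  have key := measure_closedBall_le_image_add hh (x := x) hclose
  have himage : T '' ((fun y => T.symm (π (g y))) '' S) = π '' (g '' S) := by
    simp [image_image]
  have hle : ENNReal.ofReal |(T : Euc n →L[ℝ] Euc n).det| *
      μH[n] ((fun y => T.symm (π (g y))) '' S) ≤ μH[n] (g '' S) := by
    rw [← hausdorffMeasure_image_equiv, himage]
    simpa using hπlip.hausdorffMeasure_image_le (Nat.cast_nonneg n) (g '' S)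
  refine (mul_le_mul_right key _).trans ?_
  rw [mul_add]
  refine add_le_add hle (le_of_eq ?_)
  rw [← mul_assoc, ENNReal.ofReal_mul (abs_nonneg _), ENNReal.ofReal_pow (by positivity)]
  congr 3
  rw [← ENNReal.ofReal_coe_nnreal]
  simp [hN]

lemma measure_diff_le_of_le_measure_inter {α : Type*} [MeasurableSpace α] {μ : Measure α}
    {B X : Set α} (hB : μ B ≠ ∞) (hX : MeasurableSet X) {s : ℝ} (hs₀ : 0 ≤ s) (hs₁ : s ≤ 1)
    (h : ENNReal.ofReal (1 - s) * μ B ≤ μ (B ∩ X)) :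
    μ (B \ X) ≤ ENNReal.ofReal s * μ B := by
  have h1 : ENNReal.ofReal s * μ B + ENNReal.ofReal (1 - s) * μ B = μ B := by
    rw [← add_mul, ← ENNReal.ofReal_add hs₀ (by linarith)]
    simp
  have h2 : μ (B \ X) + ENNReal.ofReal (1 - s) * μ B ≤
      ENNReal.ofReal s * μ B + ENNReal.ofReal (1 - s) * μ B := by
    rw [h1]
    calc μ (B \ X) + ENNReal.ofReal (1 - s) * μ B
      _ ≤ μ (B \ X) + μ (B ∩ X) := by gcongr
      _ = μ B := by rw [add_comm, measure_inter_add_sdiff B hX]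
  exact (ENNReal.add_le_add_iff_right (ENNReal.mul_ne_top ENNReal.ofReal_ne_top hB)).1 h2

lemma LipschitzOnWith.hausdorffMeasure_image_le_ofReal {n m : ℕ} {f : Euc n → Euc m} {K : ℝ≥0}
    {S : Set (Euc n)} (hf : LipschitzOnWith K f S) :
    μH[n] (f '' S) ≤ ENNReal.ofReal ((K : ℝ) ^ n) * μH[n] S := by
  refine (hf.hausdorffMeasure_image_le (Nat.cast_nonneg n)).trans_eq ?_
  rw [ENNReal.rpow_natCast, ENNReal.ofReal_pow K.coe_nonneg, ENNReal.ofReal_coe_nnreal]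

/-- Stability of the measure of images of small balls around a density point of a set on which `f`
is well approximated by an injective linear map. -/
lemma exists_pos_forall_eventually_le_of_injective {n m : ℕ} {A : Euc n →L[ℝ] Euc m}
    (hA : Function.Injective A) (K L : ℝ≥0) {η : ℝ} (hη₀ : 0 < η) (hη₁ : η < 1) :
    ∃ c : ℝ≥0, c ≠ 0 ∧ ∀ (f : Euc n → Euc m) (E S : Set (Euc n)), S ⊆ E → MeasurableSet S →
      LipschitzOnWith K f E → ApproximatesLinearOn f A S c → ∀ x ∈ S,
      Tendsto (fun r => μH[n] (S ∩ closedBall x r) / μH[n] (closedBall x r)) (𝓝[>] 0) (𝓝 1) →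
      ∀ᶠ r in 𝓝[>] (0 : ℝ), ∀ g : Euc n → Euc m, LipschitzOnWith L g E →
        (∀ y ∈ E, ‖g y - f y‖ ≤ c * r) →
        ENNReal.ofReal η * μH[n] (f '' (E ∩ closedBall x r)) ≤
          μH[n] (g '' (E ∩ closedBall x r)) := by
  obtain ⟨T, π, hπ, hπA, hTA⟩ := exists_equiv_of_injective hA
  set J : ℝ := |(T : Euc n →L[ℝ] Euc n).det|
  have hJ : 0 < J := abs_pos.2 (LinearEquiv.isUnit_det' T.toLinearEquiv).ne_zero
  set N : ℝ := ‖(T.symm : Euc n →L[ℝ] Euc n)‖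
  have hN : 0 ≤ N := norm_nonneg _
  set Q : ℝ := (1 + n * (N * L + 1)) ^ n
  have hQ : 0 ≤ Q := by positivity
  obtain ⟨c, hc, hc1, hcN, hcoef⟩ : ∃ c : ℝ≥0, 0 < c ∧ (c : ℝ) < 1 ∧ 2 * N * c < 1 ∧
      η * ((1 + c * N) ^ n * J + (K : ℝ) ^ n * c) +
        J * Q * (c + (1 - (1 - 2 * N * c) ^ n)) < J := by
    have c1 : Continuous fun c : ℝ≥0 => (c : ℝ) := by fun_prop
    have c2 : Continuous fun c : ℝ≥0 => 2 * N * (c : ℝ) := by fun_prop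
    have c3 : Continuous fun c : ℝ≥0 => η * ((1 + (c : ℝ) * N) ^ n * J + (K : ℝ) ^ n * c) +
        J * Q * (c + (1 - (1 - 2 * N * c) ^ n)) := by fun_prop
    have e1 : ∀ᶠ c : ℝ≥0 in 𝓝[>] (0 : ℝ≥0), (c : ℝ) < 1 :=
      ((c1.tendsto 0).mono_left nhdsWithin_le_nhds).eventually (gt_mem_nhds (by simp))
    have e2 : ∀ᶠ c : ℝ≥0 in 𝓝[>] (0 : ℝ≥0), 2 * N * (c : ℝ) < 1 :=
      ((c2.tendsto 0).mono_left nhdsWithin_le_nhds).eventually (gt_mem_nhds (by simp))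
    have e3 := ((c3.tendsto 0).mono_left nhdsWithin_le_nhds : Tendsto _ (𝓝[>] (0 : ℝ≥0)) _).eventually
      (gt_mem_nhds (show _ < J by simpa using mul_lt_of_lt_one_left hJ hη₁))
    obtain ⟨c, ⟨h1, h2, h3⟩, h4⟩ := ((e1.and (e2.and e3)).and self_mem_nhdsWithin).exists
    exact ⟨c, h4, h1, h2, h3⟩
  refine ⟨c, hc.ne', fun f E S hSE hS hf hfA x hxS hdens => ?_⟩
  have hc' : (0 : ℝ) < c := hc
  have hev : ∀ᶠ r in 𝓝[>] (0 : ℝ), ENNReal.ofReal (1 - c) <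
      μH[n] (S ∩ closedBall x r) / μH[n] (closedBall x r) := by
    refine hdens.eventually (lt_mem_nhds ?_)
    rw [← ENNReal.ofReal_one]
    exact (ENNReal.ofReal_lt_ofReal_iff one_pos).2 (by linarith)
  filter_upwards [hev, self_mem_nhdsWithin] with r hr hr0 g hg hgf
  replace hr0 : 0 < r := hr0
  set B := closedBall x r
  have hBfin : μH[n] B ≠ ∞ := measure_closedBall_lt_top.ne
  have hBpos : μH[n] B ≠ 0 := (measure_closedBall_pos _ _ hr0).ne'
  have hD : μH[n] (B \ S) ≤ ENNReal.ofReal c * μH[n] B := by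
    refine measure_diff_le_of_le_measure_inter hBfin hS hc'.le hc1.le ?_
    rw [inter_comm]
    exact (ENNReal.le_div_iff_mul_le (Or.inl hBpos) (Or.inl hBfin)).1 hr.le
  set τ := 2 * N * (c : ℝ)
  have hτ : 0 ≤ τ := by positivity
  have hpow : (1 - τ) ^ n ≤ 1 := pow_le_one₀ (by linarith) (by linarith)
  have hpow0 : 0 ≤ (1 - τ) ^ n := pow_nonneg (by linarith) n
  have hann : μH[n] (B \ closedBall x ((1 - τ) * r)) ≤
      ENNReal.ofReal (1 - (1 - τ) ^ n) * μH[n] B := by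
    refine measure_diff_le_of_le_measure_inter hBfin measurableSet_closedBall (by linarith)
      (by linarith) ?_
    rw [inter_eq_self_of_subset_right (closedBall_subset_closedBall (by nlinarith)),
      Measure.addHaar_closedBall_mul _ _ (by linarith) hr0.le, finrank_euclideanSpace_fin,
      _root_.sub_sub_cancel, Measure.addHaar_closedBall_center]
  have hD' : μH[n] (B \ (S ∩ B ∩ closedBall x ((1 - τ) * r))) ≤
      ENNReal.ofReal (c + (1 - (1 - τ) ^ n)) * μH[n] B := by
    rw [ENNReal.ofReal_add hc'.le (by linarith), add_mul]
    refine le_trans (measure_mono ?_) ((measure_union_le _ _).trans (add_le_add hD hann))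
    rintro y ⟨hyB, hy⟩
    by_cases hyS : y ∈ S
    · exact Or.inr ⟨hyB, fun h => hy ⟨⟨hyS, hyB⟩, h⟩⟩
    · exact Or.inl ⟨hyB, hyS⟩
  have hupper : μH[n] (f '' (E ∩ B)) ≤
      ENNReal.ofReal ((1 + c * N) ^ n * J + (K : ℝ) ^ n * c) * μH[n] B := by
    rw [ENNReal.ofReal_add (by positivity) (by positivity), add_mul,
      ENNReal.ofReal_mul (p := (K : ℝ) ^ n) (by positivity), mul_assoc]
    have hsub : f '' (E ∩ B) ⊆ f '' (S ∩ B) ∪ f '' ((E ∩ B) \ S) := by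
      rw [← image_union]
      refine image_mono fun y hy => ?_
      by_cases hyS : y ∈ S
      · exact Or.inl ⟨hyS, hy.2⟩
      · exact Or.inr ⟨hy, hyS⟩
    refine (measure_mono hsub).trans ((measure_union_le _ _).trans (add_le_add ?_ ?_))
    · refine (hausdorffMeasure_image_le_of_approximatesLinearOn (hfA.mono_set inter_subset_left) T
        fun v => (hTA v).ge).trans ?_
      gcongr
      exact inter_subset_right
    · refine (hf.mono (sdiff_subset.trans inter_subset_left)).hausdorffMeasure_image_le_ofReal.trans ?_
      gcongr
      exact (measure_mono (sdiff_subset_sdiff_left inter_subset_right)).trans hD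
  have hlower := det_mul_measure_closedBall_le (x := x) (r := r) (hfA.mono_set inter_subset_left)
    ⟨hxS, mem_closedBall_self hr0.le⟩ inter_subset_right
    (hg.mono (inter_subset_left.trans hSE)) (fun y hy => hgf y (hSE hy.1)) T π hπ hπA
  set Z := ENNReal.ofReal (J * Q) * μH[n] (B \ (S ∩ B ∩ closedBall x ((1 - τ) * r)))
  have hZ : Z ≠ ∞ := ENNReal.mul_ne_top ENNReal.ofReal_ne_top
    (ne_top_of_le_ne_top hBfin (measure_mono sdiff_subset))
  have hsum : ENNReal.ofReal η * μH[n] (f '' (E ∩ B)) + Z ≤ ENNReal.ofReal J * μH[n] B :=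
    calc ENNReal.ofReal η * μH[n] (f '' (E ∩ B)) + Z
      _ ≤ ENNReal.ofReal η * (ENNReal.ofReal ((1 + c * N) ^ n * J + (K : ℝ) ^ n * c) * μH[n] B) +
          ENNReal.ofReal (J * Q) * (ENNReal.ofReal (c + (1 - (1 - τ) ^ n)) * μH[n] B) := by
        simp only [Z]
        gcongr
      _ = ENNReal.ofReal (η * ((1 + c * N) ^ n * J + (K : ℝ) ^ n * c) +
          J * Q * (c + (1 - (1 - τ) ^ n))) * μH[n] B := by
        rw [ENNReal.ofReal_add (p := η * ((1 + c * N) ^ n * J + (K : ℝ) ^ n * c))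
          (q := J * Q * (c + (1 - (1 - τ) ^ n))) (by positivity)
          (mul_nonneg (by positivity) (by linarith)), ENNReal.ofReal_mul hη₀.le,
          ENNReal.ofReal_mul (by positivity : 0 ≤ J * Q), add_mul, mul_assoc, mul_assoc]
      _ ≤ _ := by gcongr
  have hle := (ENNReal.add_le_add_iff_right hZ).1 (hsum.trans hlower)
  refine hle.trans (measure_mono (image_mono ?_))
  exact inter_subset_inter_left _ hSE

/-- The radii at which the measure of the image of the ball of centre `x` is stable, up to the
factor `η`, under uniformly small `L`-Lipschitz perturbations of `f`. -/
def stableRadii {n m : ℕ} (f : Euc n → Euc m) (E : Set (Euc n)) (L : ℝ≥0) (η : ℝ) (x : Euc n) :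
    Set ℝ :=
  {r | ∃ δ > (0 : ℝ), ∀ g : Euc n → Euc m, LipschitzOnWith L g E → (∀ y ∈ E, ‖g y - f y‖ ≤ δ) →
    ENNReal.ofReal η * μH[n] (f '' (E ∩ closedBall x r)) ≤ μH[n] (g '' (E ∩ closedBall x r))}

lemma exists_pos_forall_hausdorffMeasure_image_diff_le {n m : ℕ} {f : Euc n → Euc m}
    {E : Set (Euc n)} {K : ℝ≥0} (hf : LipschitzOnWith K f E) (L : ℝ≥0) {η ε : ℝ} (hη₀ : 0 < η)
    (hη₁ : η < 1) (hε : 0 < ε) (A : Euc n →L[ℝ] Euc m) :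
    ∃ c : ℝ≥0, c ≠ 0 ∧ ∀ S ⊆ E, MeasurableSet S → ApproximatesLinearOn f A S c →
      μH[n] (f '' (S \ {x | ∀ᶠ r in 𝓝[>] (0 : ℝ), r ∈ stableRadii f E L η x})) ≤
        ENNReal.ofReal ε * μH[n] S := by
  by_cases hA : Function.Injective A
  · obtain ⟨c, hc, h⟩ := exists_pos_forall_eventually_le_of_injective hA K L hη₀ hη₁
    refine ⟨c, hc, fun S hSE hS hfA => le_of_eq_of_le ?_ zero_le⟩
    have hnull : μH[n] (S \ {x | ∀ᶠ r in 𝓝[>] (0 : ℝ), r ∈ stableRadii f E L η x}) = 0 := by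
      have hdens := (ae_restrict_iff' hS).1 (Besicovitch.ae_tendsto_measure_inter_div μH[n] S)
      refine measure_mono_null ?_ (ae_iff.1 hdens)
      rintro x ⟨hxS, hx⟩ hx'
      refine hx ?_
      filter_upwards [h f E S hSE hS hf hfA x hxS (hx' hxS), self_mem_nhdsWithin] with r hr hr0
      exact ⟨c * r, mul_pos (NNReal.coe_pos.2 (pos_iff_ne_zero.2 hc)) hr0, hr⟩
    refine le_antisymm ?_ zero_le
    refine (hf.mono (sdiff_subset.trans hSE)).hausdorffMeasure_image_le_ofReal.trans_eq ?_
    rw [hnull, mul_zero]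
  · obtain ⟨c, hc, h⟩ := exists_pos_forall_hausdorffMeasure_image_le_of_not_injective hA hε
    exact ⟨c, hc, fun S _ _ hfA => (measure_mono (image_mono sdiff_subset)).trans (h f S hfA)⟩

lemma hausdorffMeasure_image_diff_stableRadii {n m : ℕ} {f : Euc n → Euc m} {E : Set (Euc n)}
    (hE : IsCompact E) {K : ℝ≥0} (hf : LipschitzOnWith K f E) (L : ℝ≥0) {η : ℝ} (hη₀ : 0 < η)
    (hη₁ : η < 1) :
    μH[n] (f '' (E \ {x | ∀ᶠ r in 𝓝[>] (0 : ℝ), r ∈ stableRadii f E L η x})) = 0 := by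
  set G := {x | ∀ᶠ r in 𝓝[>] (0 : ℝ), r ∈ stableRadii f E L η x}
  have hEfin : μH[n] E ≠ ∞ := hE.measure_lt_top.ne
  suffices H : ∀ ε : ℝ, 0 < ε → μH[n] (f '' (E \ G)) ≤ ENNReal.ofReal ε * μH[n] E by
    have hlim : Tendsto (fun ε : ℝ => ENNReal.ofReal ε * μH[n] E) (𝓝[>] 0) (𝓝 0) := by
      have h := (ENNReal.tendsto_ofReal (tendsto_id (α := ℝ) (x := 𝓝 0))).mono_left
        (nhdsWithin_le_nhds (s := Ioi 0))
      simpa using ENNReal.Tendsto.mul_const h (Or.inr hEfin)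
    exact le_antisymm (ge_of_tendsto hlim (eventually_mem_nhdsWithin.mono H)) zero_le
  intro ε hε
  choose c hc hcA using
    exists_pos_forall_hausdorffMeasure_image_diff_le hf L hη₀ hη₁ hε
  set D := toMeasurable μH[n] {x ∈ E | ¬ DifferentiableWithinAt ℝ f E x}
  have hD : μH[n] D = 0 := by
    rw [measure_toMeasurable]
    have := hf.ae_differentiableWithinAt_of_mem (μ := μH[n])
    simpa [ae_iff] using this
  have hs : ∀ x ∈ E \ D, HasFDerivWithinAt f (fderivWithin ℝ f E x) (E \ D) x := by
    rintro x ⟨hxE, hxD⟩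
    have hx : DifferentiableWithinAt ℝ f E x := by
      by_contra hx
      exact hxD (subset_toMeasurable _ _ ⟨hxE, hx⟩)
    exact hx.hasFDerivWithinAt.mono sdiff_subset
  have hsm : MeasurableSet (E \ D) := hE.measurableSet.diff (measurableSet_toMeasurable _ _)
  obtain ⟨t, A, htd, htm, hst, htA, -⟩ :=
    exists_partition_approximatesLinearOn_of_hasFDerivWithinAt f (E \ D) _ hs c hc
  have hsub : f '' (E \ G) ⊆ f '' (E ∩ D) ∪ ⋃ i, f '' (((E \ D) ∩ t i) \ G) := by
    rw [← image_iUnion, ← image_union]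
    refine image_mono ?_
    rintro x ⟨hxE, hxG⟩
    by_cases hxD : x ∈ D
    · exact Or.inl ⟨hxE, hxD⟩
    · obtain ⟨i, hi⟩ := mem_iUnion.1 (hst ⟨hxE, hxD⟩)
      exact Or.inr (mem_iUnion.2 ⟨i, ⟨⟨hxE, hxD⟩, hi⟩, hxG⟩)
  calc μH[n] (f '' (E \ G))
    _ ≤ μH[n] (f '' (E ∩ D)) + ∑' i, μH[n] (f '' (((E \ D) ∩ t i) \ G)) :=
      (measure_mono hsub).trans ((measure_union_le _ _).trans (by gcongr; exact measure_iUnion_le _))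
    _ ≤ 0 + ∑' i, ENNReal.ofReal ε * μH[n] ((E \ D) ∩ t i) := by
      gcongr with i
      · refine (hf.mono inter_subset_left).hausdorffMeasure_image_le_ofReal.trans_eq ?_
        rw [measure_mono_null inter_subset_right hD, mul_zero]
      · exact hcA _ _ (inter_subset_left.trans sdiff_subset) (hsm.inter (htm i)) (htA i)
    _ = ENNReal.ofReal ε * μH[n] (⋃ i, (E \ D) ∩ t i) := by
      rw [zero_add, ENNReal.tsum_mul_left, measure_iUnion
        (fun i j hij => (htd hij).mono inter_subset_right inter_subset_right)
        fun i => hsm.inter (htm i)]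
    _ ≤ ENNReal.ofReal ε * μH[n] E := by
      gcongr
      exact iUnion_subset fun i => inter_subset_left.trans sdiff_subset

/-- The Hausdorff measure of images under an injective continuous map of a compact set, viewed as a
measure on the domain. -/
lemma exists_measure_eq_hausdorffMeasure_image {n m : ℕ} {f : Euc n → Euc m} {E : Set (Euc n)}
    (hE : IsCompact E) (hf : ContinuousOn f E) (hinj : InjOn f E) :
    ∃ ν : Measure (Euc n), ∀ S, ν S = μH[n] (f '' (E ∩ S)) := by
  have hemb : MeasurableEmbedding (E.domRestrict f) := by
    have := isCompact_iff_compactSpace.1 hE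
    exact (Continuous.isClosedEmbedding hf.domRestrict hinj.injective).measurableEmbedding
  refine ⟨(μH[n].comap (E.domRestrict f)).map Subtype.val, fun S => ?_⟩
  rw [(MeasurableEmbedding.subtype_coe hE.measurableSet).map_apply, hemb.comap_apply,
    image_domRestrict, inter_comm]

lemma eventually_disjoint_image_of_norm_sub_le {n m : ℕ} {f : Euc n → Euc m} {E U V : Set (Euc n)}
    (hf : ContinuousOn f E) (hinj : InjOn f E) (hU : IsCompact U) (hV : IsCompact V) (hUE : U ⊆ E)
    (hVE : V ⊆ E) (hUV : Disjoint U V) :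
    ∀ᶠ δ in 𝓝[>] (0 : ℝ), ∀ g : Euc n → Euc m, (∀ x ∈ E, ‖g x - f x‖ ≤ δ) →
      Disjoint (g '' U) (g '' V) := by
  have hdisj : Disjoint (f '' U) (f '' V) := by
    rw [disjoint_iff_inter_eq_empty, ← hinj.image_inter hUE hVE, hUV.inter_eq, image_empty]
  obtain ⟨δ₀, hδ₀, h⟩ := hdisj.exists_cthickenings (hU.image_of_continuousOn (hf.mono hUE))
    (hV.image_of_continuousOn (hf.mono hVE)).isClosed
  have hsub : ∀ W ⊆ E, ∀ δ ≤ δ₀, ∀ g : Euc n → Euc m, (∀ x ∈ E, ‖g x - f x‖ ≤ δ) →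
      g '' W ⊆ cthickening δ₀ (f '' W) := by
    rintro W hW δ hδ g hg _ ⟨x, hx, rfl⟩
    refine mem_cthickening_of_dist_le _ (f x) _ _ (mem_image_of_mem f hx) ?_
    rw [dist_eq_norm]
    exact (hg x (hW hx)).trans hδ
  filter_upwards [Ioc_mem_nhdsGT hδ₀] with δ hδ g hg
  exact h.mono (hsub U hUE δ hδ.2 g hg) (hsub V hVE δ hδ.2 g hg)

/-- Let `E ⊆ ℝ^n` be compact, `f : E → ℝ^m` an injective Lipschitz map and
`L ≥ 0`. For every `η ∈ (0,1)` there is `δ > 0` such that every `L`-Lipschitz `g : E → ℝ^m`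
with `sup_E ‖g − f‖ ≤ δ` satisfies `H^n(g(E)) ≥ η H^n(f(E))`. -/
theorem stmt8 (n m : ℕ) (hnm : n ≤ m)
    (E : Set (Euc n)) (hE : IsCompact E)
    (f : Euc n → Euc m) (K : NNReal) (hf : LipschitzOnWith K f E) (hinj : InjOn f E)
    (L : NNReal) (η : ℝ) (hη₁ : 0 < η) (hη₂ : η < 1) :
    ∃ δ > (0 : ℝ), ∀ g : Euc n → Euc m, LipschitzOnWith L g E →
      (∀ x ∈ E, ‖g x - f x‖ ≤ δ) →
      ENNReal.ofReal η * μH[n] (f '' E) ≤ μH[n] (g '' E) := by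
  obtain ⟨ν, hν⟩ := exists_measure_eq_hausdorffMeasure_image hE hf.continuousOn hinj
  have hνuniv : ν univ = μH[n] (f '' E) := by rw [hν, inter_univ]
  have hνfin : ν univ ≠ ∞ := by
    rw [hνuniv]
    exact ne_top_of_le_ne_top (ENNReal.mul_ne_top ENNReal.ofReal_ne_top hE.measure_lt_top.ne)
      hf.hausdorffMeasure_image_le_ofReal
  have : IsFiniteMeasure ν := ⟨hνfin.lt_top⟩
  rw [← hνuniv]
  rcases eq_or_ne (ν univ) 0 with h0 | h0
  · exact ⟨1, one_pos, fun g _ _ => by simp [h0]⟩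
  obtain ⟨η', hη, hη'⟩ := exists_between hη₂
  have hη'0 : 0 < η' := hη₁.trans hη
  set G := {x | ∀ᶠ r in 𝓝[>] (0 : ℝ), r ∈ stableRadii f E L η' x}
  have hG : ν Gᶜ = 0 := by
    rw [hν, ← sdiff_eq]
    exact hausdorffMeasure_image_diff_stableRadii hE hf L hη'0 hη'
  obtain ⟨t, r, htc, htG, hr, hcov, hdisj⟩ := Besicovitch.exists_disjoint_closedBall_covering_ae ν
    (stableRadii f E L η') G
    (fun x (hx : ∀ᶠ r in 𝓝[>] 0, _) ρ hρ => (hx.and (Ioo_mem_nhdsGT hρ)).exists)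
    (fun _ => 1) (fun _ _ => one_pos)
  set B : Euc n → Set (Euc n) := fun x => closedBall x (r x)
  have hsum : ν univ = ∑' x : t, ν (B x) := by
    rw [← measure_biUnion htc hdisj fun x _ => measurableSet_closedBall]
    refine le_antisymm ?_ (measure_mono (subset_univ _))
    calc ν univ
      _ ≤ ν ((⋃ x ∈ t, B x) ∪ (Gᶜ ∪ (G \ ⋃ x ∈ t, B x))) := by
        refine measure_mono fun x _ => ?_
        by_cases hx : x ∈ ⋃ x ∈ t, B x
        · exact Or.inl hx
        · by_cases hxG : x ∈ G
          · exact Or.inr (Or.inr ⟨hxG, hx⟩)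
          · exact Or.inr (Or.inl hxG)
      _ ≤ ν (⋃ x ∈ t, B x) + (ν Gᶜ + ν (G \ ⋃ x ∈ t, B x)) :=
        (measure_union_le _ _).trans (by gcongr; exact measure_union_le _ _)
      _ = _ := by rw [hG, hcov, add_zero, add_zero]
  have hlt : ENNReal.ofReal (η / η') * ν univ < ∑' x : t, ν (B x) := by
    rw [← hsum]
    nth_rw 2 [← one_mul (ν univ)]
    refine ENNReal.mul_lt_mul_left h0 hνfin ?_
    rw [← ENNReal.ofReal_one]
    exact (ENNReal.ofReal_lt_ofReal_iff one_pos).2 ((div_lt_one hη'0).2 hη)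
  rw [ENNReal.tsum_eq_iSup_sum] at hlt
  obtain ⟨F, hF⟩ := lt_iSup_iff.1 hlt
  have hcpt : ∀ x, IsCompact (E ∩ B x) := fun x => hE.inter_right isClosed_closedBall
  have hstable : ∀ᶠ δ in 𝓝[>] (0 : ℝ), ∀ x ∈ F, ∀ g : Euc n → Euc m, LipschitzOnWith L g E →
      (∀ y ∈ E, ‖g y - f y‖ ≤ δ) →
      ENNReal.ofReal η' * ν (B x) ≤ μH[n] (g '' (E ∩ B x)) := by
    refine (Filter.eventually_all_finset F).2 fun x _ => ?_
    obtain ⟨δ₀, hδ₀, h⟩ := (hr x x.2).1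
    filter_upwards [Ioc_mem_nhdsGT hδ₀] with δ hδ g hg hgf
    rw [hν]
    exact h g hg fun y hy => (hgf y hy).trans hδ.2
  have hpair : ∀ᶠ δ in 𝓝[>] (0 : ℝ), ∀ x ∈ F, ∀ y ∈ F, x ≠ y → ∀ g : Euc n → Euc m,
      (∀ z ∈ E, ‖g z - f z‖ ≤ δ) → Disjoint (g '' (E ∩ B x)) (g '' (E ∩ B y)) := by
    refine (Filter.eventually_all_finset F).2 fun x _ =>
      (Filter.eventually_all_finset F).2 fun y _ => ?_
    by_cases hxy : x = y
    · simp [hxy]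
    filter_upwards [eventually_disjoint_image_of_norm_sub_le hf.continuousOn hinj (hcpt x) (hcpt y)
      inter_subset_left inter_subset_left ((hdisj x.2 y.2 (Subtype.coe_ne_coe.2 hxy)).mono
        inter_subset_right inter_subset_right)] with δ hδ _ using hδ
  obtain ⟨δ, ⟨hδ₁, hδ₂⟩, hδ⟩ := ((hstable.and hpair).and self_mem_nhdsWithin).exists
  refine ⟨δ, hδ, fun g hg hgf => ?_⟩
  calc ENNReal.ofReal η * ν univ
    _ = ENNReal.ofReal η' * (ENNReal.ofReal (η / η') * ν univ) := by
      rw [← mul_assoc, ← ENNReal.ofReal_mul hη'0.le, mul_div_cancel₀ _ hη'0.ne']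
    _ ≤ ENNReal.ofReal η' * ∑ x ∈ F, ν (B x) := by gcongr
    _ ≤ ∑ x ∈ F, μH[n] (g '' (E ∩ B x)) := by
      rw [Finset.mul_sum]
      exact Finset.sum_le_sum fun x hx => hδ₁ x hx g hg hgf
    _ = μH[n] (⋃ x ∈ F, g '' (E ∩ B x)) :=
      (measure_biUnion_finset (fun x hx y hy hxy => hδ₂ x hx y hy hxy g hgf) fun x _ =>
        ((hcpt x).image_of_continuousOn
          (hg.continuousOn.mono inter_subset_left)).measurableSet).symm
    _ ≤ μH[n] (g '' E) :=
      measure_mono (iUnion₂_subset fun x _ => image_mono inter_subset_left)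
end
end

section
/- Let n ≤ m be natural numbers and let K be a compact metric space such that there exist a set F ⊂ ℝ^n and a biLipschitz bijection I : F → K. Let f : K → ℝ^m be a biLipschitz map (a Lipschitz injection whose inverse on f(K) is Lipschitz), and let L ≥ 0. Then for every η ∈ (0,1) there exists δ > 0 such that every L-Lipschitz map g : K → ℝ^m with sup_{x ∈ K} |g(x) − f(x)| ≤ δ satisfies H^n(g(K)) ≥ η · H^n(f(K)). -/
open MeasureTheory Metric Set Filter Topology ENNReal

noncomputable section

instance isAddHaarMeasure_hausdorffMeasure_euc (n : ℕ) :
    (μH[(n : ℝ)] : Measure (Euc n)).IsAddHaarMeasure := by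
  simpa using MeasureTheory.isAddHaarMeasure_hausdorffMeasure (E := EuclideanSpace ℝ (Fin n))

/-- The value at `1` of a polynomial of bounded degree is a fixed linear combination of its values
at finitely many points close to `0`. -/
theorem exists_nodes_weights (n : ℕ) {τ : ℝ} (hτ : 0 < τ) :
    ∃ t w : ℕ → ℝ, (∀ j ∈ Finset.range (n + 1), 0 < t j ∧ t j < τ) ∧
      ∀ p : Polynomial ℝ, p.natDegree ≤ n →
        p.eval 1 = ∑ j ∈ Finset.range (n + 1), w j * p.eval (t j) := by
  set t : ℕ → ℝ := fun j => τ / (j + 2) with ht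
  refine ⟨t, fun j => (Lagrange.basis (Finset.range (n + 1)) t j).eval 1, ?_, ?_⟩
  · intro j _
    have : (0 : ℝ) ≤ j := j.cast_nonneg
    refine ⟨by positivity, ?_⟩
    rw [ht]
    exact div_lt_self hτ (by linarith)
  · intro p hp
    have hinj : InjOn t (Finset.range (n + 1) : Set ℕ) := by
      intro i _ j _ hij
      have hi : (0 : ℝ) < (i : ℝ) + 2 := by positivity
      have hj : (0 : ℝ) < (j : ℝ) + 2 := by positivity
      simp only [ht] at hij
      rw [div_eq_div_iff hi.ne' hj.ne'] at hij
      have := mul_left_cancel₀ hτ.ne' hij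
      exact_mod_cast (add_right_cancel this).symm
    have hdeg : p.degree < ((Finset.range (n + 1)).card : WithBot ℕ) := by
      rw [Finset.card_range]
      exact lt_of_le_of_lt Polynomial.degree_le_natDegree (by exact_mod_cast Nat.lt_succ_of_le hp)
    conv_lhs => rw [Lagrange.eq_interpolate hinj hdeg, Lagrange.interpolate_apply]
    rw [Polynomial.eval_finsetSum]
    refine Finset.sum_congr rfl fun j _ => ?_
    simp [mul_comm]

theorem exists_polynomial_eval_eq_det_one_add_smul {n : ℕ} (A : Euc n →L[ℝ] Euc n) :
    ∃ p : Polynomial ℝ, p.natDegree ≤ n ∧ ∀ t : ℝ, p.eval t = (1 + t • A).det := by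
  let b := (EuclideanSpace.basisFun (Fin n) ℝ).toBasis
  let M := LinearMap.toMatrix b b (A : Euc n →ₗ[ℝ] Euc n)
  refine ⟨(Polynomial.X • M.map Polynomial.C + (1 : Matrix (Fin n) (Fin n) ℝ).map Polynomial.C).det,
    by simpa using Polynomial.natDegree_det_X_add_C_le M 1, fun t => ?_⟩
  have h1 : (1 + t • A).det = (1 + t • M).det := by
    rw [ContinuousLinearMap.det, ← LinearMap.det_toMatrix b]
    congr 1
    rw [show ((1 + t • A : Euc n →L[ℝ] Euc n) : Euc n →ₗ[ℝ] Euc n)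
      = LinearMap.id + t • (A : Euc n →ₗ[ℝ] Euc n) from rfl]
    rw [map_add, map_smul, LinearMap.toMatrix_id]
  rw [h1, ← Polynomial.coe_evalRingHom, RingHom.map_det]
  congr 1
  ext i j
  simp [Matrix.one_apply, apply_ite, add_comm]
  exact mul_comm _ _

theorem bijective_add_of_lipschitz {E : Type*} [NormedAddCommGroup E] [CompleteSpace E] {h : E → E}
    {K : NNReal} (hK : K < 1) (hh : LipschitzWith K h) :
    Function.Bijective fun x => x + h x := by
  constructor
  · intro x y hxy
    have h1 : ‖x - y‖ ≤ K * ‖x - y‖ := by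
      have := hh.norm_sub_le y x
      have h2 : h y - h x = x - y := by
        simp only at hxy
        rw [sub_eq_sub_iff_add_eq_add, add_comm, ← hxy, add_comm]
      rwa [h2, norm_sub_rev y x] at this
    have h3 : (K : ℝ) < 1 := by exact_mod_cast hK
    have h4 : ‖x - y‖ = 0 := by nlinarith [norm_nonneg (x - y)]
    exact sub_eq_zero.1 (norm_eq_zero.1 h4)
  · intro y
    have hc : ContractingWith K fun x => y - h x := by
      refine ⟨hK, lipschitzWith_iff_norm_sub_le.2 fun a b => ?_⟩
      have := hh.norm_sub_le b a
      rwa [norm_sub_rev b a, show h b - h a = (y - h a) - (y - h b) by abel] at this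
    have : Nonempty E := ⟨0⟩
    refine ⟨hc.fixedPoint _, ?_⟩
    have h1 : y - h (hc.fixedPoint _) = hc.fixedPoint _ := hc.fixedPoint_isFixedPt
    exact (sub_eq_iff_eq_add.1 h1).symm

theorem setIntegral_det_one_add_smul_fderiv {n : ℕ} {h : Euc n → Euc n} {K : NNReal}
    (hh : LipschitzWith K h) {c : Euc n} {R : ℝ} (h0 : ∀ x ∉ closedBall c R, h x = 0) {t : NNReal}
    (htK : t * K < 1) (hpos : ∀ x, 0 < (1 + (t : ℝ) • fderiv ℝ h x).det) :
    ∫ x in closedBall c R, (1 + (t : ℝ) • fderiv ℝ h x).det ∂μH[(n : ℝ)] =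
      (μH[(n : ℝ)] : Measure (Euc n)).real (closedBall c R) := by
  set μ : Measure (Euc n) := μH[(n : ℝ)]
  set B := closedBall c R
  set ψ : Euc n → Euc n := fun x => x + (t : ℝ) • h x with hψ
  have hth : LipschitzWith (t * K) fun x => (t : ℝ) • h x := by
    refine lipschitzWith_iff_norm_sub_le.2 fun x y => ?_
    rw [← smul_sub, norm_smul, NNReal.coe_mul, mul_assoc]
    simpa using mul_le_mul_of_nonneg_left (hh.norm_sub_le x y) t.2
  have hbij : Function.Bijective ψ := bijective_add_of_lipschitz htK hth
  have hψL : LipschitzWith (1 + t * K) ψ := LipschitzWith.id.add hth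
  have hout : ∀ x ∉ B, ψ x = x := fun x hx => by simp [hψ, h0 x hx]
  have himg : ψ '' B = B := by
    ext y
    constructor
    · rintro ⟨x, hx, rfl⟩
      by_contra hy
      exact hy (by rwa [hbij.1 (hout _ hy)])
    · intro hy
      obtain ⟨x, rfl⟩ := hbij.2 y
      by_contra hx
      have : x ∉ B := fun hxB => hx ⟨x, hxB, rfl⟩
      rw [hout x this] at hy
      exact this hy
  set D := {x | DifferentiableAt ℝ h x}
  have hD : MeasurableSet D := measurableSet_of_differentiableAt ℝ h
  have hDc : μ Dᶜ = 0 := (hh.ae_differentiableAt (μ := μ) :)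
  have hs : MeasurableSet (B ∩ D) := isClosed_closedBall.measurableSet.inter hD
  have hae : (B ∩ D : Set (Euc n)) =ᵐ[μ] B := by
    refine (inter_ae_eq_left_of_ae_eq_univ ?_)
    exact ae_eq_univ.2 hDc
  have hnull : μ (ψ '' Dᶜ) = 0 := by
    refine le_antisymm ((hψL.hausdorffMeasure_image_le n.cast_nonneg _).trans ?_) zero_le
    rw [show μH[(n : ℝ)] Dᶜ = 0 from hDc, mul_zero]
  have hμ : μ (ψ '' (B ∩ D)) = μ B := by
    apply le_antisymm
    · exact measure_mono ((image_mono inter_subset_left).trans himg.le)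
    · calc μ B ≤ μ (ψ '' (B ∩ D) ∪ ψ '' Dᶜ) := by
            refine measure_mono ?_
            rw [← image_union]
            nth_rw 1 [← himg]
            refine image_mono fun x hx => ?_
            by_cases hxD : x ∈ D
            · exact Or.inl ⟨hx, hxD⟩
            · exact Or.inr hxD
        _ ≤ _ := measure_union_le _ _
        _ = _ := by rw [hnull, add_zero]
  have key := integral_image_eq_integral_abs_det_fderiv_smul μ hs
    (f := ψ) (f' := fun x => 1 + (t : ℝ) • fderiv ℝ h x)
    (fun x hx => ((hasFDerivAt_id x).add
      ((hx.2 : DifferentiableAt ℝ h x).hasFDerivAt.const_smul (t : ℝ))).hasFDerivWithinAt)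
    hbij.1.injOn (fun _ => (1 : ℝ))
  rw [setIntegral_congr_set hae] at key
  simp only [smul_eq_mul, mul_one, abs_of_pos (hpos _)] at key
  rw [← key]
  simp [Measure.real, hμ]

theorem setIntegral_det_one_add_fderiv {n : ℕ} {h : Euc n → Euc n} {K : NNReal}
    (hh : LipschitzWith K h) {c : Euc n} {R : ℝ} (h0 : ∀ x ∉ closedBall c R, h x = 0) :
    ∫ x in closedBall c R, (1 + fderiv ℝ h x).det ∂μH[(n : ℝ)] =
      (μH[(n : ℝ)] : Measure (Euc n)).real (closedBall c R) := by
  set μ : Measure (Euc n) := μH[(n : ℝ)]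
  have hev : ∀ᶠ M : Euc n →L[ℝ] Euc n in 𝓝 1, 0 < M.det := by
    refine ContinuousLinearMap.continuous_det.continuousAt.eventually_const_lt ?_
    simp [ContinuousLinearMap.det]
  obtain ⟨ε, hε, hball⟩ := Metric.eventually_nhds_iff.1 hev
  set τ : ℝ := min 1 ε / (K + 1) with hτdef
  have hK1 : (0 : ℝ) < K + 1 := by positivity
  have hτ : 0 < τ := div_pos (lt_min one_pos hε) hK1
  obtain ⟨t, w, ht, hp⟩ := exists_nodes_weights n hτ
  have hsmall : ∀ s : ℝ, 0 < s → s < τ → s * K < min 1 ε := fun s hs hsτ => by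
    rw [hτdef, lt_div_iff₀ hK1] at hsτ
    nlinarith
  have hnode : ∀ j ∈ Finset.range (n + 1),
      ∫ x in closedBall c R, (1 + t j • fderiv ℝ h x).det ∂μ = μ.real (closedBall c R) := by
    intro j hj
    obtain ⟨h1, h2⟩ := ht j hj
    have h3 := hsmall _ h1 h2
    refine setIntegral_det_one_add_smul_fderiv (t := ⟨t j, h1.le⟩) hh h0 ?_ fun x => ?_
    · rw [← NNReal.coe_lt_coe]
      exact h3.trans_le (min_le_left _ _)
    · apply hball
      rw [dist_eq_norm, add_sub_cancel_left, norm_smul]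
      refine lt_of_le_of_lt ?_ (h3.trans_le (min_le_right _ _))
      rw [Real.norm_eq_abs]
      change |t j| * _ ≤ _
      rw [abs_of_pos h1]
      exact mul_le_mul_of_nonneg_left (norm_fderiv_le_of_lipschitz ℝ hh) h1.le
  have hpt : ∀ x, (1 + fderiv ℝ h x).det =
      ∑ j ∈ Finset.range (n + 1), w j * (1 + t j • fderiv ℝ h x).det := fun x => by
    obtain ⟨p, hpn, hpe⟩ := exists_polynomial_eval_eq_det_one_add_smul (fderiv ℝ h x)
    simpa [hpe] using hp p hpn
  have hint : ∀ j, IntegrableOn (fun x => (1 + t j • fderiv ℝ h x).det) (closedBall c R) μ := by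
    intro j
    have hmeas : Measurable fun x => (1 + t j • fderiv ℝ h x).det :=
      ContinuousLinearMap.continuous_det.measurable.comp
        (((measurable_fderiv ℝ h).const_smul (t j)).const_add 1)
    have hcpt : IsCompact (closedBall (0 : Euc n →L[ℝ] Euc n) K) := isCompact_closedBall _ _
    obtain ⟨C, hC⟩ := hcpt.exists_bound_of_continuousOn
      (f := fun A : Euc n →L[ℝ] Euc n => (1 + t j • A).det)
      (ContinuousLinearMap.continuous_det.comp (by fun_prop)).continuousOn
    refine Measure.integrableOn_of_bounded (M := C) measure_closedBall_lt_top.ne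
      hmeas.aestronglyMeasurable (ae_of_all _ fun x => hC _ ?_)
    simpa using norm_fderiv_le_of_lipschitz ℝ hh
  simp_rw [hpt]
  rw [integral_finsetSum _ fun j _ => (hint j).const_mul _]
  simp_rw [integral_const_mul]
  rw [Finset.sum_congr rfl fun j hj => by rw [hnode j hj], ← Finset.sum_mul]
  have := hp 1 (by simp)
  simp only [Polynomial.eval_one, mul_one] at this
  rw [← this, one_mul]

theorem lipschitzWith_radialProjection {E : Type*} [NormedAddCommGroup E] [NormedSpace ℝ E] {r : ℝ}
    (hr : 0 < r) : LipschitzWith 2 fun z : E => (r / max r ‖z‖) • z := by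
  refine lipschitzWith_iff_norm_sub_le.2 fun x y => ?_
  set a := max r ‖x‖
  set b := max r ‖y‖
  have hra : r ≤ a := le_max_left _ _
  have hyb : ‖y‖ ≤ b := le_max_right _ _
  have ha : 0 < a := hr.trans_le hra
  have hb : 0 < b := hr.trans_le (le_max_left _ _)
  have hab : |b - a| ≤ ‖x - y‖ := by
    rw [abs_sub_comm]
    refine (abs_max_sub_max_le_max r ‖x‖ r ‖y‖).trans ?_
    simpa using abs_norm_sub_norm_le x y
  have h1 : (r / a) • x - (r / b) • y = (r / a) • (x - y) + (r / a * ((b - a) / b)) • y := by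
    rw [smul_sub, sub_add, ← sub_smul]
    congr 2
    field_simp
    ring
  have hra1 : r / a ≤ 1 := (div_le_one ha).2 hra
  have h2 : ‖(r / a * ((b - a) / b)) • y‖ ≤ ‖x - y‖ := by
    rw [norm_smul, Real.norm_eq_abs, abs_mul, abs_div (b - a), abs_of_pos (div_pos hr ha),
      abs_of_pos hb]
    calc r / a * (|b - a| / b) * ‖y‖ = r / a * |b - a| * (‖y‖ / b) := by ring
      _ ≤ 1 * ‖x - y‖ * 1 := by
        gcongr
        exact (div_le_one hb).2 hyb
      _ = ‖x - y‖ := by ring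
  have h3 : ‖(r / a) • (x - y)‖ ≤ ‖x - y‖ := by
    rw [norm_smul, Real.norm_eq_abs, abs_of_pos (div_pos hr ha)]
    exact mul_le_of_le_one_left (norm_nonneg _) hra1
  rw [h1]
  refine (norm_add_le _ _).trans ?_
  simp only [NNReal.coe_ofNat]
  linarith

/-- A Lipschitz map that is the identity outside a large ball, and that pushes the part of this
ball which is outside of a smaller ball to its boundary. -/
theorem exists_lipschitzWith_push_to_sphere {E : Type*} [NormedAddCommGroup E] [NormedSpace ℝ E]
    {s R : ℝ} (hs : 0 < s) (hsR : s ≤ R) :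
    ∃ (ρ : E → E) (C : NNReal), LipschitzWith C ρ ∧ (∀ z, R ≤ ‖z‖ → ρ z = z) ∧
      ∀ z, s ≤ ‖z‖ → ‖z‖ ≤ R → ‖ρ z‖ = R := by
  have hR := hs.trans_le hsR
  refine ⟨fun z => z + (R / s) • ((s / max s ‖z‖) • z) - (R / max R ‖z‖) • z,
    1 + ‖R / s‖₊ * 2 + 2, ?_, ?_, ?_⟩
  · exact (LipschitzWith.id.add ((lipschitzWith_smul (R / s)).comp
      (lipschitzWith_radialProjection hs))).sub (lipschitzWith_radialProjection hR)
  · intro z hz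
    have : 0 < ‖z‖ := hR.trans_le hz
    simp only [max_eq_right hz, max_eq_right (hsR.trans hz), smul_smul]
    rw [div_mul_div_cancel₀ hs.ne', add_sub_cancel_right]
  · intro z hz hzR
    have : 0 < ‖z‖ := hs.trans_le hz
    simp only [max_eq_left hzR, max_eq_right hz, smul_smul]
    rw [div_mul_div_cancel₀ hs.ne', div_self hR.ne', one_smul, add_sub_cancel_left, norm_smul,
      Real.norm_eq_abs, abs_of_pos (div_pos hR this), div_mul_cancel₀ _ this.ne']

theorem det_fderiv_eq_zero_of_norm_eq {n : ℕ} {χ : Euc n → Euc n} {D : Euc n →L[ℝ] Euc n}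
    {x : Euc n} {R : ℝ} (hR : 0 < R) (hD : HasFDerivAt χ D x) (hχ : ∀ᶠ z in 𝓝 x, ‖χ z‖ = R) :
    D.det = 0 := by
  by_contra hdet
  have h1 := hD.norm_sq
  have h2 : HasFDerivAt (fun z => ‖χ z‖ ^ 2) (0 : Euc n →L[ℝ] ℝ) x := by
    refine (hasFDerivAt_const (R ^ 2) x).congr_of_eventuallyEq ?_
    filter_upwards [hχ] with z hz
    rw [hz]
  have h3 := h1.unique h2
  have hsurj : Function.Surjective D :=
    (LinearMap.equivOfDetNeZero (D : Euc n →ₗ[ℝ] Euc n) hdet).surjective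
  obtain ⟨v, hv⟩ := hsurj (χ x)
  have h4 := DFunLike.congr_fun h3 v
  simp [hv] at h4
  have h5 := hχ.self_of_nhds
  rw [h4] at h5
  simp at h5
  exact hR.ne h5

/-- A Lipschitz map of a Euclidean space that is the identity outside a ball is surjective. -/
theorem surjective_of_lipschitz_of_eq_id_off_ball {n : ℕ} {ψ : Euc n → Euc n} {K : NNReal}
    (hψ : LipschitzWith K ψ) {r : ℝ} (hout : ∀ x ∉ closedBall (0 : Euc n) r, ψ x = x) :
    Function.Surjective ψ := by
  intro y
  by_contra hy
  have hyr : y ∈ closedBall (0 : Euc n) r := by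
    by_contra h
    exact hy ⟨y, hout y h⟩
  have hcpt : IsCompact (ψ '' closedBall (0 : Euc n) (r + 1)) :=
    (isCompact_closedBall _ _).image hψ.continuous
  have hyimg : y ∈ (ψ '' closedBall (0 : Euc n) (r + 1))ᶜ := fun ⟨x, _, hx⟩ => hy ⟨x, hx⟩
  obtain ⟨s₀, hs₀, hball⟩ := Metric.isOpen_iff.1 hcpt.isClosed.isOpen_compl y hyimg
  obtain ⟨R₀, hR₀⟩ := hcpt.isBounded.subset_closedBall y
  set s := min s₀ 1
  have hs : 0 < s := lt_min hs₀ one_pos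
  have hr : 0 ≤ r := nonempty_closedBall.1 ⟨y, hyr⟩
  have hfar : ∀ x, s ≤ ‖ψ x - y‖ := by
    intro x
    by_cases hx : x ∈ closedBall (0 : Euc n) (r + 1)
    · by_contra! h
      refine hball (a := ψ x) ?_ ⟨x, hx, rfl⟩
      rw [mem_ball, dist_eq_norm]
      exact h.trans_le (min_le_left _ _)
    · have hx' : r + 1 < ‖x‖ := by simpa using hx
      rw [hout x (by simp; linarith)]
      have h1 : ‖y‖ ≤ r := by simpa using hyr
      have := norm_sub_norm_le x y
      exact (min_le_right _ _).trans (by linarith)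
  set R := max s (max R₀ (2 * r + 1))
  have hRr : 2 * r + 1 ≤ R := (le_max_right _ _).trans (le_max_right _ _)
  have hR : 0 < R := by linarith
  obtain ⟨ρ, C, hρ, hρid, hρR⟩ :=
    exists_lipschitzWith_push_to_sphere (E := Euc n) hs (le_max_left s (max R₀ (2 * r + 1)))
  have hin : ∀ x ∈ closedBall y R, ‖ψ x - y‖ ≤ R := by
    intro x hx
    by_cases hx' : x ∈ closedBall (0 : Euc n) (r + 1)
    · have := hR₀ ⟨x, hx', rfl⟩
      rw [mem_closedBall, dist_eq_norm] at this
      exact this.trans ((le_max_left _ _).trans (le_max_right _ _))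
    · have hx'' : r + 1 < ‖x‖ := by simpa using hx'
      rw [hout x (by simp; linarith)]
      rwa [mem_closedBall, dist_eq_norm] at hx
  set χ : Euc n → Euc n := fun x => ρ (ψ x - y) with hχ
  set h : Euc n → Euc n := fun x => χ x - (x - y) with hh
  have hhL : LipschitzWith (C * (K + 0) + (1 + 0)) h :=
    (hρ.comp (hψ.sub (LipschitzWith.const y))).sub (LipschitzWith.id.sub (LipschitzWith.const y))
  have hh0 : ∀ x ∉ closedBall y R, h x = 0 := by
    intro x hx
    have hx1 : R < ‖x - y‖ := by
      rw [mem_closedBall, dist_eq_norm, not_le] at hx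
      exact hx
    have hx2 : x ∉ closedBall (0 : Euc n) r := by
      intro hx2
      have h1 : ‖y‖ ≤ r := by simpa using hyr
      have h2 : ‖x‖ ≤ r := by simpa using hx2
      have := norm_sub_le x y
      linarith
    simp only [hh, hχ, hout x hx2]
    rw [hρid _ hx1.le, sub_self]
  have hint := setIntegral_det_one_add_fderiv hhL hh0
  have hzero : ∫ x in closedBall y R, (1 + fderiv ℝ h x).det ∂μH[(n : ℝ)] = 0 := by
    have hae : (ball y R : Set (Euc n)) =ᵐ[μH[(n : ℝ)]] closedBall y R := by
      refine ae_eq_of_subset_of_measure_ge ball_subset_closedBall ?_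
        measurableSet_ball.nullMeasurableSet measure_closedBall_lt_top.ne
      rw [Measure.addHaar_closedBall _ y hR.le, Measure.addHaar_ball_of_pos _ y hR]
    rw [← setIntegral_congr_set hae]
    refine setIntegral_eq_zero_of_ae_eq_zero ?_
    filter_upwards [hhL.ae_differentiableAt (μ := (μH[(n : ℝ)] : Measure (Euc n)))] with x hx hxB
    have hd : HasFDerivAt χ (1 + fderiv ℝ h x) x := by
      have := ((hasFDerivAt_id x).sub_const y).add hx.hasFDerivAt
      refine this.congr_of_eventuallyEq (Eventually.of_forall fun z => ?_)
      simp [hh]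
    refine det_fderiv_eq_zero_of_norm_eq hR hd ?_
    filter_upwards [isOpen_ball.mem_nhds hxB] with z hz
    exact hρR _ (hfar z) (hin z (ball_subset_closedBall hz))
  rw [hzero] at hint
  have hpos : 0 < (μH[(n : ℝ)] : Measure (Euc n)).real (closedBall y R) :=
    ENNReal.toReal_pos (measure_closedBall_pos _ y hR).ne' measure_closedBall_lt_top.ne
  exact hpos.ne hint

/-- Brouwer's theorem for Lipschitz maps: a small Lipschitz perturbation of the identity covers
every point. -/
theorem exists_add_eq_of_norm_le {n : ℕ} {h : Euc n → Euc n} {K : NNReal} (hh : LipschitzWith K h)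
    {δ : ℝ} (hδ : 0 < δ) (hle : ∀ x, ‖h x‖ ≤ δ) (y : Euc n) :
    ∃ x ∈ closedBall y δ, x + h x = y := by
  set θ : Euc n → ℝ := fun x => max 0 (min 1 (2 - δ⁻¹ * dist x y)) with hθ
  have hθL : LipschitzWith ⟨δ⁻¹, by positivity⟩ θ := by
    have h1 : LipschitzWith ⟨δ⁻¹, by positivity⟩ fun x : Euc n => 2 - δ⁻¹ * dist x y := by
      refine LipschitzWith.of_dist_le_mul fun a b => ?_
      rw [Real.dist_eq, show 2 - δ⁻¹ * dist a y - (2 - δ⁻¹ * dist b y)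
        = δ⁻¹ * (dist b y - dist a y) by ring, abs_mul, abs_of_pos (by positivity)]
      refine mul_le_mul_of_nonneg_left ?_ (by positivity)
      rw [dist_comm a b]
      exact abs_dist_sub_le b a y
    exact (h1.const_min 1).const_max 0
  have hθ0 : ∀ x, 0 ≤ θ x := fun x => le_max_left _ _
  have hθ1 : ∀ x, θ x ≤ 1 := fun x => max_le zero_le_one (min_le_left _ _)
  have hL : LipschitzWith (K + 1) fun x => θ x • h x := by
    refine lipschitzWith_iff_norm_sub_le.2 fun a b => ?_
    rw [show θ a • h a - θ b • h b = θ a • (h a - h b) + (θ a - θ b) • h b by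
      rw [smul_sub, sub_smul]; abel]
    refine (norm_add_le _ _).trans ?_
    rw [norm_smul, norm_smul, Real.norm_eq_abs, abs_of_nonneg (hθ0 a)]
    have h1 : θ a * ‖h a - h b‖ ≤ 1 * (K * ‖a - b‖) :=
      mul_le_mul (hθ1 a) (hh.norm_sub_le a b) (norm_nonneg _) zero_le_one
    have h2 : ‖θ a - θ b‖ * ‖h b‖ ≤ (δ⁻¹ * ‖a - b‖) * δ :=
      mul_le_mul (hθL.norm_sub_le a b) (hle b) (norm_nonneg _) (by positivity)
    have h3 : (δ⁻¹ * ‖a - b‖) * δ = ‖a - b‖ := by field_simp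
    rw [NNReal.coe_add, NNReal.coe_one]
    linarith
  obtain ⟨x, hx⟩ := surjective_of_lipschitz_of_eq_id_off_ball (r := ‖y‖ + 2 * δ)
    (LipschitzWith.id.add hL) (fun x hx => by
      have h1 : ‖y‖ + 2 * δ < ‖x‖ := by simpa using hx
      have h2 : ‖x‖ - ‖y‖ ≤ dist x y := by rw [dist_eq_norm]; exact norm_sub_norm_le x y
      have h3 : 2 ≤ δ⁻¹ * dist x y := by
        rw [inv_mul_eq_div, le_div_iff₀ hδ]
        linarith
      have h4 : θ x = 0 := max_eq_left ((min_le_right _ _).trans (by linarith))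
      simp [h4]) y
  simp only [id] at hx
  have hxy : dist x y ≤ δ := by
    rw [dist_comm, dist_eq_norm, ← hx, add_sub_cancel_left, norm_smul, Real.norm_eq_abs,
      abs_of_nonneg (hθ0 x)]
    exact (mul_le_of_le_one_left (norm_nonneg _) (hθ1 x)).trans (hle x)
  refine ⟨x, hxy, ?_⟩
  have h4 : θ x = 1 := by
    have : δ⁻¹ * dist x y ≤ 1 := by
      rw [inv_mul_eq_div, div_le_one hδ]
      exact hxy
    simp only [hθ]
    rw [min_eq_left (by linarith), max_eq_right zero_le_one]
  rwa [h4, one_smul] at hx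

theorem exists_delta_hausdorffMeasure_le_image {n : ℕ} {S : Set (Euc n)} (hS : IsCompact S)
    (M : NNReal) {η : ℝ≥0∞} (hη : η ≠ 0) :
    ∃ δ > (0 : ℝ), ∀ u : Euc n → Euc n, LipschitzOnWith M u S → (∀ x ∈ S, ‖u x - x‖ ≤ δ) →
      μH[(n : ℝ)] S ≤ μH[(n : ℝ)] (u '' S) + η := by
  set M' : NNReal := 1 + 2 * (lipschitzExtensionConstant (Euc n) * (M + 1))
  have hMt : (M' : ℝ≥0∞) ^ (n : ℝ) ≠ ∞ := by
    rw [ENNReal.rpow_natCast]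
    exact ENNReal.pow_ne_top ENNReal.coe_ne_top
  set η' : ℝ≥0∞ := η / (M' : ℝ≥0∞) ^ (n : ℝ)
  have hη' : η' ≠ 0 := ENNReal.div_ne_zero.2 ⟨hη, hMt⟩
  obtain ⟨U, hSU, hU, hUμ⟩ := hS.exists_isOpen_lt_add (μ := (μH[(n : ℝ)] : Measure (Euc n))) hη'
  obtain ⟨δ, hδ, hδU⟩ := hS.exists_cthickening_subset_open hU hSU
  refine ⟨δ, hδ, fun u hu hclose => ?_⟩
  have hsub : LipschitzOnWith (M + 1) (fun x => u x - x) S := hu.sub LipschitzWith.id.lipschitzOnWith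
  obtain ⟨h₀, hh₀, heq⟩ := hsub.extend_finite_dimension
  set h : Euc n → Euc n := fun x => (δ / max δ ‖h₀ x‖) • h₀ x with hh
  have hhL : LipschitzWith (2 * (lipschitzExtensionConstant (Euc n) * (M + 1))) h :=
    (lipschitzWith_radialProjection hδ).comp hh₀
  have hhle : ∀ x, ‖h x‖ ≤ δ := fun x => by
    have h1 : 0 < max δ ‖h₀ x‖ := hδ.trans_le (le_max_left _ _)
    rw [hh, norm_smul, Real.norm_eq_abs, abs_of_pos (div_pos hδ h1), div_mul_eq_mul_div,
      div_le_iff₀ h1]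
    exact mul_le_mul_of_nonneg_left (le_max_right _ _) hδ.le
  have hhS : ∀ x ∈ S, x + h x = u x := fun x hx => by
    have h1 : h₀ x = u x - x := (heq hx).symm
    have h2 : max δ ‖h₀ x‖ = δ := max_eq_left (by rw [h1]; exact hclose x hx)
    simp only [hh]
    rw [h2, div_self hδ.ne', one_smul, h1, add_sub_cancel]
  set v : Euc n → Euc n := fun x => x + h x
  have hv : LipschitzWith M' v := LipschitzWith.id.add hhL
  have hcover : S ⊆ v '' S ∪ v '' (U \ S) := by
    intro y hy
    obtain ⟨x, hx, hxy⟩ := exists_add_eq_of_norm_le hhL hδ hhle y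
    have hxU : x ∈ U := hδU (mem_cthickening_of_dist_le x y δ S hy hx)
    by_cases hxS : x ∈ S
    · exact Or.inl ⟨x, hxS, hxy⟩
    · exact Or.inr ⟨x, ⟨hxU, hxS⟩, hxy⟩
  have himg : v '' S = u '' S := image_congr hhS
  have hdiff : μH[(n : ℝ)] (U \ S) ≤ η' := by
    rw [measure_sdiff hSU hS.isClosed.measurableSet.nullMeasurableSet hS.measure_lt_top.ne]
    exact tsub_le_iff_left.2 hUμ.le
  calc μH[(n : ℝ)] S ≤ μH[(n : ℝ)] (v '' S) + μH[(n : ℝ)] (v '' (U \ S)) :=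
        (measure_mono hcover).trans (measure_union_le _ _)
    _ ≤ μH[(n : ℝ)] (u '' S) + (M' : ℝ≥0∞) ^ (n : ℝ) * η' := by
        rw [himg]
        gcongr
        exact (hv.hausdorffMeasure_image_le n.cast_nonneg _).trans (by gcongr)
    _ ≤ μH[(n : ℝ)] (u '' S) + η := by
        gcongr
        exact ENNReal.mul_div_le

theorem exists_delta_hausdorffMeasure_image_le {α : Type*} [MetricSpace α] {n m : ℕ} {C : Set α}
    (hC : IsCompact C) {φ : α → Euc m} (hφ : ContinuousOn φ C) {p : Euc m → Euc n}
    (hp : LipschitzWith 1 p) {a b : NNReal}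
    (ha : ∀ x ∈ C, ∀ y ∈ C, dist (φ x) (φ y) ≤ a * dist (p (φ x)) (p (φ y)))
    (hb : ∀ x ∈ C, ∀ y ∈ C, dist x y ≤ b * dist (φ x) (φ y))
    (L : NNReal) {η : ℝ≥0∞} (hη : η ≠ 0) :
    ∃ δ > (0 : ℝ), ∀ γ : α → Euc m, LipschitzOnWith L γ C → (∀ x ∈ C, ‖γ x - φ x‖ ≤ δ) →
      μH[(n : ℝ)] (φ '' C) ≤ (a : ℝ≥0∞) ^ (n : ℝ) * (μH[(n : ℝ)] (γ '' C) + η) := by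
  rcases C.eq_empty_or_nonempty with rfl | ⟨x₀, hx₀⟩
  · exact ⟨1, one_pos, by simp⟩
  have : Nonempty α := ⟨x₀⟩
  set q : α → Euc n := fun x => p (φ x) with hq
  set r : Euc n → α := Function.invFunOn q C
  have hrC : ∀ z ∈ q '' C, r z ∈ C := fun z hz => Function.invFunOn_mem hz
  have hqr : ∀ z ∈ q '' C, q (r z) = z := fun z hz => Function.invFunOn_eq hz
  have hrq : ∀ x ∈ C, r (q x) = x := fun x hx => by
    have hz : q x ∈ q '' C := ⟨x, hx, rfl⟩
    have h1 := ha _ (hrC _ hz) x hx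
    have h2 := hb _ (hrC _ hz) x hx
    have h3 : dist (p (φ (r (q x)))) (p (φ x)) = 0 := by
      rw [dist_eq_zero]
      exact hqr _ hz
    rw [h3, mul_zero] at h1
    have h4 : dist (φ (r (q x))) (φ x) = 0 := le_antisymm h1 dist_nonneg
    rw [h4, mul_zero] at h2
    exact dist_le_zero.1 h2
  have hφr : LipschitzOnWith a (fun z => φ (r z)) (q '' C) := by
    refine LipschitzOnWith.of_dist_le_mul fun z hz w hw => ?_
    have := ha _ (hrC z hz) _ (hrC w hw)
    rwa [show p (φ (r z)) = z from hqr z hz, show p (φ (r w)) = w from hqr w hw] at this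
  have hr : LipschitzOnWith (b * a) r (q '' C) := by
    refine LipschitzOnWith.of_dist_le_mul fun z hz w hw => ?_
    have h1 := hb _ (hrC z hz) _ (hrC w hw)
    have h2 := hφr.dist_le_mul z hz w hw
    rw [NNReal.coe_mul, mul_assoc]
    exact h1.trans (mul_le_mul_of_nonneg_left h2 b.2)
  have hS : IsCompact (q '' C) := hC.image_of_continuousOn (hp.continuous.comp_continuousOn hφ)
  obtain ⟨δ, hδ, H⟩ := exists_delta_hausdorffMeasure_le_image hS (1 * (L * (b * a))) hη
  refine ⟨δ, hδ, fun γ hγ hclose => ?_⟩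
  have hu : LipschitzOnWith (1 * (L * (b * a))) (fun z => p (γ (r z))) (q '' C) :=
    hp.comp_lipschitzOnWith (hγ.comp hr hrC)
  have h1 := H _ hu fun z hz => by
    nth_rw 2 [← hqr z hz]
    refine (hp.norm_sub_le _ _).trans ?_
    simpa using hclose _ (hrC z hz)
  have h2 : φ '' C = (fun z => φ (r z)) '' (q '' C) := by
    rw [image_image]
    exact image_congr fun x hx => by rw [hrq x hx]
  have h3 : (fun z => p (γ (r z))) '' (q '' C) = p '' (γ '' C) := by
    rw [image_image, image_image]
    exact image_congr fun x hx => by rw [hrq x hx]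
  rw [h2]
  refine (hφr.hausdorffMeasure_image_le n.cast_nonneg).trans ?_
  gcongr
  refine h1.trans ?_
  rw [h3]
  gcongr
  simpa using hp.hausdorffMeasure_image_le (d := n) n.cast_nonneg (γ '' C)

theorem norm_le_mul_norm_fderiv_of_density_one {n m : ℕ} {F : Set (Euc n)} {Φ : Euc n → Euc m}
    {c : ℝ} (hc : 0 ≤ c) {x : Euc n}
    (hΦ : ∀ y ∈ F, dist y x ≤ c * dist (Φ y) (Φ x))
    {D : Euc n →L[ℝ] Euc m} (hD : HasFDerivAt Φ D x)
    (hx : Tendsto (fun r => (μH[(n : ℝ)] : Measure (Euc n)) (F ∩ closedBall x r) /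
      (μH[(n : ℝ)] : Measure (Euc n)) (closedBall x r)) (𝓝[>] 0) (𝓝 1)) (v : Euc n) :
    ‖v‖ ≤ c * ‖D v‖ := by
  have key : ∀ ε : ℝ, 0 < ε → ‖v‖ - ε ≤ c * (‖D v‖ + ‖D‖ * ε + ε * (‖v‖ + ε)) := by
    intro ε hε
    have h1 := Measure.eventually_nonempty_inter_smul_of_density_one μH[(n : ℝ)] F x hx
      (closedBall v ε) measurableSet_closedBall (measure_closedBall_pos _ v hε).ne'
    obtain ⟨ρ, hρ, hball⟩ := Metric.eventually_nhds_iff.1 (hD.isLittleO.def hε)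
    have h2 : ∀ᶠ r : ℝ in 𝓝[>] 0, r * (‖v‖ + ε) < ρ := by
      have : Tendsto (fun r : ℝ => r * (‖v‖ + ε)) (𝓝[>] 0) (𝓝 (0 * (‖v‖ + ε))) :=
        ((continuous_id.mul continuous_const).tendsto 0).mono_left nhdsWithin_le_nhds
      rw [zero_mul] at this
      exact this.eventually_lt_const hρ
    obtain ⟨r, ⟨⟨z, hzF, hz⟩, hr2⟩, hr⟩ := ((h1.and h2).and self_mem_nhdsWithin).exists
    simp only [singleton_add, mem_image, mem_smul_set] at hz
    obtain ⟨_, ⟨w, hw, rfl⟩, rfl⟩ := hz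
    rw [mem_closedBall, dist_eq_norm] at hw
    have hwv : ‖w‖ ≤ ‖v‖ + ε := by
      have := norm_sub_norm_le w v
      linarith
    have hvw : ‖v‖ - ε ≤ ‖w‖ := by
      have := norm_sub_norm_le v w
      rw [norm_sub_rev] at this
      linarith
    have hdist : ‖x + r • w - x‖ = r * ‖w‖ := by
      rw [add_sub_cancel_left, norm_smul, Real.norm_eq_abs, abs_of_pos hr]
    have h3 := @hball (x + r • w) (by
      rw [dist_eq_norm, hdist]
      exact (mul_le_mul_of_nonneg_left hwv hr.le).trans_lt hr2)
    have h4 := hΦ _ hzF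
    rw [dist_eq_norm, dist_eq_norm, hdist] at h4
    rw [hdist, add_sub_cancel_left, map_smul] at h3
    have h5 : ‖Φ (x + r • w) - Φ x‖ ≤ r * ‖D w‖ + ε * (r * ‖w‖) := by
      have := norm_sub_norm_le (Φ (x + r • w) - Φ x) (r • D w)
      rw [norm_smul, Real.norm_eq_abs, abs_of_pos hr] at this
      linarith
    have h6 : r * ‖w‖ ≤ r * (c * (‖D w‖ + ε * ‖w‖)) :=
      h4.trans ((mul_le_mul_of_nonneg_left h5 hc).trans_eq (by ring))
    have h7 := le_of_mul_le_mul_left h6 hr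
    have h8 : ‖D w‖ ≤ ‖D v‖ + ‖D‖ * ε := by
      have h9 := norm_sub_norm_le (D w) (D v)
      rw [← map_sub] at h9
      have h10 := (D.le_opNorm (w - v)).trans (mul_le_mul_of_nonneg_left hw (norm_nonneg D))
      linarith
    refine hvw.trans (h7.trans (mul_le_mul_of_nonneg_left ?_ hc))
    gcongr
  have hl : Tendsto (fun ε : ℝ => ‖v‖ - ε) (𝓝[>] 0) (𝓝 (‖v‖ - 0)) :=
    (Continuous.tendsto (by fun_prop) 0).mono_left nhdsWithin_le_nhds
  have hr : Tendsto (fun ε : ℝ => c * (‖D v‖ + ‖D‖ * ε + ε * (‖v‖ + ε))) (𝓝[>] 0)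
      (𝓝 (c * (‖D v‖ + ‖D‖ * 0 + 0 * (‖v‖ + 0)))) :=
    (Continuous.tendsto (by fun_prop) 0).mono_left nhdsWithin_le_nhds
  have := le_of_tendsto_of_tendsto hl hr (by
    filter_upwards [self_mem_nhdsWithin] with ε hε using key ε hε)
  simpa using this

theorem exists_norm_le_one_isometry_on_range {n m : ℕ} {A : Euc n →L[ℝ] Euc m} {c : ℝ}
    (hA : ∀ v, ‖v‖ ≤ c * ‖A v‖) :
    ∃ p : Euc m →L[ℝ] Euc n, LipschitzWith 1 p ∧ ∀ v, ‖p (A v)‖ = ‖A v‖ := by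
  set V := LinearMap.range (A : Euc n →ₗ[ℝ] Euc m)
  have hinj : Function.Injective (A : Euc n →ₗ[ℝ] Euc m) := by
    refine (injective_iff_map_eq_zero _).2 fun v hv => ?_
    have h1 := hA v
    rw [show A v = 0 from hv, norm_zero, mul_zero] at h1
    exact norm_le_zero_iff.1 h1
  have hV : Module.finrank ℝ V = n := by
    rw [LinearMap.finrank_range_of_inj hinj, finrank_euclideanSpace_fin]
  set e : V ≃ₗᵢ[ℝ] Euc n := ((stdOrthonormalBasis ℝ V).reindex (finCongr hV)).repr
  refine ⟨(e.toContinuousLinearEquiv : V →L[ℝ] Euc n).comp V.orthogonalProjectionOnto, ?_, ?_⟩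
  · have := e.isometry.lipschitz.comp (V.lipschitzWith_orthogonalProjectionOnto)
    rw [one_mul] at this
    exact this
  · intro v
    have h1 : V.orthogonalProjectionOnto (A v) = ⟨A v, v, rfl⟩ :=
      V.orthogonalProjectionOnto_mem_subspace_eq_self ⟨A v, v, rfl⟩
    change ‖e (V.orthogonalProjectionOnto (A v))‖ = _
    rw [e.norm_map, h1]
    rfl

/-- Up to small measure, a compact set on which a Lipschitz map is biLipschitz is a finite union of
disjoint compact sets whose images are almost flat. -/
theorem exists_compact_pieces_almost_flat {n m : ℕ} {F : Set (Euc n)} (hF : IsCompact F)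
    {Φ : Euc n → Euc m} {CΦ c : NNReal} (hΦ : LipschitzWith CΦ Φ)
    (hc : ∀ x ∈ F, ∀ y ∈ F, dist x y ≤ c * dist (Φ x) (Φ y)) {a : NNReal} (ha : 1 < a)
    {τ : ℝ≥0∞} (hτ : τ ≠ 0) :
    ∃ (N : ℕ) (C : ℕ → Set (Euc n)), (∀ k, IsCompact (C k)) ∧ (∀ k, C k ⊆ F) ∧
      Pairwise (Function.onFun Disjoint C) ∧
      (∀ k < N, ∃ p : Euc m → Euc n, LipschitzWith 1 p ∧
        ∀ x ∈ C k, ∀ y ∈ C k, dist (Φ x) (Φ y) ≤ a * dist (p (Φ x)) (p (Φ y))) ∧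
      μH[(n : ℝ)] (F \ ⋃ k < N, C k) < τ := by
  set μ : Measure (Euc n) := μH[(n : ℝ)]
  have hae : ∀ᵐ x ∂μ.restrict F, DifferentiableAt ℝ Φ x ∧ ∀ v, ‖v‖ ≤ c * ‖fderiv ℝ Φ x v‖ := by
    filter_upwards [ae_restrict_of_ae (s := F) (hΦ.ae_differentiableAt (μ := μ)),
      Besicovitch.ae_tendsto_measure_inter_div μ F, ae_restrict_mem hF.measurableSet]
      with x hx hxd hxF
    exact ⟨hx, norm_le_mul_norm_fderiv_of_density_one c.2 (fun y hy => hc y hy x hxF)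
      hx.hasFDerivAt hxd⟩
  rw [ae_restrict_iff' hF.measurableSet, ae_iff] at hae
  obtain ⟨Z, hZsub, hZm, hZ0⟩ := exists_measurable_superset_of_null hae
  set s := F \ Z
  have hsm : MeasurableSet s := hF.measurableSet.diff hZm
  have hs : ∀ x ∈ s, DifferentiableAt ℝ Φ x ∧ ∀ v, ‖v‖ ≤ c * ‖fderiv ℝ Φ x v‖ := by
    intro x hx
    by_contra h
    exact hx.2 (hZsub fun h' => h (h' hx.1))
  rcases s.eq_empty_or_nonempty with hse | hsne
  · refine ⟨0, fun _ => ∅, by simp, by simp, fun i j _ => by simp [Function.onFun], by simp, ?_⟩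
    have hFZ : F ⊆ Z := sdiff_eq_empty.1 hse
    have : μ F = 0 := measure_mono_null hFZ hZ0
    simpa [this] using pos_iff_ne_zero.2 hτ
  set ε : ℝ := (1 - (a : ℝ)⁻¹) / (2 * (c + 1))
  have ha' : (1 : ℝ) < a := by exact_mod_cast ha
  have hinv : (a : ℝ)⁻¹ < 1 := inv_lt_one_of_one_lt₀ ha'
  have hc1 : (0 : ℝ) < c + 1 := by positivity
  have hε : 0 < ε := div_pos (by linarith) (by positivity)
  have hεc : 2 * ε * c ≤ 1 - (a : ℝ)⁻¹ := by
    have h1 : ε * (2 * (c + 1)) = 1 - (a : ℝ)⁻¹ := div_mul_cancel₀ _ (by positivity)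
    nlinarith
  obtain ⟨t, A, htd, htm, hst, happ, hA⟩ :=
    exists_partition_approximatesLinearOn_of_hasFDerivWithinAt Φ s (fderiv ℝ Φ)
      (fun x hx => (hs x hx).1.hasFDerivAt.hasFDerivWithinAt) (fun _ => ⟨ε, hε.le⟩)
      (fun _ h => hε.ne' (congrArg NNReal.toReal h))
  obtain ⟨τ', hτ'pos, hτ'sum⟩ := ENNReal.exists_pos_sum_of_countable' hτ ℕ
  have hsfin : ∀ k, μ (s ∩ t k) ≠ ∞ := fun k =>
    ((measure_mono (inter_subset_left.trans sdiff_subset)).trans_lt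
      (hF.measure_lt_top (μ := μ))).ne
  have hexC : ∀ k, ∃ C ⊆ s ∩ t k, IsCompact C ∧ μ ((s ∩ t k) \ C) < τ' k := fun k =>
    (hsm.inter (htm k)).exists_isCompact_sdiff_lt (hsfin k) (hτ'pos k).ne'
  choose C hCsub hCc hCμ using hexC
  have hCF : ∀ k, C k ⊆ F := fun k => (hCsub k).trans (inter_subset_left.trans sdiff_subset)
  have hlim : Tendsto (fun N : ℕ => μ (F \ ⋃ k < N, C k)) atTop
      (𝓝 (μ (⋂ N : ℕ, F \ ⋃ k < N, C k))) := by
    refine tendsto_measure_iInter_atTop (fun N => ?_) (fun i j hij => ?_) ⟨0, ?_⟩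
    · exact (hF.measurableSet.diff (MeasurableSet.iUnion fun k => MeasurableSet.iUnion fun _ =>
        (hCc k).measurableSet)).nullMeasurableSet
    · refine sdiff_subset_sdiff_right ?_
      exact biUnion_subset_biUnion_left fun k hk => lt_of_lt_of_le hk hij
    · exact ((measure_mono sdiff_subset).trans_lt hF.measure_lt_top).ne
  have hlt : μ (⋂ N : ℕ, F \ ⋃ k < N, C k) < τ := by
    have hsub : (⋂ N : ℕ, F \ ⋃ k < N, C k) ⊆ Z ∪ ⋃ k, (s ∩ t k) \ C k := by
      intro x hx
      rw [mem_iInter] at hx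
      by_cases hxZ : x ∈ Z
      · exact Or.inl hxZ
      · have hxs : x ∈ s := ⟨(hx 0).1, hxZ⟩
        obtain ⟨k, hk⟩ := mem_iUnion.1 (hst hxs)
        refine Or.inr (mem_iUnion.2 ⟨k, ⟨hxs, hk⟩, fun hxC => ?_⟩)
        exact (hx (k + 1)).2 (mem_iUnion₂.2 ⟨k, k.lt_succ_self, hxC⟩)
    calc μ (⋂ N : ℕ, F \ ⋃ k < N, C k) ≤ μ Z + ∑' k, μ ((s ∩ t k) \ C k) :=
          (measure_mono hsub).trans ((measure_union_le _ _).trans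
            (by gcongr; exact measure_iUnion_le _))
      _ ≤ ∑' k, τ' k := by
          rw [hZ0, zero_add]
          exact ENNReal.tsum_le_tsum fun k => (hCμ k).le
      _ < τ := hτ'sum
  obtain ⟨N, hN⟩ := (hlim.eventually_lt_const hlt).exists
  refine ⟨N, C, hCc, hCF, fun i j hij => ?_, fun k _ => ?_, hN⟩
  · exact (htd hij).mono ((hCsub i).trans inter_subset_right) ((hCsub j).trans inter_subset_right)
  · obtain ⟨y₀, hy₀, hAy⟩ := hA hsne k
    obtain ⟨p, hp, hpA⟩ := exists_norm_le_one_isometry_on_range (A := A k) (c := c)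
      (by rw [hAy]; exact (hs y₀ hy₀).2)
    refine ⟨p, hp, fun x hx y hy => ?_⟩
    have h1 : ‖Φ x - Φ y - A k (x - y)‖ ≤ ε * ‖x - y‖ :=
      happ k x (hCsub k hx) y (hCsub k hy)
    have h2 : ‖x - y‖ ≤ c * ‖Φ x - Φ y‖ := by
      simpa [dist_eq_norm] using hc x (hCF k hx) y (hCF k hy)
    have h3 : ‖A k (x - y)‖ ≤ ‖p (Φ x - Φ y)‖ + ε * ‖x - y‖ := by
      rw [← hpA]
      have h4 : ‖p (A k (x - y)) - p (Φ x - Φ y)‖ ≤ ‖Φ x - Φ y - A k (x - y)‖ := by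
        rw [norm_sub_rev (Φ x - Φ y)]
        simpa using hp.norm_sub_le (A k (x - y)) (Φ x - Φ y)
      have := norm_sub_norm_le (p (A k (x - y))) (p (Φ x - Φ y))
      linarith
    have h5 : ‖Φ x - Φ y‖ ≤ ‖A k (x - y)‖ + ε * ‖x - y‖ := by
      have := norm_sub_norm_le (Φ x - Φ y) (A k (x - y))
      linarith
    rw [dist_eq_norm, dist_eq_norm, ← map_sub]
    have h6 : (a : ℝ)⁻¹ * ‖Φ x - Φ y‖ ≤ ‖p (Φ x - Φ y)‖ := by
      have h7 := mul_le_mul_of_nonneg_left h2 hε.le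
      have h8 := mul_le_mul_of_nonneg_right hεc (norm_nonneg (Φ x - Φ y))
      linarith
    rwa [inv_mul_le_iff₀ (by linarith)] at h6

theorem exists_pos_of_forall_finset_exists_pos {ι : Type*} (s : Finset ι) {P : ι → ℝ → Prop}
    (hmono : ∀ i, ∀ δ δ', δ' ≤ δ → P i δ → P i δ') (h : ∀ i ∈ s, ∃ δ > (0 : ℝ), P i δ) :
    ∃ δ > (0 : ℝ), ∀ i ∈ s, P i δ := by
  have h1 : ∀ᶠ δ in 𝓝[>] (0 : ℝ), ∀ i ∈ s, P i δ := by
    refine (Filter.eventually_all_finset s).2 fun i hi => ?_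
    obtain ⟨δ, hδ, hP⟩ := h i hi
    filter_upwards [Ioc_mem_nhdsGT hδ] with δ' hδ'
    exact hmono i δ δ' hδ'.2 hP
  obtain ⟨δ, hδ, hpos⟩ := (h1.and self_mem_nhdsWithin).exists
  exact ⟨δ, hpos, hδ⟩

theorem exists_delta_disjoint_image {α β : Type*} [MetricSpace α] [NormedAddCommGroup β]
    {C C' : Set α} (hC : IsCompact C) (hC' : IsCompact C') (hd : Disjoint C C') {φ : α → β}
    {c : NNReal} (hc : ∀ x ∈ C, ∀ y ∈ C', dist x y ≤ c * dist (φ x) (φ y)) :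
    ∃ δ > (0 : ℝ), ∀ γ : α → β, (∀ x ∈ C ∪ C', ‖γ x - φ x‖ ≤ δ) →
      Disjoint (γ '' C) (γ '' C') := by
  obtain ⟨r, hr, hsep⟩ := Metric.exists_pos_forall_lt_edist hC hC'.isClosed hd
  have hc1 : (0 : ℝ) < c + 1 := by positivity
  refine ⟨r / (2 * (c + 1)), by positivity, fun γ hγ => ?_⟩
  rw [Set.disjoint_left]
  rintro _ ⟨x, hx, rfl⟩ ⟨y, hy, hxy⟩
  have h1 := hγ x (Or.inl hx)
  have h2 := hγ y (Or.inr hy)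
  have h3 := hc x hx y hy
  have h4 : dist (φ x) (φ y) ≤ 2 * (r / (2 * (c + 1))) := by
    have h5 : φ x - φ y = (γ y - φ y) - (γ x - φ x) := by
      rw [hxy]
      abel
    rw [dist_eq_norm, h5]
    exact (norm_sub_le _ _).trans (by linarith)
  have h6 : (r : ℝ) < dist x y := by
    have := hsep x hx y hy
    rw [edist_nndist] at this
    exact_mod_cast this
  have h7 : (2 : ℝ) * (r / (2 * (c + 1))) * (c + 1) = r := by field_simp
  have h8 : c * dist (φ x) (φ y) ≤ c * (2 * (r / (2 * (c + 1)))) :=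
    mul_le_mul_of_nonneg_left h4 c.2
  have h9 : (0 : ℝ) ≤ 2 * (r / (2 * (c + 1))) := by positivity
  linarith

theorem exists_one_lt_pow_mul_le (n : ℕ) {η : ℝ} (hη₂ : η < 1) :
    ∃ a : NNReal, 1 < a ∧ (a : ℝ) ^ n * η ≤ (1 + η) / 2 := by
  have h1 : Tendsto (fun a : NNReal => (a : ℝ) ^ n * η) (𝓝[>] 1) (𝓝 (((1 : NNReal) : ℝ) ^ n * η)) :=
    (Continuous.tendsto (by fun_prop) 1).mono_left nhdsWithin_le_nhds
  have h2 : ((1 : NNReal) : ℝ) ^ n * η < (1 + η) / 2 := by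
    simp
    linarith
  obtain ⟨a, ha, ha1⟩ := ((h1.eventually_lt_const h2).and self_mem_nhdsWithin).exists
  exact ⟨a, ha1, ha.le⟩

/-- Lower semicontinuity of the Hausdorff measure of the image of a compact subset of `ℝ^n`, at a
biLipschitz map, along equi-Lipschitz uniform convergence. -/
theorem exists_delta_mul_hausdorffMeasure_image_le {n m : ℕ} {F : Set (Euc n)} (hF : IsCompact F)
    {Φ : Euc n → Euc m} {CΦ c : NNReal} (hΦ : LipschitzWith CΦ Φ)
    (hc : ∀ x ∈ F, ∀ y ∈ F, dist x y ≤ c * dist (Φ x) (Φ y)) (L : NNReal) {η : ℝ} (hη₁ : 0 < η)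
    (hη₂ : η < 1) :
    ∃ δ > (0 : ℝ), ∀ γ : Euc n → Euc m, LipschitzOnWith L γ F → (∀ x ∈ F, ‖γ x - Φ x‖ ≤ δ) →
      ENNReal.ofReal η * μH[(n : ℝ)] (Φ '' F) ≤ μH[(n : ℝ)] (γ '' F) := by
  set A := μH[(n : ℝ)] (Φ '' F) with hA
  have hCtop : ∀ a : NNReal, (a : ℝ≥0∞) ^ (n : ℝ) ≠ ∞ := fun a => by
    rw [ENNReal.rpow_natCast]
    exact ENNReal.pow_ne_top ENNReal.coe_ne_top
  have hAtop : A ≠ ∞ := by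
    refine ne_top_of_le_ne_top ?_ (hΦ.hausdorffMeasure_image_le n.cast_nonneg F)
    exact ENNReal.mul_ne_top (hCtop _) hF.measure_lt_top.ne
  by_cases hA0 : A = 0
  · exact ⟨1, one_pos, fun γ _ _ => by simp [hA0]⟩
  obtain ⟨a, ha, haη⟩ := exists_one_lt_pow_mul_le n hη₂
  set B : ℝ≥0∞ := ENNReal.ofReal ((1 - η) / 2) * A with hB
  have hB0 : B / 2 ≠ 0 := by
    have h1 : ENNReal.ofReal ((1 - η) / 2) ≠ 0 := by
      rw [Ne, ENNReal.ofReal_eq_zero, not_le]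
      linarith
    exact ENNReal.div_ne_zero.2 ⟨mul_ne_zero h1 hA0, by simp⟩
  obtain ⟨N, C, hCc, hCF, hCd, hCp, hCτ⟩ := exists_compact_pieces_almost_flat hF hΦ hc ha
    (τ := B / 2 / (CΦ : ℝ≥0∞) ^ (n : ℝ)) (ENNReal.div_ne_zero.2 ⟨hB0, hCtop _⟩)
  set η₀ : ℝ≥0∞ := B / 2 / ((a : ℝ≥0∞) ^ (n : ℝ) * N)
  have hη₀ : η₀ ≠ 0 :=
    ENNReal.div_ne_zero.2 ⟨hB0, ENNReal.mul_ne_top (hCtop _) (ENNReal.natCast_ne_top N)⟩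
  obtain ⟨δ₁, hδ₁, H₁⟩ := exists_pos_of_forall_finset_exists_pos (Finset.range N)
    (P := fun k δ => ∀ γ : Euc n → Euc m, LipschitzOnWith L γ F → (∀ x ∈ F, ‖γ x - Φ x‖ ≤ δ) →
      μH[(n : ℝ)] (Φ '' C k) ≤ (a : ℝ≥0∞) ^ (n : ℝ) * (μH[(n : ℝ)] (γ '' C k) + η₀))
    (fun k δ δ' hδ h γ hγ hcl => h γ hγ fun x hx => (hcl x hx).trans hδ)
    (fun k hk => by
      obtain ⟨p, hp, hpa⟩ := hCp k (Finset.mem_range.1 hk)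
      obtain ⟨δ, hδ, H⟩ := exists_delta_hausdorffMeasure_image_le (hCc k)
        hΦ.continuous.continuousOn hp hpa
        (fun x hx y hy => hc x (hCF k hx) y (hCF k hy)) L hη₀
      exact ⟨δ, hδ, fun γ hγ hcl => H γ (hγ.mono (hCF k)) fun x hx => hcl x (hCF k hx)⟩)
  obtain ⟨δ₂, hδ₂, H₂⟩ := exists_pos_of_forall_finset_exists_pos
    (Finset.range N ×ˢ Finset.range N)
    (P := fun k δ => ∀ γ : Euc n → Euc m, (∀ x ∈ F, ‖γ x - Φ x‖ ≤ δ) → k.1 ≠ k.2 →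
      Disjoint (γ '' C k.1) (γ '' C k.2))
    (fun k δ δ' hδ h γ hcl => h γ fun x hx => (hcl x hx).trans hδ)
    (fun k _ => by
      by_cases hk : k.1 = k.2
      · exact ⟨1, one_pos, fun γ _ h => absurd hk h⟩
      obtain ⟨δ, hδ, H⟩ := exists_delta_disjoint_image (hCc k.1) (hCc k.2) (hCd hk)
        (fun x hx y hy => hc x (hCF _ hx) y (hCF _ hy))
      exact ⟨δ, hδ, fun γ hcl _ => H γ fun x hx => hcl x (union_subset (hCF _) (hCF _) hx)⟩)
  refine ⟨min δ₁ δ₂, lt_min hδ₁ hδ₂, fun γ hγ hcl => ?_⟩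
  set G := μH[(n : ℝ)] (γ '' F)
  have hsum : ∑ k ∈ Finset.range N, μH[(n : ℝ)] (γ '' C k) ≤ G := by
    rw [← measure_biUnion_finset]
    · refine measure_mono (iUnion₂_subset fun k _ => image_mono (hCF k))
    · intro i hi j hj hij
      exact H₂ (i, j) (Finset.mk_mem_product hi hj) γ
        (fun x hx => (hcl x hx).trans (min_le_right _ _)) hij
    · intro k _
      exact ((hCc k).image_of_continuousOn (hγ.continuousOn.mono (hCF k))).measurableSet
  have hcover : Φ '' F ⊆ (⋃ k ∈ Finset.range N, Φ '' C k) ∪ Φ '' (F \ ⋃ k < N, C k) := by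
    rintro _ ⟨x, hx, rfl⟩
    by_cases hxC : x ∈ ⋃ k < N, C k
    · obtain ⟨k, hk, hxk⟩ := mem_iUnion₂.1 hxC
      exact Or.inl (mem_iUnion₂.2 ⟨k, Finset.mem_range.2 hk, x, hxk, rfl⟩)
    · exact Or.inr ⟨x, ⟨hx, hxC⟩, rfl⟩
  have hmain : A ≤ (a : ℝ≥0∞) ^ (n : ℝ) * G + B := by
    calc A ≤ ∑ k ∈ Finset.range N, μH[(n : ℝ)] (Φ '' C k) +
          μH[(n : ℝ)] (Φ '' (F \ ⋃ k < N, C k)) :=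
          (measure_mono hcover).trans ((measure_union_le _ _).trans
            (by gcongr; exact measure_biUnion_finset_le _ _))
      _ ≤ ∑ k ∈ Finset.range N, (a : ℝ≥0∞) ^ (n : ℝ) * (μH[(n : ℝ)] (γ '' C k) + η₀) +
          (CΦ : ℝ≥0∞) ^ (n : ℝ) * (B / 2 / (CΦ : ℝ≥0∞) ^ (n : ℝ)) := by
          gcongr with k hk
          · exact H₁ k hk γ hγ fun x hx => (hcl x hx).trans (min_le_left _ _)
          · exact (hΦ.hausdorffMeasure_image_le n.cast_nonneg _).trans (by gcongr)
      _ = (a : ℝ≥0∞) ^ (n : ℝ) * ∑ k ∈ Finset.range N, μH[(n : ℝ)] (γ '' C k) +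
          (a : ℝ≥0∞) ^ (n : ℝ) * N * η₀ +
          (CΦ : ℝ≥0∞) ^ (n : ℝ) * (B / 2 / (CΦ : ℝ≥0∞) ^ (n : ℝ)) := by
          rw [← Finset.mul_sum, Finset.sum_add_distrib, mul_add, Finset.sum_const,
            Finset.card_range, nsmul_eq_mul, mul_assoc ((a : ℝ≥0∞) ^ (n : ℝ))]
      _ ≤ (a : ℝ≥0∞) ^ (n : ℝ) * G + B / 2 + B / 2 := by
          gcongr
          · exact ENNReal.mul_div_le
          · exact ENNReal.mul_div_le
      _ = (a : ℝ≥0∞) ^ (n : ℝ) * G + B := by rw [add_assoc, ENNReal.add_halves]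
  by_cases hG : G = ∞
  · rw [hG]
    exact le_top
  have hBtop : B ≠ ∞ := ENNReal.mul_ne_top ENNReal.ofReal_ne_top hAtop
  have hreal := ENNReal.toReal_mono
    (ENNReal.add_ne_top.2 ⟨ENNReal.mul_ne_top (hCtop a) hG, hBtop⟩) hmain
  rw [ENNReal.toReal_add (ENNReal.mul_ne_top (hCtop a) hG) hBtop, hB, ENNReal.toReal_mul,
    ENNReal.toReal_mul, ENNReal.toReal_ofReal (by linarith), ENNReal.rpow_natCast,
    ENNReal.toReal_pow, ENNReal.coe_toReal] at hreal
  rw [← ENNReal.toReal_le_toReal (ENNReal.mul_ne_top ENNReal.ofReal_ne_top hAtop) hG,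
    ENNReal.toReal_mul, ENNReal.toReal_ofReal hη₁.le]
  have hapos : (0 : ℝ) < (a : ℝ) ^ n := by
    have : (0 : ℝ) < a := by exact_mod_cast zero_lt_one.trans ha
    positivity
  refine le_of_mul_le_mul_left ?_ hapos
  have h1 := mul_le_mul_of_nonneg_right haη (ENNReal.toReal_nonneg (a := A))
  linarith

/-- Let `K` be a compact metric space admitting a biLipschitz bijection
`I : F → K` from some `F ⊆ ℝ^n`, let `f : K → ℝ^m` be biLipschitz, and `L ≥ 0`. For every
`η ∈ (0,1)` there is `δ > 0` such that every `L`-Lipschitz `g : K → ℝ^m` with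
`sup_K ‖g − f‖ ≤ δ` satisfies `H^n(g(K)) ≥ η H^n(f(K))`. -/
theorem stmt9 (n m : ℕ) (hnm : n ≤ m)
    (K : Type*) [MetricSpace K] [CompactSpace K]
    (F : Set (Euc n)) (I : Euc n → K) (CI CI' : NNReal)
    (hIlip : LipschitzOnWith CI I F) (hIsurj : I '' F = univ)
    (hIinv : ∀ x ∈ F, ∀ y ∈ F, dist x y ≤ (CI' : ℝ) * dist (I x) (I y))
    (f : K → Euc m) (Cf Cf' : NNReal)
    (hflip : LipschitzWith Cf f) (hfanti : AntilipschitzWith Cf' f)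
    (L : NNReal) (η : ℝ) (hη₁ : 0 < η) (hη₂ : η < 1) :
    ∃ δ > (0 : ℝ), ∀ g : K → Euc m, LipschitzWith L g →
      (∀ x, ‖g x - f x‖ ≤ δ) →
      ENNReal.ofReal η * μH[n] (Set.range f) ≤ μH[n] (Set.range g) := by
  have hex : ∀ k : K, ∃ x ∈ F, I x = k := fun k => by
    have : k ∈ I '' F := hIsurj ▸ mem_univ k
    exact this
  choose J hJF hIJ using hex
  have hJ : LipschitzWith CI' J := LipschitzWith.of_dist_le_mul fun k l => by
    simpa [hIJ] using hIinv _ (hJF k) _ (hJF l)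
  have hJI : ∀ x ∈ F, J (I x) = x := fun x hx => by
    have h1 := hIinv _ (hJF (I x)) x hx
    rw [hIJ, dist_self, mul_zero] at h1
    exact dist_le_zero.1 h1
  have hrange : range J = F :=
    Subset.antisymm (range_subset_iff.2 hJF) fun x hx => ⟨I x, hJI x hx⟩
  have hF : IsCompact F := hrange ▸ isCompact_range hJ.continuous
  have hfI : LipschitzOnWith (Cf * CI) (fun x => f (I x)) F := hflip.comp_lipschitzOnWith hIlip
  obtain ⟨Φ, hΦ, heq⟩ := hfI.extend_finite_dimension
  have hrange_eq : ∀ g : K → Euc m, range g = (fun x => g (I x)) '' F := fun g => by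
    rw [← image_univ, ← hIsurj, image_image]
  obtain ⟨δ, hδ, H⟩ := exists_delta_mul_hausdorffMeasure_image_le hF hΦ (c := CI' * Cf')
    (fun x hx y hy => by
      rw [← heq hx, ← heq hy, NNReal.coe_mul, mul_assoc]
      exact (hIinv x hx y hy).trans
        (mul_le_mul_of_nonneg_left (hfanti.le_mul_dist _ _) CI'.2)) (L * CI) hη₁ hη₂
  refine ⟨δ, hδ, fun g hg hclose => ?_⟩
  rw [hrange_eq f, hrange_eq g, heq.image_eq]
  exact H _ (hg.comp_lipschitzOnWith hIlip) fun x hx => by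
    rw [← heq hx]
    exact hclose _
end
end
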